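/- Let K be a global function field of characteristic different from 2, i.e. a finite extension of 𝔽_q(t) where q is odd, and let m ≥ 1 be a natural number. Then the set {(a_{ij})_{1 ≤ i,j ≤ m} ∈ K^{m²} : the quadratic form Σ_{1 ≤ i,j ≤ m} a_{ij} x_i x_j = 0 has no nonzero solution (x₁, …, x_m) ∈ K^m} is diophantine over K. -/

import Mathlib

/-- A subset `S ⊆ K^ι` is diophantine over `K` if there are `m ∈ ℕ` and a polynomial
`f` in the variables `y_i` (`i : ι`) and `x_1, …, x_m` with coefficients in `K` such that
`a ∈ S` iff `f(a, x) = 0` has a solution `x ∈ K^m`. -/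
def IsDiophantine {K : Type*} [Field K] {ι : Type*} [Fintype ι] (S : Set (ι → K)) : Prop :=
  ∃ (m : ℕ) (f : MvPolynomial (ι ⊕ Fin m) K),
    ∀ a : ι → K, a ∈ S ↔ ∃ x : Fin m → K, MvPolynomial.eval (Sum.elim a x) f = 0

namespace GFq

/-- A normalized discrete valuation, written additively, with `ord 0 = 0` by convention. -/
structure Place (K : Type*) [Field K] where
  ord : K → ℤ
  ord_zero : ord 0 = 0
  ord_mul : ∀ x y, x ≠ 0 → y ≠ 0 → ord (x * y) = ord x + ord y
  ord_add : ∀ x y, x ≠ 0 → y ≠ 0 → x + y ≠ 0 → min (ord x) (ord y) ≤ ord (x + y)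
  surj : ∃ x, x ≠ 0 ∧ ord x = 1

namespace Place
variable {K : Type*} [Field K] (v : Place K)

@[ext] theorem ext' {v w : Place K} (h : ∀ x, v.ord x = w.ord x) : v = w := by
  cases v; cases w; congr; funext x; exact h x

/-- `x` has order at least `n`. -/
def ge (x : K) (n : ℤ) : Prop := x = 0 ∨ n ≤ v.ord x

theorem ord_one : v.ord 1 = 0 := by
  have := v.ord_mul 1 1 one_ne_zero one_ne_zero
  simp at this; exact this

theorem ord_inv (x : K) : v.ord x⁻¹ = - v.ord x := by
  by_cases hx : x = 0
  · simp [hx, v.ord_zero]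
  have := v.ord_mul x x⁻¹ hx (inv_ne_zero hx)
  rw [mul_inv_cancel₀ hx, v.ord_one] at this; omega

theorem ord_div {x y : K} (hx : x ≠ 0) (hy : y ≠ 0) : v.ord (x / y) = v.ord x - v.ord y := by
  rw [div_eq_mul_inv, v.ord_mul _ _ hx (inv_ne_zero hy), ord_inv]; ring

theorem ord_pow (x : K) (n : ℕ) : v.ord (x ^ n) = n * v.ord x := by
  by_cases hx : x = 0
  · subst hx; rcases Nat.eq_zero_or_pos n with h | h
    · simp [h, v.ord_one]
    · simp [zero_pow h.ne', v.ord_zero]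
  induction n with
  | zero => simp [v.ord_one]
  | succ n ih => rw [pow_succ, v.ord_mul _ _ (pow_ne_zero _ hx) hx, ih]; push_cast; ring

theorem ord_zpow (x : K) (n : ℤ) : v.ord (x ^ n) = n * v.ord x := by
  rcases n with n | n
  · simpa using v.ord_pow x n
  · rw [zpow_negSucc, ord_inv, ord_pow, Int.negSucc_eq]; push_cast; ring

theorem ord_neg_one : v.ord (-1) = 0 := by
  have := v.ord_mul (-1) (-1) (by simp) (by simp)
  simp [v.ord_one] at this; omega

theorem ord_neg (x : K) : v.ord (-x) = v.ord x := by
  by_cases hx : x = 0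
  · simp [hx]
  rw [← neg_one_mul, v.ord_mul _ _ (by simp) hx, ord_neg_one, zero_add]

theorem ord_prod {ι : Type*} (s : Finset ι) (f : ι → K) (h : ∀ i ∈ s, f i ≠ 0) :
    v.ord (∏ i ∈ s, f i) = ∑ i ∈ s, v.ord (f i) := by
  classical
  induction s using Finset.induction_on with
  | empty => simp [v.ord_one]
  | insert a s ha ih =>
    rw [Finset.prod_insert ha, Finset.sum_insert ha, v.ord_mul, ih]
    · intro i hi; exact h i (Finset.mem_insert_of_mem hi)
    · exact h a (Finset.mem_insert_self _ _)
    · rw [Finset.prod_ne_zero_iff]; intro i hi; exact h i (Finset.mem_insert_of_mem hi)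

variable {v}
theorem ge_zero (n : ℤ) : v.ge 0 n := Or.inl rfl
theorem ge_of_ord {x : K} {n : ℤ} (h : n ≤ v.ord x) : v.ge x n := Or.inr h
theorem ge_one : v.ge 1 0 := Or.inr v.ord_one.ge
theorem ge.mono {x : K} {n m : ℤ} (h : v.ge x n) (hm : m ≤ n) : v.ge x m :=
  h.imp id fun h => hm.trans h
theorem ge.le {x : K} {n : ℤ} (h : v.ge x n) (hx : x ≠ 0) : n ≤ v.ord x := h.resolve_left hx
theorem ge_self {x : K} : v.ge x (v.ord x) := Or.inr le_rfl

theorem ge.neg {x : K} {n : ℤ} (h : v.ge x n) : v.ge (-x) n := by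
  rcases h with h | h
  · left; simp [h]
  · right; rwa [ord_neg]

theorem ge.add {x y : K} {n : ℤ} (h : v.ge x n) (h' : v.ge y n) : v.ge (x + y) n := by
  rcases h with rfl | h
  · simpa using h'
  rcases h' with rfl | h'
  · right; simpa using h
  by_cases hx : x = 0
  · subst hx; right; simpa using h'
  by_cases hy : y = 0
  · subst hy; right; simpa using h
  by_cases hxy : x + y = 0
  · left; exact hxy
  right; exact (le_min h h').trans (v.ord_add x y hx hy hxy)

theorem ge.sub {x y : K} {n : ℤ} (h : v.ge x n) (h' : v.ge y n) : v.ge (x - y) n := by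
  rw [sub_eq_add_neg]; exact h.add h'.neg

theorem ge.mul {x y : K} {n m : ℤ} (h : v.ge x n) (h' : v.ge y m) : v.ge (x * y) (n + m) := by
  by_cases hx : x = 0
  · left; simp [hx]
  by_cases hy : y = 0
  · left; simp [hy]
  right; rw [v.ord_mul _ _ hx hy]; exact add_le_add (h.le hx) (h'.le hy)

theorem ge.mul0 {x y : K} {n : ℤ} (h : v.ge x n) (h' : v.ge y 0) : v.ge (x * y) n := by
  simpa using h.mul h'
theorem ge.mul0' {x y : K} {n : ℤ} (h : v.ge x 0) (h' : v.ge y n) : v.ge (x * y) n := by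
  simpa using h.mul h'

theorem ge.pow {x : K} (h : v.ge x 0) (n : ℕ) : v.ge (x ^ n) 0 := by
  induction n with
  | zero => simpa using ge_one
  | succ n ih => rw [pow_succ]; exact ih.mul0 h

theorem ge.sum {ι : Type*} (s : Finset ι) (f : ι → K) {n : ℤ} (h : ∀ i ∈ s, v.ge (f i) n) :
    v.ge (∑ i ∈ s, f i) n := Finset.sum_induction f (fun x => v.ge x n)
      (fun _ _ h h' => h.add h') (ge_zero n) h

theorem not_ge {x : K} {n : ℤ} : ¬ v.ge x n ↔ x ≠ 0 ∧ v.ord x < n := by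
  simp [ge, not_or]

theorem ge_sub_comm {x y : K} {n : ℤ} : v.ge (x - y) n ↔ v.ge (y - x) n :=
  ⟨fun h => by simpa using h.neg, fun h => by simpa using h.neg⟩

theorem ge_mul_iff {x y : K} {n : ℤ} (hx : x ≠ 0) : v.ge (x * y) n ↔ v.ge y (n - v.ord x) := by
  by_cases hy : y = 0
  · simp [hy, ge_zero]
  simp only [ge, mul_eq_zero, hx, hy, false_or, v.ord_mul _ _ hx hy]
  constructor <;> intro h <;> omega

theorem ge_div_iff {x y : K} {n : ℤ} (hx : x ≠ 0) : v.ge (y / x) n ↔ v.ge y (n + v.ord x) := by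
  rw [div_eq_inv_mul, ge_mul_iff (inv_ne_zero hx), ord_inv]; simp

/-- If `y` is strictly smaller than `x` then `x+y` has the order of `x`. -/
theorem ord_add_eq {x y : K} (hx : x ≠ 0) (h : v.ge y (v.ord x + 1)) :
    x + y ≠ 0 ∧ v.ord (x + y) = v.ord x := by
  have key : x + y ≠ 0 := by
    intro h0
    have : y = -x := by linear_combination h0
    rw [this] at h
    have := h.le (neg_ne_zero.2 hx)
    rw [ord_neg] at this; omega
  refine ⟨key, le_antisymm ?_ ?_⟩
  · by_contra hc
    push Not at hc
    have h1 : v.ge (x + y) (v.ord x + 1) := Or.inr hc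
    have := (h1.sub h).le (by simpa using hx)
    simp at this
  · exact (ge_self.add (h.mono (by omega))).le key

theorem ord_eq_of_sub {x y : K} (hx : x ≠ 0) (h : v.ge (y - x) (v.ord x + 1)) :
    y ≠ 0 ∧ v.ord y = v.ord x := by
  have := ord_add_eq hx h
  simpa using this

theorem unit_of_sub_one {x : K} {n : ℤ} (hn : 1 ≤ n) (h : v.ge (x - 1) n) : x ≠ 0 ∧ v.ord x = 0 := by
  have := ord_eq_of_sub (v := v) (x := 1) (y := x) one_ne_zero (by rw [ord_one]; exact h.mono hn)
  rwa [ord_one] at this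

variable (v)
theorem exists_unif : ∃ p : K, p ≠ 0 ∧ v.ord p = 1 := v.surj
theorem exists_ord (n : ℤ) : ∃ x : K, x ≠ 0 ∧ v.ord x = n := by
  obtain ⟨p, hp, h⟩ := v.surj
  exact ⟨p ^ n, zpow_ne_zero _ hp, by rw [ord_zpow, h, mul_one]⟩

/-- Valuation ring. -/
def O : Subring K where
  carrier := {x | v.ge x 0}
  mul_mem' h h' := by simpa using ge.mul h h'
  one_mem' := ge_one
  add_mem' h h' := ge.add h h'
  zero_mem' := ge_zero 0
  neg_mem' h := ge.neg h

theorem mem_O {x : K} : x ∈ v.O ↔ v.ge x 0 := Iff.rfl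

/-- Maximal ideal. -/
def I : Ideal v.O where
  carrier := {x | v.ge (x : K) 1}
  add_mem' h h' := ge.add h h'
  zero_mem' := ge_zero 1
  smul_mem' c x h := by
    change v.ge ((c : K) * x) 1
    exact ge.mul0' c.2 h

theorem mem_I {x : v.O} : x ∈ v.I ↔ v.ge (x : K) 1 := Iff.rfl

instance : v.I.IsMaximal := by
  rw [Ideal.isMaximal_iff]
  refine ⟨?_, ?_⟩
  · rw [mem_I]; intro h
    have := h.le (by simp); simp [ord_one] at this
  · intro J x hJ hx hxJ
    rw [mem_I, not_ge] at hx
    have h0 : v.ord (x : K) = 0 := by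
      have := ge.le x.2 hx.1; omega
    have : v.ge (x : K)⁻¹ 0 := by right; rw [ord_inv, h0]; simp
    have h1 : (⟨(x : K)⁻¹, this⟩ : v.O) * x = 1 := by
      ext; simp [hx.1]
    rw [← h1]; exact J.mul_mem_left _ hxJ

/-- Residue field. -/
abbrev κ := v.O ⧸ v.I

noncomputable instance instFieldκ : Field v.κ := Ideal.Quotient.field v.I

noncomputable def res (x : K) (hx : v.ge x 0) : v.κ := Ideal.Quotient.mk v.I ⟨x, hx⟩

theorem res_eq {x y : K} (hx : v.ge x 0) (hy : v.ge y 0) :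
    v.res x hx = v.res y hy ↔ v.ge (x - y) 1 := by
  unfold res
  rw [Ideal.Quotient.eq, mem_I]; rfl

theorem res_surj (a : v.κ) : ∃ x, ∃ hx : v.ge x 0, v.res x hx = a := by
  obtain ⟨⟨x, hx⟩, rfl⟩ := Ideal.Quotient.mk_surjective a
  exact ⟨x, hx, rfl⟩

theorem res_mul {x y : K} (hx : v.ge x 0) (hy : v.ge y 0) :
    v.res (x * y) (hx.mul0 hy) = v.res x hx * v.res y hy := by
  unfold res; rw [← map_mul]; rfl
theorem res_add {x y : K} (hx : v.ge x 0) (hy : v.ge y 0) :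
    v.res (x + y) (hx.add hy) = v.res x hx + v.res y hy := by
  unfold res; rw [← map_add]; rfl
theorem res_neg {x : K} (hx : v.ge x 0) : v.res (-x) hx.neg = - v.res x hx := by
  unfold res; rw [← map_neg]; rfl
theorem res_sub {x y : K} (hx : v.ge x 0) (hy : v.ge y 0) :
    v.res (x - y) (hx.sub hy) = v.res x hx - v.res y hy := by
  unfold res; rw [← map_sub]; rfl
theorem res_pow {x : K} (hx : v.ge x 0) (n : ℕ) :
    v.res (x ^ n) (hx.pow n) = v.res x hx ^ n := by
  unfold res; rw [← map_pow]; rfl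
theorem res_one : v.res 1 ge_one = 1 := by
  unfold res; exact map_one (Ideal.Quotient.mk v.I)
theorem res_zero : v.res 0 (ge_zero 0) = 0 := by
  unfold res; exact map_zero (Ideal.Quotient.mk v.I)
theorem res_eq_zero {x : K} (hx : v.ge x 0) : v.res x hx = 0 ↔ v.ge x 1 := by
  rw [← res_zero, res_eq]; simp
theorem res_eq_one {x : K} (hx : v.ge x 0) : v.res x hx = 1 ↔ v.ge (x - 1) 1 := by
  rw [← res_one, res_eq]

end Place
end GFq

namespace GFq
namespace Place
variable {K : Type*} [Field K] (v : Place K)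

/-- Finite residue field of odd characteristic. -/
structure Good : Prop where
  fin : Finite v.κ
  two_ne : (2 : K) ≠ 0
  ord_two : v.ord 2 = 0

/-- Local square (up to first order, after scaling). -/
def lsq (a : K) : Prop := ∃ y, y ≠ 0 ∧ v.ge (a * y ^ 2 - 1) 1

variable {v}

theorem lsq_ne_zero {a : K} (h : v.lsq a) : a ≠ 0 := by
  rintro rfl
  obtain ⟨y, -, h⟩ := h
  have := h.le (by simp)
  simp [ord_neg_one] at this

theorem lsq_of_eq_sq {y : K} (hy : y ≠ 0) : v.lsq (y ^ 2) := by
  refine ⟨y⁻¹, inv_ne_zero hy, Or.inl ?_⟩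
  field_simp; simp

theorem lsq_mul {a b : K} (h : v.lsq a) (h' : v.lsq b) : v.lsq (a * b) := by
  obtain ⟨y, hy, h⟩ := h
  obtain ⟨z, hz, h'⟩ := h'
  refine ⟨y * z, mul_ne_zero hy hz, ?_⟩
  have e : a * b * (y * z) ^ 2 - 1 = (a * y ^ 2 - 1) * (b * z ^ 2 - 1) + (a * y ^ 2 - 1) +
    (b * z ^ 2 - 1) := by ring
  rw [e]
  exact (((h.mul h').mono (by norm_num)).add h).add h'

theorem lsq_mul_sq {a y : K} (hy : y ≠ 0) : v.lsq (a * y ^ 2) ↔ v.lsq a := by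
  refine ⟨fun h => ?_, fun h => lsq_mul h (lsq_of_eq_sq hy)⟩
  have := lsq_mul h (lsq_of_eq_sq (v := v) (inv_ne_zero hy))
  have e : a * y ^ 2 * y⁻¹ ^ 2 = a := by field_simp
  rwa [e] at this

theorem lsq_of_sub_one {x : K} {n : ℤ} (hn : 1 ≤ n) (h : v.ge (x - 1) n) : v.lsq x :=
  ⟨1, one_ne_zero, by simpa using h.mono hn⟩

theorem lsq_ord {a : K} (h : v.lsq a) : ∃ y, y ≠ 0 ∧ v.ord a = 2 * v.ord y := by
  have ha := lsq_ne_zero h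
  obtain ⟨y, hy, h⟩ := h
  have := (unit_of_sub_one le_rfl h).2
  rw [v.ord_mul _ _ ha (pow_ne_zero _ hy), ord_pow] at this
  refine ⟨y⁻¹, inv_ne_zero hy, ?_⟩
  rw [ord_inv]; push_cast at this; omega

theorem Good.half (hv : v.Good) : v.ge (1/2 : K) 0 := by
  right; rw [ord_div _ one_ne_zero hv.two_ne, hv.ord_two, ord_one]; simp

theorem lsq_hensel (hv : v.Good) {a : K} (h : v.lsq a) (n : ℤ) :
    ∃ y, y ≠ 0 ∧ v.ge (a * y ^ 2 - 1) n := by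
  suffices H : ∀ k : ℕ, ∃ y, y ≠ 0 ∧ v.ge (a * y ^ 2 - 1) (k + 1) by
    obtain ⟨y, hy, h⟩ := H n.toNat
    exact ⟨y, hy, h.mono (by have := Int.self_le_toNat n; omega)⟩
  intro k
  induction k with
  | zero => obtain ⟨y, hy, h⟩ := h; exact ⟨y, hy, by simpa using h⟩
  | succ k ih =>
    obtain ⟨y, hy, h1⟩ := ih
    have h2 := hv.half
    have h0 : v.ge (a * y ^ 2 - 1) 0 := h1.mono (by omega)
    have key : v.ge (a * (y * (1 - (a * y ^ 2 - 1) * (1/2))) ^ 2 - 1) ((k + 1 : ℕ) + 1) := by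
      have e : a * (y * (1 - (a * y ^ 2 - 1) * (1/2))) ^ 2 - 1 =
         ((a * y ^ 2 - 1) * (a * y ^ 2 - 1)) * ((a * y ^ 2 - 1) * ((1/2) * (1/2)) - ((1/2) * (1/2) + (1/2))) := by
        have := hv.two_ne
        field_simp; ring
      rw [e]
      refine ge.mul0 ((h1.mul h1).mono (by push_cast; omega)) ?_
      exact (h0.mul0 (h2.mul0 h2)).sub ((h2.mul0 h2).add h2)
    refine ⟨_, ?_, key⟩
    intro hz
    rw [hz] at key
    have := key.le (by simp)
    simp [ord_neg_one] at this; omega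

/-- For integral units, being a local square means being a square in the residue field. -/
theorem lsq_unit_iff {u : K} (hu : u ≠ 0) (h0 : v.ord u = 0) :
    v.lsq u ↔ IsSquare (v.res u (ge_of_ord h0.ge)) := by
  constructor
  · rintro ⟨y, hy, h⟩
    have h1 := (unit_of_sub_one le_rfl h).2
    rw [v.ord_mul _ _ hu (pow_ne_zero _ hy), ord_pow, h0] at h1
    have hy0 : v.ge y⁻¹ 0 := by right; rw [ord_inv]; push_cast at h1; omega
    refine ⟨v.res y⁻¹ hy0, ?_⟩
    rw [← res_mul, res_eq]
    have e : u - y⁻¹ * y⁻¹ = (u * y ^ 2 - 1) * (y⁻¹ * y⁻¹) := by field_simp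
    rw [e]; exact h.mul0 (hy0.mul0 hy0)
  · rintro ⟨s, hs⟩
    obtain ⟨y, hy, rfl⟩ := v.res_surj s
    rw [← res_mul, res_eq] at hs
    have := ord_eq_of_sub (v := v) (x := u) (y := y * y) hu (by rw [h0]; exact ge_sub_comm.1 hs)
    have hy0 : y ≠ 0 := fun h => this.1 (by simp [h])
    refine ⟨y⁻¹, inv_ne_zero hy0, ?_⟩
    have e : u * y⁻¹ ^ 2 - 1 = (u - y * y) * (y * y)⁻¹ := by field_simp
    rw [e]
    refine hs.mul0 (Or.inr ?_)
    rw [ord_inv, this.2, h0]; simp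

theorem isSquare_mul_of_not {F : Type*} [Field F] [Finite F] {a b : F}
    (ha : ¬ IsSquare a) (hb : ¬ IsSquare b) : IsSquare (a * b) := by
  classical
  have := Fintype.ofFinite F
  have h2 : ringChar F ≠ 2 := fun h => ha (FiniteField.isSquare_of_char_two h a)
  have ha0 : a ≠ 0 := by rintro rfl; exact ha (IsSquare.zero)
  have hb0 : b ≠ 0 := by rintro rfl; exact hb (IsSquare.zero)
  rw [← quadraticChar_one_iff_isSquare (mul_ne_zero ha0 hb0), map_mul,
    (quadraticChar_neg_one_iff_not_isSquare).2 ha, (quadraticChar_neg_one_iff_not_isSquare).2 hb]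
  norm_num

variable (v) in
noncomputable def unif : K := v.surj.choose
theorem unif_ne : v.unif ≠ 0 := v.surj.choose_spec.1
theorem ord_unif : v.ord v.unif = 1 := v.surj.choose_spec.2

variable (v) in
/-- parity of the order -/
noncomputable def o (a : K) : ZMod 2 := (v.ord a : ZMod 2)

variable (v) in
noncomputable def upart (a : K) : K := a * v.unif ^ (- v.ord a)

open Classical in
variable (v) in
/-- residue character of the unit part -/
noncomputable def r (a : K) : ZMod 2 := if v.lsq (v.upart a) then 0 else 1

variable (v) in
/-- Hilbert symbol, additively -/
noncomputable def h (a b : K) : ZMod 2 :=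
  v.o a * v.o b * v.r (-1) + v.r a * v.o b + v.o a * v.r b

theorem upart_ne {a : K} (ha : a ≠ 0) : v.upart a ≠ 0 := mul_ne_zero ha (zpow_ne_zero _ unif_ne)
theorem ord_upart {a : K} (ha : a ≠ 0) : v.ord (v.upart a) = 0 := by
  rw [upart, v.ord_mul _ _ ha (zpow_ne_zero _ unif_ne), ord_zpow, ord_unif]; ring
theorem upart_mul {a b : K} (ha : a ≠ 0) (hb : b ≠ 0) :
    v.upart (a * b) = v.upart a * v.upart b := by
  rw [upart, upart, upart, v.ord_mul _ _ ha hb, neg_add, zpow_add₀ unif_ne]; ring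

theorem o_mul {a b : K} (ha : a ≠ 0) (hb : b ≠ 0) : v.o (a * b) = v.o a + v.o b := by
  simp [o, v.ord_mul _ _ ha hb]

theorem unit_nonlsq_mul (hv : v.Good) {a b : K} (ha : a ≠ 0) (hb : b ≠ 0) (ha0 : v.ord a = 0)
    (hb0 : v.ord b = 0) (h : ¬ v.lsq a) (h' : ¬ v.lsq b) : v.lsq (a * b) := by
  have := hv.fin
  rw [lsq_unit_iff ha ha0] at h
  rw [lsq_unit_iff hb hb0] at h'
  rw [lsq_unit_iff (mul_ne_zero ha hb) (by rw [v.ord_mul _ _ ha hb]; omega),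
    res_mul v (ge_of_ord ha0.ge) (ge_of_ord hb0.ge)]
  exact isSquare_mul_of_not h h'

theorem lsq_cancel {a b : K} (ha : v.lsq a) (h : v.lsq (a * b)) : v.lsq b := by
  have h0 := lsq_ne_zero ha
  have := lsq_mul ha h
  have e : a * (a * b) = b * a ^ 2 := by ring
  rwa [e, lsq_mul_sq h0] at this

theorem r_mul (hv : v.Good) {a b : K} (ha : a ≠ 0) (hb : b ≠ 0) : v.r (a * b) = v.r a + v.r b := by
  unfold r
  rw [upart_mul ha hb]
  by_cases h1 : v.lsq (v.upart a) <;> by_cases h2 : v.lsq (v.upart b)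
  · simp [h1, h2, lsq_mul h1 h2]
  · have : ¬ v.lsq (v.upart a * v.upart b) := fun h => h2 (lsq_cancel h1 h)
    simp [h1, h2, this]
  · have : ¬ v.lsq (v.upart a * v.upart b) := fun h => h1 (lsq_cancel h2 (by rwa [mul_comm]))
    simp [h1, h2, this]
  · have := unit_nonlsq_mul hv (upart_ne ha) (upart_ne hb) (ord_upart ha) (ord_upart hb) h1 h2
    simp [h1, h2, this]; decide

theorem lsq_iff {a : K} (ha : a ≠ 0) : v.lsq a ↔ v.o a = 0 ∧ v.r a = 0 := by
  have key : ∀ k : ℤ, v.ord a = 2 * k → (v.lsq (v.upart a) ↔ v.lsq a) := by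
    intro k hk
    rw [upart, hk, show -(2 * k) = (-k) * 2 by ring, zpow_mul, zpow_ofNat]
    exact lsq_mul_sq (v := v) (zpow_ne_zero (-k) (unif_ne (v := v)))
  constructor
  · intro h
    obtain ⟨y, hy, h2⟩ := lsq_ord h
    refine ⟨?_, ?_⟩
    · rw [o, h2]; push_cast; rw [show (2 : ZMod 2) = 0 from rfl, zero_mul]
    · rw [r, if_pos]; exact (key _ h2).2 h
  · rintro ⟨h1, h2⟩
    rw [o, ZMod.intCast_zmod_eq_zero_iff_dvd] at h1
    obtain ⟨k, hk⟩ := h1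
    rw [← key k (by simpa using hk)]
    by_contra hc
    simp [r, hc] at h2

theorem o_sq {y : K} (hy : y ≠ 0) : v.o (y ^ 2) = 0 :=
  ((lsq_iff (pow_ne_zero _ hy)).1 (lsq_of_eq_sq hy)).1
theorem r_sq {y : K} (hy : y ≠ 0) : v.r (y ^ 2) = 0 :=
  ((lsq_iff (pow_ne_zero _ hy)).1 (lsq_of_eq_sq hy)).2
theorem o_lsq {y : K} (hy : v.lsq y) : v.o y = 0 := ((lsq_iff (lsq_ne_zero hy)).1 hy).1
theorem r_lsq {y : K} (hy : v.lsq y) : v.r y = 0 := ((lsq_iff (lsq_ne_zero hy)).1 hy).2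

theorem h_comm (a b : K) : v.h a b = v.h b a := by unfold h; ring
theorem h_mul_right (hv : v.Good) {a b c : K} (hb : b ≠ 0) (hc : c ≠ 0) :
    v.h a (b * c) = v.h a b + v.h a c := by
  unfold h; rw [o_mul hb hc, r_mul hv hb hc]; ring
theorem h_mul_left (hv : v.Good) {a b c : K} (hb : b ≠ 0) (hc : c ≠ 0) :
    v.h (b * c) a = v.h b a + v.h c a := by
  rw [h_comm, h_mul_right hv hb hc, h_comm a, h_comm a]
theorem h_lsq_right {a b : K} (hb : v.lsq b) : v.h a b = 0 := by
  unfold h; rw [o_lsq hb, r_lsq hb]; ring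
theorem h_lsq_left {a b : K} (hb : v.lsq b) : v.h b a = 0 := by
  rw [h_comm, h_lsq_right hb]

theorem h_neg_self (hv : v.Good) {a : K} (ha : a ≠ 0) : v.h a (-a) = 0 := by
  rw [← neg_one_mul, h_mul_right hv (by simp) ha]
  have h1 : v.o (-1) = 0 := by simp [o, ord_neg_one]
  unfold h
  rw [h1]
  generalize v.o a = x; generalize v.r a = y; generalize v.r (-1) = z
  revert x y z; decide

theorem o_unit {a : K} (h : v.ord a = 0) : v.o a = 0 := by simp [o, h]

theorem steinberg (hv : v.Good) {A : K} (hA : A ≠ 0) (hA1 : 1 - A ≠ 0) : v.h A (1 - A) = 0 := by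
  rcases lt_trichotomy (v.ord A) 0 with hlt | heq | hgt
  · have e : 1 - A = (-A) * (1 - A⁻¹) := by field_simp; ring
    have hl : v.lsq (1 - A⁻¹) := by
      refine lsq_of_sub_one (n := 1) le_rfl ?_
      have : 1 - A⁻¹ - 1 = -A⁻¹ := by ring
      rw [this]; right; rw [ord_neg, ord_inv]; omega
    rw [e, h_mul_right hv (neg_ne_zero.2 hA) (lsq_ne_zero hl), h_neg_self hv hA, h_lsq_right hl,
      add_zero]
  · by_cases hl : v.lsq A
    · exact h_lsq_left hl
    · have h0 : v.ord (1 - A) = 0 := by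
        have h1 : v.ge (1 - A) 0 := ge_one.sub (Or.inr heq.ge)
        by_contra hc
        have h2 : v.ge (A - 1) 1 := by
          rw [ge_sub_comm]; right; have := h1.le hA1; omega
        exact hl (lsq_of_sub_one le_rfl h2)
      unfold h; rw [o_unit heq, o_unit h0]; ring
  · apply h_lsq_right
    refine lsq_of_sub_one (n := 1) le_rfl ?_
    have : 1 - A - 1 = -A := by ring
    rw [this]; right; rw [ord_neg]; omega

/-- L1: norms have trivial symbol. -/
theorem h_norm (hv : v.Good) {a x y : K} (ha : a ≠ 0) (hc : x ^ 2 - a * y ^ 2 ≠ 0) :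
    v.h a (x ^ 2 - a * y ^ 2) = 0 := by
  by_cases hx : x = 0
  · subst hx
    have hy : y ≠ 0 := by rintro rfl; simp at hc
    have e : (0 : K) ^ 2 - a * y ^ 2 = (-a) * y ^ 2 := by ring
    rw [e, h_mul_right hv (neg_ne_zero.2 ha) (pow_ne_zero _ hy), h_neg_self hv ha,
      h_lsq_right (lsq_of_eq_sq hy), add_zero]
  by_cases hy : y = 0
  · subst hy
    have e : x ^ 2 - a * 0 ^ 2 = x ^ 2 := by ring
    rw [e]; exact h_lsq_right (lsq_of_eq_sq hx)
  have hyx : y / x ≠ 0 := div_ne_zero hy hx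
  have e : x ^ 2 - a * y ^ 2 = x ^ 2 * (1 - a * (y / x) ^ 2) := by field_simp
  have h1 : 1 - a * (y / x) ^ 2 ≠ 0 := by
    intro h; rw [e, h, mul_zero] at hc; exact hc rfl
  have := steinberg (v := v) hv (mul_ne_zero ha (pow_ne_zero 2 hyx)) h1
  rw [h_mul_left hv ha (pow_ne_zero _ hyx), h_lsq_left (lsq_of_eq_sq hyx), add_zero] at this
  rw [e, h_mul_right hv (pow_ne_zero _ hx) h1, h_lsq_right (lsq_of_eq_sq hx), this, add_zero]

/-- square-class helper -/
theorem zero_of_nonlsq {a z w : K} (ha0 : a ≠ 0) (ha : ¬ v.lsq a) (h : w ^ 2 = a * z ^ 2) :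
    w = 0 ∧ z = 0 := by
  by_cases hz : z = 0
  · subst hz; simpa using h
  exfalso; apply ha
  have : w ≠ 0 := by
    rintro rfl; simp [ha0, hz] at h
  refine (lsq_mul_sq hz).1 ?_
  rw [← h]; exact lsq_of_eq_sq this

/-- L2 -/
theorem aniso_of_h (hv : v.Good) {a b x1 x2 x3 : K} (ha : a ≠ 0) (hb : b ≠ 0) (hab : v.h a b = 1)
    (h1 : v.lsq x1) (h2 : v.lsq x2) (h3 : v.lsq x3) {z0 z1 z2 z3 : K}
    (e : z0 ^ 2 - a * x1 * z1 ^ 2 - b * x2 * z2 ^ 2 + a * b * x3 * z3 ^ 2 = 0) :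
    z0 = 0 ∧ z1 = 0 ∧ z2 = 0 ∧ z3 = 0 := by
  have n1 := lsq_ne_zero h1
  have n2 := lsq_ne_zero h2
  have n3 := lsq_ne_zero h3
  have ha' : ¬ v.lsq a := fun h => by rw [h_lsq_left h] at hab; exact zero_ne_one hab
  have h32 : v.lsq (x3 / x2) := by
    have : x3 / x2 = x3 * x2 * (x2⁻¹) ^ 2 := by field_simp
    rw [this, lsq_mul_sq (inv_ne_zero n2)]; exact lsq_mul h3 h2
  have e2 : z0 ^ 2 - a * x1 * z1 ^ 2 = b * x2 * (z2 ^ 2 - a * (x3 / x2) * z3 ^ 2) := by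
    field_simp; linear_combination e
  have hA1 : ¬ v.lsq (a * x1) := fun h => ha' (lsq_cancel h1 (by rwa [mul_comm]))
  have hA2 : ¬ v.lsq (a * (x3 / x2)) := fun h => ha' (lsq_cancel h32 (by rwa [mul_comm]))
  have nA1 : a * x1 ≠ 0 := mul_ne_zero ha n1
  have nA2 : a * (x3 / x2) ≠ 0 := mul_ne_zero ha (div_ne_zero n3 n2)
  by_cases hc : z0 ^ 2 - a * x1 * z1 ^ 2 = 0
  · have hd : z2 ^ 2 - a * (x3 / x2) * z3 ^ 2 = 0 := by
      rw [hc] at e2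
      exact (mul_eq_zero.1 e2.symm).resolve_left (mul_ne_zero hb n2)
    have q1 := zero_of_nonlsq nA1 hA1 (sub_eq_zero.1 hc)
    have q2 := zero_of_nonlsq nA2 hA2 (sub_eq_zero.1 hd)
    exact ⟨q1.1, q1.2, q2.1, q2.2⟩
  · exfalso
    have hd : z2 ^ 2 - a * (x3 / x2) * z3 ^ 2 ≠ 0 := by
      intro h; rw [h, mul_zero] at e2; exact hc e2
    have q1 := h_norm hv nA1 hc
    have q2 := h_norm hv nA2 hd
    rw [h_mul_left hv ha n1, h_lsq_left h1, add_zero, e2, h_mul_right hv (mul_ne_zero hb n2) hd,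
      h_mul_right hv hb n2, hab, h_lsq_right h2] at q1
    rw [h_mul_left hv ha (div_ne_zero n3 n2), h_lsq_left h32, add_zero] at q2
    rw [q2] at q1; simp at q1

theorem lsq_of_eq {a b : K} (hv : v.Good) (ha : a ≠ 0) (hb : b ≠ 0) (ho : v.o a = v.o b)
    (hr : v.r a = v.r b) : v.lsq (a * b) := by
  rw [lsq_iff (mul_ne_zero ha hb), o_mul ha hb, r_mul hv ha hb, ho, hr]
  exact ⟨CharTwo.add_self_eq_zero _, CharTwo.add_self_eq_zero _⟩

theorem eq_of_lsq {a b : K} (hv : v.Good) (ha : a ≠ 0) (hb : b ≠ 0) (h : v.lsq (a * b)) :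
    v.o a = v.o b ∧ v.r a = v.r b := by
  rw [lsq_iff (mul_ne_zero ha hb), o_mul ha hb, r_mul hv ha hb] at h
  exact ⟨CharTwo.add_eq_zero.1 h.1, CharTwo.add_eq_zero.1 h.2⟩

theorem lsq_of_close {a b : K} (ha : a ≠ 0) (h : v.ge (b - a) (v.ord a + 1)) : v.lsq (a * b) := by
  have e : a * b = (1 + (b - a) / a) * a ^ 2 := by field_simp; ring
  rw [e, lsq_mul_sq ha]
  refine lsq_of_sub_one (n := 1) le_rfl ?_
  rw [add_sub_cancel_left, ge_div_iff ha]
  exact h.mono (by omega)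

theorem close_o_r (hv : v.Good) {a b : K} (ha : a ≠ 0) (h : v.ge (b - a) (v.ord a + 1)) :
    v.o b = v.o a ∧ v.r b = v.r a := by
  have := eq_of_lsq hv ha (ord_eq_of_sub ha h).1 (lsq_of_close ha h)
  exact ⟨this.1.symm, this.2.symm⟩

theorem exists_loc (hv : v.Good) (x y : ZMod 2) : ∃ a : K, a ≠ 0 ∧ v.o a = x ∧ v.r a = y := by
  have := hv.fin
  have key : ∃ u : K, u ≠ 0 ∧ v.o u = 0 ∧ v.r u = 1 := by
    have h2 : ringChar v.κ ≠ 2 := by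
      intro h
      have h2 : (2 : v.κ) = 0 := by
        have := ringChar.Nat.cast_ringChar (R := v.κ)
        rw [h] at this; exact_mod_cast this
      have : v.res 2 (ge_of_ord hv.ord_two.ge) = 0 := by
        rw [← h2]; rfl
      rw [res_eq_zero] at this
      have := this.le hv.two_ne
      rw [hv.ord_two] at this; omega
    have := Fintype.ofFinite v.κ
    obtain ⟨s, hs⟩ := FiniteField.exists_nonsquare h2
    obtain ⟨u, hu, rfl⟩ := v.res_surj s
    have hu0 : ¬ v.ge u 1 := by
      intro h; rw [(v.res_eq_zero hu).2 h] at hs; exact hs IsSquare.zero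
    rw [not_ge] at hu0
    have hu1 : v.ord u = 0 := by have := hu.le hu0.1; omega
    have : ¬ v.lsq u := by rwa [lsq_unit_iff hu0.1 hu1]
    refine ⟨u, hu0.1, o_unit hu1, ?_⟩
    rw [lsq_iff hu0.1, o_unit hu1] at this
    generalize v.r u = z at *
    revert this; revert z; decide
  obtain ⟨u, hu, h1, h2⟩ := key
  obtain ⟨p, hp, h3⟩ := v.surj
  have hop : v.o p = 1 := by simp [o, h3]
  have key2 : ∀ y : ZMod 2, ∃ a : K, a ≠ 0 ∧ v.o a = 0 ∧ v.r a = y := by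
    intro y
    obtain rfl | rfl : y = 0 ∨ y = 1 := by revert y; decide
    · exact ⟨1 ^ 2, by simp, o_sq one_ne_zero, r_sq one_ne_zero⟩
    · exact ⟨u, hu, h1, h2⟩
  obtain rfl | rfl : x = 0 ∨ x = 1 := by revert x; decide
  · exact key2 y
  · obtain ⟨a, ha, h4, h5⟩ := key2 (y + v.r p)
    refine ⟨a * p, mul_ne_zero ha hp, ?_, ?_⟩
    · rw [o_mul ha hp, h4, hop, zero_add]
    · rw [r_mul hv ha hp, h5, add_assoc, CharTwo.add_self_eq_zero, add_zero]

theorem exists_h_one (hv : v.Good) {a : K} (ha : a ≠ 0) (hl : ¬ v.lsq a) :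
    ∃ c : K, c ≠ 0 ∧ v.h a c = 1 := by
  rw [lsq_iff ha] at hl
  have : ∃ x y : ZMod 2, v.o a * x * v.r (-1) + v.r a * x + v.o a * y = 1 := by
    generalize v.o a = p at *; generalize v.r a = q at *; generalize v.r (-1) = e at *
    revert hl; revert p q e; decide
  obtain ⟨x, y, h⟩ := this
  obtain ⟨c, hc, rfl, rfl⟩ := exists_loc hv x y
  exact ⟨c, hc, h⟩

theorem exists_norm_loc (hv : v.Good) {a c : K} (ha : a ≠ 0) (hc : c ≠ 0) (h : v.h a c = 0) :
    ∃ x y : K, x ^ 2 - a * y ^ 2 ≠ 0 ∧ v.lsq (c * (x ^ 2 - a * y ^ 2)) := by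
  by_cases h1 : v.lsq c
  · exact ⟨1, 0, by simp, by simpa using h1⟩
  by_cases h2 : v.lsq (c * (-a))
  · exact ⟨0, 1, by simpa using ha, by simpa using h2⟩
  by_cases h3 : v.lsq a
  · -- split case
    set x := (c + 1) / 2
    set y := (c - 1) / 2
    have hxy : x ^ 2 - y ^ 2 = c := by
      have := hv.two_ne
      simp only [x, y]; field_simp; ring
    obtain ⟨t, ht, h4⟩ := lsq_hensel hv h3 (v.ord c + 1 - v.ord (y ^ 2))
    have h5 : v.ge ((x ^ 2 - a * (t * y) ^ 2) - c) (v.ord c + 1) := by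
      have e : (x ^ 2 - a * (t * y) ^ 2) - c = -((a * t ^ 2 - 1) * y ^ 2) := by
        rw [← hxy]; ring
      rw [e]
      exact ((h4.mul (ge_self (x := y ^ 2))).mono (by omega)).neg
    exact ⟨x, t * y, (ord_eq_of_sub hc h5).1, lsq_of_close hc h5⟩
  have hoc : v.o a = 0 ∧ v.r a = 1 ∧ v.o c = 0 ∧ v.r c = 1 := by
    have hn1 : (-1 : K) ≠ 0 := by simp
    have o1 : v.o (-1) = 0 := by simp [o, ord_neg_one]
    rw [← neg_one_mul, lsq_iff (mul_ne_zero hc (mul_ne_zero hn1 ha)),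
      o_mul hc (mul_ne_zero hn1 ha), o_mul hn1 ha, r_mul hv hc (mul_ne_zero hn1 ha),
      r_mul hv hn1 ha, o1] at h2
    rw [lsq_iff hc] at h1
    rw [lsq_iff ha] at h3
    unfold Place.h at h
    generalize v.o a = p at *; generalize v.r a = q at *; generalize v.r (-1) = e at *
    generalize v.o c = s at *; generalize v.r c = t at *
    revert h h1 h2 h3; revert p q e s t; decide
  obtain ⟨q1, q2, q3, q4⟩ := hoc
  -- unit parts
  have even : ∀ z : K, z ≠ 0 → v.o z = 0 → ∃ s u : K, s ≠ 0 ∧ u ≠ 0 ∧ z = u * s ^ 2 ∧ v.ord u = 0 := by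
    intro z hz hz0
    rw [o, ZMod.intCast_zmod_eq_zero_iff_dvd] at hz0
    obtain ⟨k, hk⟩ := hz0
    obtain ⟨s, hs, hs1⟩ := v.exists_ord k
    refine ⟨s, z / s ^ 2, hs, div_ne_zero hz (pow_ne_zero _ hs), by field_simp, ?_⟩
    rw [ord_div _ hz (pow_ne_zero _ hs), ord_pow, hk, hs1]; simp
  obtain ⟨s, u, hs, hu, rfl, hu0⟩ := even a ha q1
  obtain ⟨s', d, hs', hd, rfl, hd0⟩ := even c hc q3
  have hu' := ge_of_ord hu0.ge
  have hd' := ge_of_ord hd0.ge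
  have := hv.fin
  have := Fintype.ofFinite v.κ
  have h2 : ringChar v.κ ≠ 2 := by
    intro h
    rw [lsq_mul_sq hs, lsq_unit_iff hu hu0] at h3
    exact h3 (FiniteField.isSquare_of_char_two h _)
  have hodd : Fintype.card v.κ % 2 = 1 := FiniteField.odd_card_of_char_ne_two h2
  have hur : v.res u hu' ≠ 0 := by
    rw [Ne, res_eq_zero]; intro hh; have := hh.le hu; omega
  obtain ⟨x, y, hxy⟩ := FiniteField.exists_root_sum_quadratic
    (f := Polynomial.X ^ 2 - Polynomial.C (v.res d hd')) (g := Polynomial.C (- v.res u hu') * Polynomial.X ^ 2)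
    (Polynomial.degree_X_pow_sub_C (by norm_num) _)
    (by rw [Polynomial.degree_C_mul_X_pow 2 (neg_ne_zero.2 hur)]; rfl) hodd
  simp only [Polynomial.eval_sub, Polynomial.eval_pow, Polynomial.eval_X, Polynomial.eval_C,
    Polynomial.eval_mul] at hxy
  obtain ⟨X, hX, rfl⟩ := v.res_surj x
  obtain ⟨Y, hY, rfl⟩ := v.res_surj y
  have key : v.ge (X ^ 2 - u * Y ^ 2 - d) 1 := by
    rw [← v.res_eq_zero ((((hX.pow 2)).sub (hu'.mul0 (hY.pow 2))).sub hd'),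
      res_sub v ((hX.pow 2).sub (hu'.mul0 (hY.pow 2))) hd', res_sub v (hX.pow 2) (hu'.mul0 (hY.pow 2)),
      res_mul v hu' (hY.pow 2), res_pow v hX, res_pow v hY]
    linear_combination hxy
  have hcl : v.ge (X ^ 2 - u * Y ^ 2 - d) (v.ord d + 1) := by rw [hd0]; simpa using key
  refine ⟨X, Y / s, ?_, ?_⟩
  · have := (ord_eq_of_sub hd hcl).1
    convert this using 2; field_simp
  · have := lsq_of_close hd hcl
    rw [← lsq_mul_sq hs'] at this
    convert this using 1; field_simp

/-- L3 -/
theorem exists_norm_approx (hv : v.Good) {a c : K} (ha : a ≠ 0) (hc : c ≠ 0) (h : v.h a c = 0)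
    (n : ℤ) : ∃ x y : K, v.ge (c * (x ^ 2 - a * y ^ 2) - 1) n := by
  obtain ⟨x, y, -, hl⟩ := exists_norm_loc hv ha hc h
  obtain ⟨z, -, hz⟩ := lsq_hensel hv hl n
  refine ⟨x * z, y * z, ?_⟩
  convert hz using 1; ring

end Place
end GFq

namespace GFq
namespace Place
variable {K : Type*} [Field K]

theorem eq_of_le {v w : Place K} (H : ∀ x, v.ge x 0 → w.ge x 0) : v = w := by
  have hu : ∀ x, x ≠ 0 → v.ord x = 0 → w.ord x = 0 := by
    intro x hx h
    have h1 := (H x (ge_of_ord h.ge)).le hx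
    have h2 := (H x⁻¹ (ge_of_ord (by rw [ord_inv]; omega))).le (inv_ne_zero hx)
    rw [ord_inv] at h2; omega
  obtain ⟨p, hp, hp1⟩ := v.surj
  have hmul : ∀ x, x ≠ 0 → w.ord x = v.ord x * w.ord p := by
    intro x hx
    have h3 : x / p ^ (v.ord x) ≠ 0 := div_ne_zero hx (zpow_ne_zero _ hp)
    have := hu _ h3 (by rw [ord_div _ hx (zpow_ne_zero _ hp), ord_zpow, hp1]; ring)
    rw [ord_div _ hx (zpow_ne_zero _ hp), ord_zpow] at this; omega
  obtain ⟨y, hy, hy1⟩ := w.surj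
  have h4 := hmul y hy
  rw [hy1] at h4
  have h5 : 0 ≤ w.ord p := (H p (ge_of_ord (by omega))).le hp
  have h6 : w.ord p = 1 := by
    have : w.ord p ∣ 1 := ⟨v.ord y, by rw [h4]; ring⟩
    exact Int.eq_one_of_dvd_one h5 this
  ext x
  by_cases hx : x = 0
  · rw [hx, ord_zero, ord_zero]
  · rw [hmul x hx, h6, mul_one]

theorem exists_sep {v w : Place K} (h : v ≠ w) : ∃ z : K, z ≠ 0 ∧ v.ord z < 0 ∧ 0 < w.ord z := by
  have h1 : ∃ x, w.ge x 0 ∧ ¬ v.ge x 0 := by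
    by_contra hc; push Not at hc; exact h (eq_of_le hc).symm
  have h2 : ∃ x, v.ge x 0 ∧ ¬ w.ge x 0 := by
    by_contra hc; push Not at hc; exact h (eq_of_le hc)
  obtain ⟨x, hx, hx'⟩ := h1
  obtain ⟨y, hy, hy'⟩ := h2
  rw [not_ge] at hx' hy'
  refine ⟨x / y, div_ne_zero hx'.1 hy'.1, ?_, ?_⟩
  · rw [ord_div _ hx'.1 hy'.1]; have := hy.le hy'.1; omega
  · rw [ord_div _ hx'.1 hy'.1]; have := hx.le hx'.1; omega

theorem one_add_of_neg {v : Place K} {z : K} (hz : v.ord z < 0) : 1 + z ≠ 0 ∧ v.ord (1 + z) = v.ord z := by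
  have h0 : z ≠ 0 := by rintro rfl; simp [ord_zero] at hz
  have := ord_add_eq (v := v) (x := z) (y := 1) h0 (by right; rw [ord_one]; omega)
  rwa [add_comm] at this

theorem one_add_of_pos {v : Place K} {z : K} (hz : 0 < v.ord z) : 1 + z ≠ 0 ∧ v.ord (1 + z) = 0 := by
  have := ord_add_eq (v := v) (x := 1) (y := z) one_ne_zero (by right; rw [ord_one]; omega)
  rwa [ord_one] at this

theorem exists_sep_finset (v : Place K) (Z : Finset (Place K)) (hZ : v ∉ Z) :
    ∃ z : K, z ≠ 0 ∧ v.ord z < 0 ∧ ∀ w ∈ Z, 0 < w.ord z := by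
  classical
  induction Z using Finset.induction_on with
  | empty =>
    obtain ⟨z, hz, h⟩ := v.exists_ord (-1)
    exact ⟨z, hz, by omega, by simp⟩
  | insert w Z hw ih =>
    rw [Finset.mem_insert, not_or] at hZ
    obtain ⟨z, hz, hzv, hzZ⟩ := ih hZ.2
    obtain ⟨y, hy, hyv, hyw⟩ := exists_sep hZ.1
    have hk : ∃ k : ℕ, 1 ≤ k ∧ ∀ u ∈ Z, - u.ord y < k := by
      refine ⟨1 + ∑ u ∈ Z, (u.ord y).natAbs, by omega, fun u hu => ?_⟩
      have := Finset.single_le_sum (f := fun u : Place K => (u.ord y).natAbs) (fun _ _ => Nat.zero_le _) hu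
      omega
    obtain ⟨k, hk1, hk⟩ := hk
    have hkz : ∀ u ∈ Z, 0 < k * u.ord z + u.ord y := by
      intro u hu
      have h1 := hzZ u hu
      have h2 := hk u hu
      nlinarith
    rcases lt_trichotomy (w.ord z) 0 with hlt | heq | hgt
    · have hv0 : v.ord (z ^ k) < 0 := by rw [ord_pow]; nlinarith
      have hw0 : w.ord (z ^ k) < 0 := by rw [ord_pow]; nlinarith
      have hne := (one_add_of_neg hv0).1
      refine ⟨z ^ k / (1 + z ^ k) * y, mul_ne_zero (div_ne_zero (pow_ne_zero _ hz) hne) hy, ?_, ?_⟩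
      · rw [ord_mul _ _ _ (div_ne_zero (pow_ne_zero _ hz) hne) hy, ord_div _ (pow_ne_zero _ hz) hne,
          (one_add_of_neg hv0).2]; omega
      · intro u hu
        rw [ord_mul _ _ _ (div_ne_zero (pow_ne_zero _ hz) hne) hy, ord_div _ (pow_ne_zero _ hz) hne]
        rcases Finset.mem_insert.1 hu with rfl | hu
        · rw [(one_add_of_neg hw0).2]; omega
        · have : 0 < u.ord (z ^ k) := by rw [ord_pow]; have := hzZ u hu; positivity
          rw [(one_add_of_pos this).2, ord_pow]; have := hkz u hu; omega
    · refine ⟨z ^ k * y, mul_ne_zero (pow_ne_zero _ hz) hy, ?_, ?_⟩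
      · rw [ord_mul _ _ _ (pow_ne_zero _ hz) hy, ord_pow]; nlinarith
      · intro u hu
        rw [ord_mul _ _ _ (pow_ne_zero _ hz) hy, ord_pow]
        rcases Finset.mem_insert.1 hu with rfl | hu
        · rw [heq]; omega
        · exact hkz u hu
    · refine ⟨z, hz, hzv, fun u hu => ?_⟩
      rcases Finset.mem_insert.1 hu with rfl | hu
      · exact hgt
      · exact hzZ u hu

theorem exists_idem [DecidableEq (Place K)] (v : Place K) (Z : Finset (Place K)) (n : ℕ) :
    ∃ e : K, v.ge (e - 1) n ∧ ∀ w ∈ Z, w ≠ v → w.ge e n := by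
  obtain ⟨z, hz, hzv, hzZ⟩ := exists_sep_finset v (Z.erase v) (by simp)
  have hv0 : v.ord (z ^ (n + 1)) ≤ -n - 1 := by rw [ord_pow]; push_cast; nlinarith
  have h1 := one_add_of_neg (v := v) (z := z ^ (n + 1)) (by omega)
  refine ⟨z ^ (n + 1) / (1 + z ^ (n + 1)), ?_, ?_⟩
  · have e : z ^ (n + 1) / (1 + z ^ (n + 1)) - 1 = - (1 + z ^ (n + 1))⁻¹ := by
      have := h1.1
      field_simp; ring
    rw [e]; right; rw [ord_neg, ord_inv, h1.2]; omega
  · intro w hw hwv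
    have h2 := hzZ w (by simp [hw, hwv])
    have h3 : (n : ℤ) + 1 ≤ w.ord (z ^ (n + 1)) := by rw [ord_pow]; push_cast; nlinarith
    right; rw [ord_div _ (pow_ne_zero _ hz) h1.1, (one_add_of_pos (by omega)).2]; omega

/-- Weak approximation. -/
theorem approx (Z : Finset (Place K)) (x : Place K → K) (n : Place K → ℤ) :
    ∃ z : K, ∀ v ∈ Z, v.ge (z - x v) (n v) := by
  classical
  obtain ⟨k, hk⟩ : ∃ k : ℕ, ∀ v ∈ Z, ∀ w ∈ Z, n v - v.ord (x w) ≤ k := by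
    refine ⟨∑ v ∈ Z, ∑ w ∈ Z, (n v - v.ord (x w)).natAbs, fun v hv w hw => ?_⟩
    have h1 := Finset.single_le_sum (f := fun v : Place K => ∑ w ∈ Z, (n v - v.ord (x w)).natAbs)
      (fun _ _ => Nat.zero_le _) hv
    have h2 := Finset.single_le_sum (f := fun w : Place K => (n v - v.ord (x w)).natAbs)
      (fun _ _ => Nat.zero_le _) hw
    omega
  choose e he1 he2 using fun v : Place K => exists_idem v Z k
  refine ⟨∑ w ∈ Z, x w * e w, fun v hv => ?_⟩
  have : ∑ w ∈ Z, x w * e w - x v = ∑ w ∈ Z, (x w * e w - if w = v then x v else 0) := by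
    rw [Finset.sum_sub_distrib]; simp [hv]
  rw [this]
  refine ge.sum _ _ fun w hw => ?_
  by_cases hwv : w = v
  · subst hwv
    have e' : x w * e w - (if w = w then x w else 0) = x w * (e w - 1) := by simp; ring
    rw [e']
    exact (ge_self.mul (he1 w)).mono (by have := hk w hw w hw; omega)
  · simp only [hwv, if_false, sub_zero]
    exact (ge_self.mul (he2 w v hv (Ne.symm hwv))).mono (by have := hk v hv w hw; omega)

/-- Normalizing a nontrivial discrete valuation. -/
theorem ofHom (f : K → ℤ) (h0 : f 0 = 0) (hm : ∀ x y, x ≠ 0 → y ≠ 0 → f (x * y) = f x + f y)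
    (ha : ∀ x y, x ≠ 0 → y ≠ 0 → x + y ≠ 0 → min (f x) (f y) ≤ f (x + y))
    (hn : ∃ x, x ≠ 0 ∧ f x ≠ 0) :
    ∃ (v : Place K) (g : ℤ), 0 < g ∧ ∀ x, f x = g * v.ord x := by
  classical
  have h1 : f 1 = 0 := by
    have := hm 1 1 one_ne_zero one_ne_zero; simp at this; exact this
  have hi : ∀ x, x ≠ 0 → f x⁻¹ = - f x := by
    intro x hx
    have := hm x x⁻¹ hx (inv_ne_zero hx); rw [mul_inv_cancel₀ hx, h1] at this; omega
  have hp : ∀ x, x ≠ 0 → ∀ n : ℕ, f (x ^ n) = n * f x := by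
    intro x hx n
    induction n with
    | zero => simp [h1]
    | succ n ih => rw [pow_succ, hm _ _ (pow_ne_zero _ hx) hx, ih]; push_cast; ring
  have hz : ∀ x, x ≠ 0 → ∀ n : ℤ, f (x ^ n) = n * f x := by
    intro x hx n
    rcases n with n | n
    · simpa using hp x hx n
    · rw [zpow_negSucc, hi _ (pow_ne_zero _ hx), hp x hx, Int.negSucc_eq]; push_cast; ring
  have hex : ∃ n : ℕ, 0 < n ∧ ∃ x, x ≠ 0 ∧ f x = n := by
    obtain ⟨x, hx, hx'⟩ := hn
    rcases lt_or_gt_of_ne hx' with h | h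
    · exact ⟨(- f x).toNat, by omega, x⁻¹, inv_ne_zero hx, by rw [hi x hx]; omega⟩
    · exact ⟨(f x).toNat, by omega, x, hx, by omega⟩
  obtain ⟨hg, p, hp0, hpg⟩ := Nat.find_spec hex
  have hmin := fun m => @Nat.find_min _ _ hex m
  set g := Nat.find hex
  have hd : ∀ x, x ≠ 0 → f x = g * (f x / g) := by
    intro x hx
    have hzne : p ^ (f x / g) ≠ 0 := zpow_ne_zero _ hp0
    have h2 : f (x * (p ^ (f x / g))⁻¹) = f x % g := by
      rw [hm _ _ hx (inv_ne_zero hzne), hi _ hzne, hz p hp0, hpg]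
      have := Int.mul_ediv_add_emod (f x) g; linarith
    have h3 := Int.emod_nonneg (f x) (b := (g : ℤ)) (by omega)
    have h4 := Int.emod_lt_of_pos (f x) (b := (g : ℤ)) (by omega)
    have h5 : f x % g = 0 := by
      by_contra hc
      refine hmin (f x % g).toNat (by omega) ⟨by omega, _, mul_ne_zero hx (inv_ne_zero hzne), ?_⟩
      rw [h2]; omega
    have := Int.mul_ediv_add_emod (f x) g; omega
  have hg' : (0 : ℤ) < g := by omega
  refine ⟨⟨fun x => f x / g, by simp [h0], ?_, ?_, p, hp0, by rw [hpg]; exact Int.ediv_self hg'.ne'⟩, g, hg', ?_⟩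
  · intro x y hx hy
    have e1 := hd x hx
    have e2 := hd y hy
    have e3 := hd (x * y) (mul_ne_zero hx hy)
    rw [hm x y hx hy] at e3 ⊢
    refine mul_left_cancel₀ hg'.ne' ?_
    rw [← e3, mul_add, ← e1, ← e2]
  · intro x y hx hy hxy
    have := ha x y hx hy hxy
    rcases min_le_iff.1 this with h | h
    · exact min_le_iff.2 (Or.inl (Int.ediv_le_ediv hg' h))
    · exact min_le_iff.2 (Or.inr (Int.ediv_le_ediv hg' h))
  · intro x
    by_cases hx : x = 0
    · simp [hx, h0]
    · exact hd x hx

/-- Discreteness criterion. -/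
theorem ofVal {Γ : Type*} [LinearOrderedCommGroupWithZero Γ] (V : Valuation K Γ) (τ : K) (hτ : τ ≠ 0)
    (hτ1 : V τ < 1) (N : ℕ) (hN : 0 < N)
    (H : ∀ x, x ≠ 0 → ∃ n : ℤ, V x ^ N = V τ ^ n) :
    ∃ w : Place K, ∀ x, w.ge x 0 ↔ V x ≤ 1 := by
  classical
  have hτ0 : 0 < V τ := by rw [zero_lt_iff]; exact (Valuation.ne_zero_iff V).2 hτ
  have anti : StrictAnti fun n : ℤ => V τ ^ n := zpow_right_strictAnti₀ hτ0 hτ1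
  choose! f hf using H
  set F : K → ℤ := fun x => if x = 0 then 0 else f x with hF
  have hFx : ∀ x, x ≠ 0 → V x ^ N = V τ ^ F x := by
    intro x hx; simp only [hF, hx, if_false]; exact hf x hx
  have hle : ∀ x y, x ≠ 0 → y ≠ 0 → (F x ≤ F y ↔ V y ≤ V x) := by
    intro x y hx hy
    rw [← pow_le_pow_iff_left₀ zero_le zero_le hN.ne' (a := V y), hFx x hx, hFx y hy]
    exact (anti.le_iff_ge).symm
  obtain ⟨w, g, hg, hw⟩ := ofHom F (by simp [hF])
    (by
      intro x y hx hy
      apply anti.injective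
      change V τ ^ F (x * y) = V τ ^ (F x + F y)
      rw [zpow_add₀ hτ0.ne', ← hFx _ hx, ← hFx _ hy, ← hFx _ (mul_ne_zero hx hy), map_mul, mul_pow])
    (by
      intro x y hx hy hxy
      have := V.map_add x y
      rcases le_max_iff.1 this with h | h
      · exact min_le_iff.2 (Or.inl ((hle _ _ hx hxy).2 h))
      · exact min_le_iff.2 (Or.inr ((hle _ _ hy hxy).2 h)))
    ⟨τ, hτ, by
      have h1 := hFx τ hτ
      intro h0
      rw [h0, zpow_zero] at h1
      exact (pow_lt_one₀ zero_le hτ1 hN.ne').ne h1⟩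
  refine ⟨w, fun x => ?_⟩
  by_cases hx : x = 0
  · simp [hx, ge_zero]
  have h1 : F 1 = 0 := by
    rw [hw 1, ord_one, mul_zero]
  have := hle 1 x one_ne_zero hx
  rw [h1, map_one] at this
  rw [← this, hw x, ge]
  simp only [hx, false_or]
  constructor
  · intro h; positivity
  · intro h; exact nonneg_of_mul_nonneg_right h hg

end Place

/-- In a vanishing sum, the maximal valuation is attained twice. -/
theorem exists_pair {K Γ ι : Type*} [Field K] [LinearOrderedCommGroupWithZero Γ] (V : Valuation K Γ)
    (s : Finset ι) (a : ι → K) (h : ∑ i ∈ s, a i = 0) (hn : ∃ i ∈ s, a i ≠ 0) :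
    ∃ i ∈ s, ∃ j ∈ s, i ≠ j ∧ a i ≠ 0 ∧ a j ≠ 0 ∧ V (a i) = V (a j) := by
  classical
  obtain ⟨i0, hi0, hi0'⟩ := hn
  obtain ⟨i, hi, hmax⟩ := Finset.exists_max_image s (fun i => V (a i)) ⟨i0, hi0⟩
  have hai : a i ≠ 0 := by
    have := hmax i0 hi0
    intro h; simp [h] at this; exact hi0' this
  have h1 : a i = - ∑ j ∈ s.erase i, a j := by
    rw [← Finset.add_sum_erase s a hi] at h; linear_combination h
  have : ∃ j ∈ s.erase i, V (a i) ≤ V (a j) := by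
    by_contra hc
    push Not at hc
    have := V.map_sum_lt ((Valuation.ne_zero_iff V).2 hai) hc
    rw [← V.map_neg, ← h1] at this
    exact lt_irrefl _ this
  obtain ⟨j, hj, hle⟩ := this
  rw [Finset.mem_erase] at hj
  have heq := le_antisymm hle (hmax j hj.2)
  refine ⟨i, hi, j, hj.2, Ne.symm hj.1, hai, ?_, heq⟩
  intro h0; rw [h0, map_zero] at heq; exact hai ((Valuation.zero_iff V).1 heq)

/-- Discreteness for finite extensions. -/
theorem ofVal_finite {k L Γ : Type*} [Field k] [Field L] [Algebra k L] [FiniteDimensional k L]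
    [LinearOrderedCommGroupWithZero Γ] (V : Valuation L Γ) (τ : L) (hτ : τ ≠ 0)
    (hτ1 : V τ < 1) (H : ∀ c : k, c ≠ 0 → ∃ n : ℤ, V (algebraMap k L c) = V τ ^ n) :
    ∃ w : Place L, ∀ x, w.ge x 0 ↔ V x ≤ 1 := by
  classical
  refine Place.ofVal V τ hτ hτ1 (Module.finrank k L).factorial (Nat.factorial_pos _) fun x hx => ?_
  have hxint : IsIntegral k x := Algebra.IsIntegral.isIntegral x
  set P := minpoly k x
  have hP0 : P ≠ 0 := minpoly.ne_zero hxint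
  have hdeg : P.natDegree ≤ Module.finrank k L := minpoly.natDegree_le x
  have hsum : ∑ i ∈ P.support, algebraMap k L (P.coeff i) * x ^ i = 0 := by
    have := minpoly.aeval k x
    rw [Polynomial.aeval_eq_sum_range] at this
    rw [← this]
    simp only [Algebra.smul_def]
    refine Finset.sum_subset ?_ ?_
    · intro i hi; rw [Finset.mem_range]; exact Nat.lt_succ_of_le (Polynomial.le_natDegree_of_mem_supp i hi)
    · intro i _ hi; rw [Polynomial.notMem_support_iff.1 hi]; simp
  have key : ∃ i j : ℕ, i < j ∧ j ≤ Module.finrank k L ∧ P.coeff i ≠ 0 ∧ P.coeff j ≠ 0 ∧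
      V (algebraMap k L (P.coeff i) * x ^ i) = V (algebraMap k L (P.coeff j) * x ^ j) := by
    obtain ⟨i, hi, j, hj, hij, -, -, he⟩ := exists_pair V P.support _ hsum
      ⟨P.natDegree, Polynomial.natDegree_mem_support_of_nonzero hP0, by
        refine mul_ne_zero ?_ (pow_ne_zero _ hx)
        rw [Ne, FaithfulSMul.algebraMap_eq_zero_iff]
        exact Polynomial.leadingCoeff_ne_zero.2 hP0⟩
    have hi' := (Polynomial.le_natDegree_of_mem_supp i hi).trans hdeg
    have hj' := (Polynomial.le_natDegree_of_mem_supp j hj).trans hdeg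
    rw [Polynomial.mem_support_iff] at hi hj
    rcases lt_or_gt_of_ne hij with h | h
    · exact ⟨i, j, h, hj', hi, hj, he⟩
    · exact ⟨j, i, h, hi', hj, hi, he.symm⟩
  obtain ⟨i, j, hij, hj, hci, hcj, he⟩ := key
  obtain ⟨m, hm⟩ := H _ hci
  obtain ⟨m', hm'⟩ := H _ hcj
  have hV0 : V x ≠ 0 := (Valuation.ne_zero_iff V).2 hx
  have hτ0 : V τ ≠ 0 := (Valuation.ne_zero_iff V).2 hτ
  have h1 : V x ^ (j - i) = V τ ^ (m - m') := by
    rw [map_mul, map_mul, map_pow, map_pow, hm, hm'] at he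
    rw [zpow_sub₀ hτ0, eq_div_iff (zpow_ne_zero _ hτ0)]
    have hxi : V x ^ i ≠ 0 := pow_ne_zero _ hV0
    refine mul_right_cancel₀ hxi ?_
    rw [he, mul_right_comm, ← pow_add, Nat.sub_add_cancel hij.le, mul_comm]
  obtain ⟨s, hs⟩ : (j - i) ∣ (Module.finrank k L).factorial :=
    Nat.dvd_factorial (by omega) (by omega)
  refine ⟨(m - m') * s, ?_⟩
  rw [hs, pow_mul, h1, zpow_mul, zpow_natCast]


theorem Place.ge_one_iff_not_inv {K : Type*} [Field K] (v : Place K) {x : K} (hx : x ≠ 0) :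
    v.ge x 1 ↔ ¬ v.ge x⁻¹ 0 := by
  rw [Place.not_ge, Place.ord_inv]
  simp only [Place.ge, hx, false_or, ne_eq, inv_eq_zero, not_false_eq_true, true_and]
  omega

theorem Place.isLocalRing_O {K : Type*} [Field K] (v : Place K) : IsLocalRing v.O := by
  refine IsLocalRing.of_nonunits_add ?_
  have : ∀ a : v.O, a ∈ nonunits v.O ↔ v.ge (a : K) 1 := by
    intro a
    constructor
    · intro ha
      by_contra hc
      rw [Place.not_ge] at hc
      have h0 : v.ord (a : K) = 0 := by have := Place.ge.le a.2 hc.1; omega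
      apply ha
      refine IsUnit.of_mul_eq_one ⟨(a : K)⁻¹, Place.ge_of_ord (by rw [Place.ord_inv]; omega)⟩ ?_
      ext; simp [hc.1]
    · intro ha hu
      obtain ⟨b, hb⟩ := hu.exists_right_inv
      have hb' : (a : K) * b = 1 := congrArg Subtype.val hb
      have := (ha.mul0 b.2).le (by rw [hb']; simp)
      rw [hb', Place.ord_one] at this; omega
  intro a b ha hb
  rw [this] at *
  exact ha.add hb

theorem Place.exists_val {K L : Type*} [Field K] [Field L] [Algebra K L] (v : Place K) :
    ∃ W : ValuationSubring L, (∀ x : K, v.ge x 0 → W.valuation (algebraMap K L x) ≤ 1) ∧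
      (∀ x : K, v.ge x 1 → W.valuation (algebraMap K L x) < 1) := by
  have := v.isLocalRing_O
  let A0 : LocalSubring K := LocalSubring.mk v.O
  obtain ⟨W, hW, hW'⟩ := (A0.map (algebraMap K L)).exists_le_valuationSubring
  refine ⟨W, fun x hx => ?_, fun x hx => ?_⟩
  · rw [ValuationSubring.valuation_le_one_iff]
    exact hW ⟨x, hx, rfl⟩
  · by_cases hx0 : x = 0
    · simp [hx0]
    have hx1 : v.ge x 0 := hx.mono (by norm_num)
    have hmem : algebraMap K L x ∈ (A0.map (algebraMap K L)).toSubring := ⟨x, hx1, rfl⟩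
    have hle : W.valuation (algebraMap K L x) ≤ 1 := by
      rw [ValuationSubring.valuation_le_one_iff]; exact hW hmem
    refine lt_of_le_of_ne hle fun h1 => ?_
    have hinv : (algebraMap K L x)⁻¹ ∈ W := by
      rw [← ValuationSubring.valuation_le_one_iff, map_inv₀, h1, inv_one]
    have hu : IsUnit (Subring.inclusion hW ⟨algebraMap K L x, hmem⟩) := by
      refine IsUnit.of_mul_eq_one ⟨_, hinv⟩ ?_
      ext
      change algebraMap K L x * (algebraMap K L x)⁻¹ = 1
      exact mul_inv_cancel₀ (by simpa using hx0)
    have hu2 := hW'.map_nonunit _ hu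
    obtain ⟨⟨b, c, hc, rfl⟩, hb⟩ := hu2.exists_right_inv
    have hb' : algebraMap K L x * algebraMap K L c = 1 := congrArg Subtype.val hb
    rw [← map_mul] at hb'
    have h2 : x * c = 1 := (algebraMap K L).injective (by rw [hb', map_one])
    have := (hx.mul0 (show v.ge c 0 from hc)).le (by rw [h2]; simp)
    rw [h2, Place.ord_one] at this; omega

theorem Place.of_val_over {K L Γ : Type*} [Field K] [Field L] [Algebra K L] [FiniteDimensional K L]
    (v : Place K) [LinearOrderedCommGroupWithZero Γ] (V : Valuation L Γ)
    (h0 : ∀ x : K, v.ge x 0 → V (algebraMap K L x) ≤ 1)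
    (h1 : ∀ x : K, v.ge x 1 → V (algebraMap K L x) < 1) :
    ∃ (w : Place L) (e : ℤ), 0 < e ∧ (∀ x : L, w.ge x 0 ↔ V x ≤ 1) ∧
      ∀ x : K, w.ord (algebraMap K L x) = e * v.ord x := by
  obtain ⟨p, hp, hp1⟩ := v.surj
  have hu : ∀ x : K, x ≠ 0 → v.ord x = 0 → V (algebraMap K L x) = 1 := by
    intro x hx hx0
    refine le_antisymm (h0 x (Place.ge_of_ord hx0.ge)) ?_
    have := h0 x⁻¹ (Place.ge_of_ord (by rw [Place.ord_inv]; omega))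
    rw [map_inv₀, map_inv₀] at this
    exact (inv_le_one₀ (zero_lt_iff.2 ((Valuation.ne_zero_iff V).2 (by simpa using hx)))).1 this
  have hdec : ∀ x : K, x ≠ 0 → V (algebraMap K L x) = V (algebraMap K L p) ^ v.ord x := by
    intro x hx
    have hpz : p ^ v.ord x ≠ 0 := zpow_ne_zero _ hp
    have := hu (x / p ^ v.ord x) (div_ne_zero hx hpz)
      (by rw [Place.ord_div _ hx hpz, Place.ord_zpow, hp1]; ring)
    rw [map_div₀, map_div₀, map_zpow₀, map_zpow₀] at this
    rwa [div_eq_one_iff_eq] at this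
    exact zpow_ne_zero _ ((Valuation.ne_zero_iff V).2 (by simpa using hp))
  have hp1' : v.ge p 1 := Place.ge_of_ord hp1.ge
  obtain ⟨w, hw⟩ := ofVal_finite (k := K) V (algebraMap K L p) (by simpa using hp) (h1 p hp1')
    fun c hc => ⟨_, hdec c hc⟩
  have hwp : w.ge (algebraMap K L p) 1 := by
    rw [Place.ge_one_iff_not_inv _ (by simpa using hp), hw, map_inv₀, not_le]
    exact (one_lt_inv₀ (zero_lt_iff.2 ((Valuation.ne_zero_iff V).2 (by simpa using hp)))).2 (h1 p hp1')
  refine ⟨w, w.ord (algebraMap K L p), ?_, hw, ?_⟩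
  · have := hwp.le (by simpa using hp); omega
  · intro x
    by_cases hx : x = 0
    · simp [hx, Place.ord_zero]
    have hpz : p ^ v.ord x ≠ 0 := zpow_ne_zero _ hp
    have hy : x / p ^ v.ord x ≠ 0 := div_ne_zero hx hpz
    have hy1 := hu _ hy (by rw [Place.ord_div _ hx hpz, Place.ord_zpow, hp1]; ring)
    have a1 := ((hw _).2 hy1.le).le ((map_ne_zero _).2 hy)
    have a2 := ((hw (algebraMap K L (x / p ^ v.ord x))⁻¹).2 (by rw [map_inv₀, hy1, inv_one])).le
      (inv_ne_zero ((map_ne_zero _).2 hy))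
    rw [Place.ord_inv] at a2
    have a3 : w.ord (algebraMap K L (x / p ^ v.ord x)) = 0 := by omega
    rw [map_div₀, map_zpow₀, Place.ord_div _ (by simpa using hx)
      (zpow_ne_zero _ (by simpa using hp)), Place.ord_zpow] at a3
    linarith

/-- Extension of places. -/
theorem Place.exists_ext {K L : Type*} [Field K] [Field L] [Algebra K L] [FiniteDimensional K L]
    (v : Place K) :
    ∃ (w : Place L) (e : ℤ), 0 < e ∧ ∀ x : K, w.ord (algebraMap K L x) = e * v.ord x := by
  obtain ⟨W, h0, h1⟩ := v.exists_val (L := L)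
  obtain ⟨w, e, he, -, h⟩ := v.of_val_over W.valuation h0 h1
  exact ⟨w, e, he, h⟩

/-- Integral elements over a subfield of constants. -/
theorem Place.ge_of_integral {K L : Type*} [Field K] [Field L] [Algebra K L] (w : Place L)
    (hK : ∀ c : K, w.ge (algebraMap K L c) 0) {x : L} (hx : IsIntegral K x) : w.ge x 0 := by
  by_contra hc
  rw [Place.not_ge] at hc
  obtain ⟨P, hP, hP0⟩ := hx
  rw [Polynomial.eval₂_eq_sum_range, Finset.sum_range_succ, hP.coeff_natDegree, map_one, one_mul]
    at hP0
  have hn : P.natDegree ≠ 0 := by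
    intro h0
    rw [hP.natDegree_eq_zero.1 h0] at hP0
    simp at hP0
  have : w.ge (x ^ P.natDegree) ((P.natDegree - 1) * w.ord x) := by
    have e : x ^ P.natDegree = - ∑ i ∈ Finset.range P.natDegree, algebraMap K L (P.coeff i) * x ^ i := by
      linear_combination hP0
    rw [e]
    refine (Place.ge.sum _ _ fun i hi => ?_).neg
    rw [Finset.mem_range] at hi
    refine ((hK _).mul0' (Place.ge_self (x := x ^ i))).mono ?_
    rw [Place.ord_pow]
    have : (i : ℤ) ≤ P.natDegree - 1 := by omega
    nlinarith
  have := this.le (pow_ne_zero _ hc.1)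
  rw [Place.ord_pow] at this
  nlinarith

/-- Restriction of places. -/
theorem Place.exists_restr {K L : Type*} [Field K] [Field L] [Algebra K L] [Algebra.IsIntegral K L]
    (w : Place L) :
    ∃ (v : Place K) (e : ℤ), 0 < e ∧ ∀ x : K, w.ord (algebraMap K L x) = e * v.ord x := by
  have hne : ∀ x : K, x ≠ 0 → algebraMap K L x ≠ 0 := fun x hx => by simpa using hx
  refine Place.ofHom (fun x : K => w.ord (algebraMap K L x)) (by simp [w.ord_zero]) ?_ ?_ ?_
  · intro x y hx hy
    rw [map_mul, w.ord_mul _ _ (hne x hx) (hne y hy)]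
  · intro x y hx hy hxy
    have h3 := hne _ hxy
    rw [map_add] at h3 ⊢
    exact w.ord_add _ _ (hne x hx) (hne y hy) h3
  · by_contra hc
    push Not at hc
    obtain ⟨y, hy, hy1⟩ := w.exists_ord (-1)
    have := (w.ge_of_integral (K := K) (fun c => by
      by_cases h : c = 0
      · left; simp [h]
      · right; exact (hc c h).ge) (Algebra.IsIntegral.isIntegral y)).le hy
    omega
end GFq

namespace GFq
open IntermediateField

/-- Global function fields over `Fq` (constant field possibly larger). -/
class GF (Fq K : Type*) [Field Fq] [Field K] [Algebra Fq K] : Prop where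
  fin : Finite Fq
  ess : Algebra.EssFiniteType Fq K
  trdeg : Algebra.trdeg Fq K = 1

section
variable {Fq K : Type*} [Field Fq] [Field K] [Algebra Fq K]

theorem GF.exists_transc [h : GF Fq K] : ∃ x : K, Transcendental Fq x := by
  have : Algebra.Transcendental Fq K := by
    rw [← trdeg_ne_zero_iff, h.trdeg]; simp
  exact this.transcendental

theorem GF.finite_adjoin [h : GF Fq K] {x : K} (hx : Transcendental Fq x) :
    FiniteDimensional Fq⟮x⟯ K := by
  have hind : AlgebraicIndependent Fq (fun _ : Unit => x) := by
    rw [algebraicIndependent_unique_type_iff]; exact hx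
  have htb : IsTranscendenceBasis Fq (fun _ : Unit => x) := by
    refine hind.isTranscendenceBasis_of_lift_trdeg_le_of_finite ?_
    rw [h.trdeg]; simp
  have halg : Algebra.IsAlgebraic Fq⟮x⟯ K := by
    have := htb.isAlgebraic_field
    rwa [Set.range_const] at this
  have := h.ess
  have hess : Algebra.EssFiniteType Fq⟮x⟯ K := Algebra.EssFiniteType.of_comp Fq _ _
  have hfg := IntermediateField.fg_top Fq⟮x⟯ K
  obtain ⟨S, hS⟩ := hfg
  have : FiniteDimensional Fq⟮x⟯ (⊤ : IntermediateField Fq⟮x⟯ K) := by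
    rw [← hS]
    exact IntermediateField.finiteDimensional_adjoin fun y _ => Algebra.IsIntegral.isIntegral y
  exact (IntermediateField.topEquiv (F := Fq⟮x⟯) (E := K)).toLinearEquiv.finiteDimensional

theorem GF.of_finite {Fq : Type*} {K L : Type*} [Field Fq] [Field K] [Algebra Fq K] [h : GF Fq K]
    [Field L] [Algebra Fq L] [Algebra K L] [IsScalarTower Fq K L] [FiniteDimensional K L] : GF Fq L := by
  refine ⟨h.fin, ?_, ?_⟩
  · have := h.ess
    exact Algebra.EssFiniteType.comp Fq K L
  · have h1 := lift_trdeg_add_eq Fq K L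
    rw [h.trdeg, trdeg_eq_zero] at h1
    simpa using h1.symm

theorem GF.adjoin [h : GF Fq K] {x : K} (hx : Transcendental Fq x) : GF Fq Fq⟮x⟯ := by
  have := GF.finite_adjoin hx
  refine ⟨h.fin, ?_, ?_⟩
  · rw [IntermediateField.essFiniteType_iff]
    exact ⟨{x}, by simp⟩
  · have h1 := lift_trdeg_add_eq Fq Fq⟮x⟯ K
    rw [h.trdeg, trdeg_eq_zero (R := Fq⟮x⟯) (A := K)] at h1
    simpa using h1

theorem ge_const [Finite Fq] (v : Place K) (c : Fq) : v.ge (algebraMap Fq K c) 0 := by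
  by_cases hc : c = 0
  · left; simp [hc]
  right
  have := Fintype.ofFinite Fq
  have h1 : (algebraMap Fq K c) ^ (Fintype.card Fq - 1) = 1 := by
    rw [← map_pow, FiniteField.pow_card_sub_one_eq_one c hc, map_one]
  have h2 := v.ord_pow (algebraMap Fq K c) (Fintype.card Fq - 1)
  rw [h1, v.ord_one] at h2
  have h3 := Fintype.one_lt_card (α := Fq)
  have : ((Fintype.card Fq - 1 : ℕ) : ℤ) ≠ 0 := by omega
  rcases mul_eq_zero.1 h2.symm with h | h
  · exact absurd h this
  · exact h.ge

theorem ord_algebraic [Finite Fq] (v : Place K) {x : K} (hx : IsAlgebraic Fq x) : v.ord x = 0 := by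
  by_cases h0 : x = 0
  · rw [h0, v.ord_zero]
  have h1 := (v.ge_of_integral (ge_const v) hx.isIntegral).le h0
  have h2 := (v.ge_of_integral (ge_const v) hx.inv.isIntegral).le (inv_ne_zero h0)
  rw [v.ord_inv] at h2; omega

theorem transc_of_ord [Finite Fq] (v : Place K) {x : K} (hx : v.ord x ≠ 0) : Transcendental Fq x :=
  fun h => hx (ord_algebraic v h)

theorem ord_const [Finite Fq] (v : Place K) (c : Fq) : v.ord (algebraMap Fq K c) = 0 :=
  ord_algebraic v (isAlgebraic_algebraMap c)

theorem exists_pole [h : GF Fq K] {y : K} (hy : Transcendental Fq y) : ∃ v : Place K, v.ord y < 0 := by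
  have := h.fin
  have hfin := GF.finite_adjoin hy
  have hy0 : y ≠ 0 := by rintro rfl; exact hy (isAlgebraic_zero)
  -- a valuation ring
  have hV : ∃ V : ValuationSubring K, (∀ c : Fq, algebraMap Fq K c ∈ V) ∧ y ∉ V := by
    by_contra hc
    push Not at hc
    have hmem : y ∈ (⨅ V : {V : ValuationSubring K // (Set.range (algebraMap Fq K)) ⊆ V.toSubring},
        V.1.toSubring) := by
      rw [Subring.mem_iInf]
      rintro ⟨V, hV⟩
      exact hc V fun c => hV ⟨c, rfl⟩
    rw [iInf_valuationSubring_superset] at hmem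
    have hmem' : IsIntegral (Subring.closure (Set.range (algebraMap Fq K))) y := hmem
    have hcl : Subring.closure (Set.range (algebraMap Fq K)) = (algebraMap Fq K).range := by
      rw [← RingHom.coe_range]; exact Subring.closure_eq _
    rw [hcl] at hmem'
    apply hy
    obtain ⟨P, hP, hP0⟩ := hmem'
    obtain ⟨Q, hQ, -, hQm⟩ := Polynomial.lifts_and_degree_eq_and_monic (f := (algebraMap Fq K).rangeRestrict)
      (p := P) (by
        rw [Polynomial.lifts_iff_coeff_lifts]; intro n
        exact RingHom.rangeRestrict_surjective _ _) hP
    refine ⟨Q, hQm.ne_zero, ?_⟩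
    rw [← hQ, Polynomial.eval₂_map] at hP0
    exact hP0
  obtain ⟨V, hVc, hVy⟩ := hV
  have hVy' : 1 < V.valuation y := by
    rw [← not_le, ValuationSubring.valuation_le_one_iff]; exact hVy
  have hVc1 : ∀ c : Fq, c ≠ 0 → V.valuation (algebraMap Fq K c) = 1 := by
    intro c hc
    refine le_antisymm ((V.valuation_le_one_iff _).2 (hVc c)) ?_
    have := (V.valuation_le_one_iff _).2 (hVc c⁻¹)
    rw [map_inv₀, map_inv₀] at this
    exact (inv_le_one₀ (zero_lt_iff.2 ((Valuation.ne_zero_iff _).2 (by simpa using hc)))).1 this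
  have hpoly : ∀ f : Polynomial Fq, f ≠ 0 →
      V.valuation (Polynomial.aeval y f) = V.valuation y ^ f.natDegree := by
    intro f hf
    have hl : V.valuation (algebraMap Fq K f.leadingCoeff * y ^ f.natDegree) = V.valuation y ^ f.natDegree := by
      rw [map_mul, map_pow, hVc1 _ (Polynomial.leadingCoeff_ne_zero.2 hf), one_mul]
    rw [Polynomial.aeval_eq_sum_range, Finset.sum_range_succ, Algebra.smul_def]
    rw [← hl]
    refine V.valuation.map_add_eq_of_lt_right ?_
    change _ < V.valuation (algebraMap Fq K f.leadingCoeff * y ^ f.natDegree)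
    rw [hl]
    have h0 : V.valuation y ≠ 0 := (Valuation.ne_zero_iff _).2 hy0
    refine V.valuation.map_sum_lt (pow_ne_zero _ h0) fun i hi => ?_
    rw [Finset.mem_range] at hi
    rw [Algebra.smul_def, map_mul, map_pow]
    refine lt_of_le_of_lt (mul_le_of_le_one_left (zero_le) ((V.valuation_le_one_iff _).2 (hVc _))) ?_
    exact pow_lt_pow_right₀ hVy' hi
  obtain ⟨w, hw⟩ := ofVal_finite (k := Fq⟮y⟯) V.valuation y⁻¹ (inv_ne_zero hy0)
    (by rw [map_inv₀]; exact inv_lt_one_of_one_lt₀ hVy') (by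
      rintro ⟨c, hc⟩ hc0
      obtain ⟨r, s, hrs⟩ := (IntermediateField.mem_adjoin_simple_iff Fq c).1 hc
      have hc0' : c ≠ 0 := fun h => hc0 (by ext; exact h)
      have hr : r ≠ 0 := by rintro rfl; rw [hrs] at hc0'; simp at hc0'
      have hs : s ≠ 0 := by rintro rfl; rw [hrs] at hc0'; simp at hc0'
      refine ⟨s.natDegree - r.natDegree, ?_⟩
      change V.valuation c = _
      have h0 : V.valuation y ≠ 0 := (Valuation.ne_zero_iff _).2 hy0
      rw [hrs, map_div₀, hpoly r hr, hpoly s hs, map_inv₀, inv_zpow, ← zpow_neg, neg_sub,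
        zpow_sub₀ h0, zpow_natCast, zpow_natCast])
  refine ⟨w, ?_⟩
  have : ¬ w.ge y 0 := by rw [hw, not_le]; exact hVy'
  exact (Place.not_ge.1 this).2

theorem exists_zero [h : GF Fq K] {y : K} (hy : Transcendental Fq y) : ∃ v : Place K, 0 < v.ord y := by
  obtain ⟨v, hv⟩ := exists_pole (y := y⁻¹) (fun h => hy (by simpa using h.inv))
  exact ⟨v, by rw [v.ord_inv] at hv; omega⟩

noncomputable instance algO [Finite Fq] (v : Place K) : Algebra Fq v.O :=
  ((algebraMap Fq K).codRestrict v.O (fun c => ge_const v c)).toAlgebra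

theorem coe_algO [Finite Fq] (v : Place K) (c : Fq) : ((algebraMap Fq v.O c : v.O) : K) = algebraMap Fq K c :=
  rfl

theorem coe_smul_O [Finite Fq] (v : Place K) (c : Fq) (x : v.O) : ((c • x : v.O) : K) = c • (x : K) := by
  rw [Algebra.smul_def, Algebra.smul_def]; rfl

theorem Place.ge.smul [Finite Fq] {v : Place K} {x : K} {n : ℤ} (h : v.ge x n) (c : Fq) : v.ge (c • x) n := by
  rw [Algebra.smul_def]; exact (ge_const v c).mul0' h

variable (Fq) in
/-- degree of a place -/
noncomputable def Place.deg [Finite Fq] (v : Place K) : ℕ := Module.finrank Fq v.κ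

/-- Independence modulo `xB` implies independence over `Fq(x)`. -/
theorem card_le_finrank [h : GF Fq K] {x : K} (hx : Transcendental Fq x) (Z : Finset (Place K))
    (hZ : ∀ v ∈ Z, 0 < v.ord x) {ι : Type*} [Fintype ι] (ω : ι → K) (hω : ∀ j, ∀ v ∈ Z, v.ge (ω j) 0)
    (hind : ∀ c : ι → Fq, (∀ v ∈ Z, v.ge (∑ j, c j • ω j) (v.ord x)) → c = 0) :
    Fintype.card ι ≤ Module.finrank Fq⟮x⟯ K := by
  classical
  have hfin := h.fin
  have := GF.finite_adjoin hx
  have hx0 : x ≠ 0 := by rintro rfl; exact hx (isAlgebraic_zero)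
  refine LinearIndependent.fintype_card_le_finrank (R := Fq⟮x⟯) (M := K) (b := ω) ?_
  -- polynomial independence
  have key : ∀ (N : ℕ) (f : ι → Polynomial Fq), (∀ j, (f j).natDegree < N) →
      ∑ j, Polynomial.aeval x (f j) * ω j = 0 → ∀ j, f j = 0 := by
    intro N
    induction N with
    | zero => intro f hf; intro _ j; exact absurd (hf j) (by omega)
    | succ N ih =>
      intro f hf hs
      have hc : (fun j => (f j).coeff 0) = 0 := by
        apply hind
        intro v hv
        have e : ∑ j, (f j).coeff 0 • ω j = - (x * ∑ j, Polynomial.aeval x (f j).divX * ω j) := by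
          have h1 : ∀ j, Polynomial.aeval x (f j) * ω j =
              x * (Polynomial.aeval x (f j).divX * ω j) + (f j).coeff 0 • ω j := by
            intro j
            conv_lhs => rw [← Polynomial.divX_mul_X_add (f j)]
            simp only [map_add, map_mul, Polynomial.aeval_X, Polynomial.aeval_C, Algebra.smul_def]
            ring
          simp_rw [h1] at hs
          rw [Finset.sum_add_distrib, ← Finset.mul_sum] at hs
          linear_combination hs
        rw [e]
        refine (Place.ge_self.mul0 (Place.ge.sum _ _ fun j _ => ?_)).neg
        refine Place.ge.mul0 ?_ (hω j v hv)
        rw [Polynomial.aeval_eq_sum_range]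
        refine Place.ge.sum _ _ fun i _ => (Place.ge.pow ?_ i).smul _
        exact Place.ge_of_ord (hZ v hv).le
      have hdiv : ∀ j, f j = (f j).divX * Polynomial.X := by
        intro j
        conv_lhs => rw [← Polynomial.divX_mul_X_add (f j)]
        have : (f j).coeff 0 = 0 := congrFun hc j
        rw [this]; simp
      have hs' : ∑ j, Polynomial.aeval x (f j).divX * ω j = 0 := by
        have h1 : ∀ j, Polynomial.aeval x (f j) * ω j = x * (Polynomial.aeval x (f j).divX * ω j) := by
          intro j
          conv_lhs => rw [hdiv j]
          simp only [map_mul, Polynomial.aeval_X]; ring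
        simp_rw [h1] at hs
        rw [← Finset.mul_sum] at hs
        exact (mul_eq_zero.1 hs).resolve_left hx0
      by_cases hN : N = 0
      · intro j
        have h1 : (f j).natDegree = 0 := by have := hf j; omega
        rw [Polynomial.eq_C_of_natDegree_eq_zero h1, show (f j).coeff 0 = 0 from congrFun hc j]; simp
      · intro j
        rw [hdiv j, ih (fun j => (f j).divX) (fun j => ?_) hs' j, zero_mul]
        rw [Polynomial.natDegree_divX_eq_natDegree_tsub_one]
        have := hf j; omega
  rw [Fintype.linearIndependent_iff]
  intro g hg
  -- clear denominators
  have hrep : ∀ j, ∃ r s : Polynomial Fq, s ≠ 0 ∧ (g j : K) = Polynomial.aeval x r / Polynomial.aeval x s := by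
    intro j
    obtain ⟨r, s, hrs⟩ := (IntermediateField.mem_adjoin_simple_iff Fq (g j : K)).1 (g j).2
    by_cases hs : s = 0
    · refine ⟨0, 1, one_ne_zero, ?_⟩; rw [hrs, hs]; simp
    · exact ⟨r, s, hs, hrs⟩
  choose r s hs hrs using hrep
  have hsx : ∀ j, Polynomial.aeval x (s j) ≠ 0 := fun j => fun h0 => hx ⟨s j, hs j, h0⟩
  have hz := key ((Finset.univ.sup fun j => (r j * ∏ i ∈ Finset.univ.erase j, s i).natDegree) + 1)
    (fun j => r j * ∏ i ∈ Finset.univ.erase j, s i)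
    (fun j => Nat.lt_succ_of_le (Finset.le_sup (f := fun j => (r j * ∏ i ∈ Finset.univ.erase j, s i).natDegree)
      (Finset.mem_univ j))) (by
      have e : ∀ j, Polynomial.aeval x (r j * ∏ i ∈ Finset.univ.erase j, s i) * ω j =
          (∏ i, Polynomial.aeval x (s i)) * (g j • ω j) := by
        intro j
        rw [← Finset.mul_prod_erase Finset.univ _ (Finset.mem_univ j), map_mul, map_prod,
          IntermediateField.smul_def, hrs j, smul_eq_mul]
        have := hsx j
        field_simp
      simp_rw [e]
      rw [← Finset.mul_sum, hg, mul_zero])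
  intro j
  have h1 := hz j
  have h2 : (∏ i ∈ Finset.univ.erase j, s i) ≠ 0 := Finset.prod_ne_zero_iff.2 fun i _ => hs i
  have h3 : r j = 0 := (mul_eq_zero.1 h1).resolve_right h2
  ext
  rw [hrs j, h3]; simp

end
end GFq

namespace GFq
open IntermediateField

section
variable {Fq K : Type*} [Field Fq] [Field K] [Algebra Fq K]

theorem res_sum_smul [Finite Fq] (v : Place K) {ι : Type*} [Fintype ι] (u : ι → K) (hu : ∀ j, v.ge (u j) 0)
    (c : ι → Fq) :
    ∑ j, c j • v.res (u j) (hu j) = v.res (∑ j, c j • u j) (Place.ge.sum _ _ fun j _ => (hu j).smul (c j)) := by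
  have : (∑ j, c j • (⟨u j, hu j⟩ : v.O)) = ⟨∑ j, c j • u j, Place.ge.sum _ _ fun j _ => (hu j).smul (c j)⟩ := by
    apply Subtype.ext
    rw [AddSubmonoidClass.coe_finsetSum]
    exact Finset.sum_congr rfl fun j _ => coe_smul_O v (c j) _
  unfold Place.res
  rw [← this, map_sum]
  rfl

theorem coeff_zero_of_res [Finite Fq] (v : Place K) {ι : Type*} [Fintype ι] (u : ι → K) (hu : ∀ j, v.ge (u j) 0)
    (hi : LinearIndependent Fq fun j => v.res (u j) (hu j))
    (c : ι → Fq) (h : v.ge (∑ j, c j • u j) 1) : c = 0 := by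
  rw [Fintype.linearIndependent_iff] at hi
  funext j
  refine hi c ?_ j
  rw [res_sum_smul, Place.res_eq_zero]; exact h

theorem finite_κ_aux [h : GF Fq K] (v : Place K) : (have := h.fin; FiniteDimensional Fq v.κ) := by
  have hfin := h.fin
  change FiniteDimensional Fq v.κ
  obtain ⟨p, hp, hp1⟩ := v.exists_unif
  have ht : Transcendental Fq p := transc_of_ord v (by omega)
  have hb : Module.rank Fq v.κ ≤ (Module.finrank Fq⟮p⟯ K : ℕ) := by
    refine rank_le fun s hs => ?_
    have hlift : ∀ a : v.κ, ∃ x, ∃ hx : v.ge x 0, v.res x hx = a := v.res_surj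
    choose L hL hLr using hlift
    have := card_le_finrank ht {v} (by simp [hp1]) (fun j : s => L j) (by
      intro j w hw; rw [Finset.mem_singleton] at hw; subst hw; exact hL _) (by
      intro c hc
      refine coeff_zero_of_res v _ (fun j : s => hL j) ?_ c ?_
      · simp_rw [hLr]; exact hs
      · have := hc v (by simp)
        rwa [hp1] at this)
    simpa using this
  exact Module.rank_lt_aleph0_iff.1 (lt_of_le_of_lt hb Cardinal.natCast_lt_aleph0)

instance [Finite Fq] [h : GF Fq K] (v : Place K) : FiniteDimensional Fq v.κ := finite_κ_aux v

theorem finite_κ [Finite Fq] [h : GF Fq K] (v : Place K) : Finite v.κ := Module.finite_of_finite Fq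

theorem deg_pos [Finite Fq] [h : GF Fq K] (v : Place K) : 0 < v.deg Fq := Module.finrank_pos

theorem card_κ [Finite Fq] [h : GF Fq K] (v : Place K) : Nat.card v.κ = Nat.card Fq ^ v.deg Fq :=
  Module.natCard_eq_pow_finrank

theorem good [h : GF Fq K] (h2 : (2 : Fq) ≠ 0) (v : Place K) : v.Good := by
  have hf := h.fin
  have e : (2 : K) = algebraMap Fq K 2 := (map_ofNat _ 2).symm
  have h2K : (2 : K) ≠ 0 := by rw [e]; exact (map_ne_zero _).2 h2
  have h3 : v.ord 2 = 0 := by rw [e]; exact ord_const v 2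
  exact ⟨finite_κ (Fq := Fq) v, h2K, h3⟩

theorem coeff_zero_pow [Finite Fq] (v : Place K) {p : K} (hp : p ≠ 0) (hp1 : v.ord p = 1)
    {ι : Type*} [Fintype ι] (u : ι → K) (hu : ∀ j, v.ge (u j) 0)
    (hi : LinearIndependent Fq fun j => v.res (u j) (hu j)) (n : ℕ)
    (c : Fin n → ι → Fq) (h : v.ge (∑ i, ∑ j, c i j • (p ^ (i : ℕ) * u j)) n) : c = 0 := by
  induction n with
  | zero => funext i; exact i.elim0
  | succ n ih =>
    have hs : ∑ i : Fin (n+1), ∑ j, c i j • (p ^ (i : ℕ) * u j) =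
        (∑ j, c 0 j • u j) + p * ∑ i : Fin n, ∑ j, c i.succ j • (p ^ (i : ℕ) * u j) := by
      rw [Fin.sum_univ_succ, Finset.mul_sum]
      congr 1
      · simp
      · refine Finset.sum_congr rfl fun i _ => ?_
        rw [Finset.mul_sum]
        refine Finset.sum_congr rfl fun j _ => ?_
        rw [mul_smul_comm]; congr 1
        simp only [Fin.val_succ]; ring
    rw [hs] at h
    have hge : v.ge (∑ i : Fin n, ∑ j, c i.succ j • (p ^ (i : ℕ) * u j)) 0 := by
      refine Place.ge.sum _ _ fun i _ => Place.ge.sum _ _ fun j _ => ?_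
      exact (Place.ge.mul0 (Place.ge.pow (Place.ge_of_ord (by omega)) _) (hu j)).smul _
    have hp' : v.ge p 1 := Place.ge_of_ord hp1.ge
    have h0 : c 0 = 0 := by
      refine coeff_zero_of_res v u hu hi _ ?_
      have h1 := (h.mono (m := 1) (by push_cast; omega)).sub (hp'.mul0 hge)
      simpa using h1
    have h1 : (fun i : Fin n => c i.succ) = 0 := by
      apply ih
      rw [h0] at h
      simp only [Pi.zero_apply, zero_smul, Finset.sum_const_zero, zero_add] at h
      rw [Place.ge_mul_iff hp, hp1] at h
      refine h.mono ?_
      push_cast; omega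
    funext i
    refine Fin.cases h0 (fun i => congrFun h1 i) i

theorem sum_ord_le [Finite Fq] [h : GF Fq K] {x : K} (hx : Transcendental Fq x) (Z : Finset (Place K))
    (hZ : ∀ v ∈ Z, 0 < v.ord x) :
    ∑ v ∈ Z, v.ord x * v.deg Fq ≤ (Module.finrank Fq⟮x⟯ K : ℕ) := by
  classical
  have h1 : ∀ v : Place K, ∃ p, p ≠ 0 ∧ v.ord p = 1 := fun v => v.exists_unif
  choose p hp hp1 using h1
  have h2 : ∀ (v : Place K) (j : Fin (v.deg Fq)), ∃ x, ∃ hx : v.ge x 0, v.res x hx = Module.finBasis Fq v.κ j :=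
    fun v j => v.res_surj _
  choose u hu hur using h2
  let ι := Σ v : Z, Fin (v.1.ord x).toNat × Fin (v.1.deg Fq)
  have h3 : ∀ k : ι, ∃ z : K, ∀ w ∈ Z, w.ge (z - if w = k.1.1 then p w ^ (k.2.1 : ℕ) * u k.1 k.2.2 else 0) (w.ord x) :=
    fun k => Place.approx Z _ _
  choose ω hω using h3
  have hmain := card_le_finrank hx Z hZ ω (by
    intro k w hw
    have h1 := (hω k w hw).mono (m := 0) (hZ w hw).le
    have h2 : w.ge (if w = k.1.1 then p w ^ (k.2.1 : ℕ) * u k.1 k.2.2 else 0) 0 := by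
      split_ifs with hwk
      · subst hwk
        exact Place.ge.mul0 (Place.ge.pow (Place.ge_of_ord (by rw [hp1]; omega)) _) (hu _ _)
      · exact Place.ge_zero _
    simpa using h1.add h2) (by
    intro c hc
    have key : ∀ v : Z, (fun (i : Fin (v.1.ord x).toNat) (j : Fin (v.1.deg Fq)) => c ⟨v, (i, j)⟩) = 0 := by
      intro v
      refine coeff_zero_pow v.1 (hp v) (hp1 v) (u v) (hu v) ?_ _ _ ?_
      · simp_rw [hur]; exact (Module.finBasis Fq v.1.κ).linearIndependent
      · have hpos := hZ v v.2
        have e : (((v.1.ord x).toNat : ℕ) : ℤ) = v.1.ord x := by omega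
        rw [e]
        have h1 := hc v v.2
        have h2 : v.1.ge (∑ k : ι, c k • (ω k - if v.1 = k.1.1 then p v ^ (k.2.1 : ℕ) * u k.1 k.2.2 else 0)) (v.1.ord x) :=
          Place.ge.sum _ _ fun k _ => (hω k v v.2).smul _
        have h3 := h1.sub h2
        rw [← Finset.sum_sub_distrib] at h3
        simp_rw [← smul_sub, sub_sub_cancel] at h3
        rw [Fintype.sum_sigma] at h3
        rw [Finset.sum_eq_single v] at h3
        · rw [Fintype.sum_prod_type] at h3
          simpa using h3
        · intro w _ hwv
          refine Finset.sum_eq_zero fun k _ => ?_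
          rw [if_neg, smul_zero]
          intro hh; exact hwv (Subtype.ext hh.symm)
        · simp
    funext k
    have := congrFun (congrFun (key k.1) k.2.1) k.2.2
    exact this)
  have hcard : (Fintype.card ι : ℤ) = ∑ v ∈ Z, v.ord x * v.deg Fq := by
    rw [Fintype.card_sigma, ← Finset.sum_coe_sort Z, Nat.cast_sum]
    refine Finset.sum_congr rfl fun v _ => ?_
    rw [Fintype.card_prod, Fintype.card_fin, Fintype.card_fin, Nat.cast_mul]
    have := hZ v v.2
    congr 1; omega
  rw [← hcard]; exact_mod_cast hmain

theorem finite_zeros [h : GF Fq K] {x : K} (hx : Transcendental Fq x) : {v : Place K | 0 < v.ord x}.Finite := by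
  have := h.fin
  by_contra hinf
  obtain ⟨Z, hZ, hc⟩ := Set.Infinite.exists_subset_card_eq hinf (Module.finrank Fq⟮x⟯ K + 1)
  have h1 := sum_ord_le hx Z (fun v hv => hZ hv)
  have h2 : ∑ v ∈ Z, (1 : ℤ) ≤ ∑ v ∈ Z, v.ord x * v.deg Fq := by
    refine Finset.sum_le_sum fun v hv => ?_
    have h3 : 0 < v.ord x := hZ hv
    have h4 : (0 : ℤ) < v.deg Fq := by exact_mod_cast deg_pos v
    exact Int.add_one_le_iff.2 (mul_pos h3 h4)
  simp only [Finset.sum_const, hc] at h2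
  simp at h2
  omega

variable (Fq) in
theorem finite_supp [h : GF Fq K] (x : K) : {v : Place K | v.ord x ≠ 0}.Finite := by
  have := h.fin
  by_cases hx : Transcendental Fq x
  · have hx' : Transcendental Fq x⁻¹ := fun h => hx (by simpa using h.inv)
    refine ((finite_zeros hx).union (finite_zeros hx')).subset ?_
    intro v (hv : v.ord x ≠ 0)
    simp only [Set.mem_union, Set.mem_ofPred_eq, v.ord_inv]
    omega
  · convert Set.finite_empty
    ext v
    simp only [Set.mem_ofPred_eq, Set.mem_empty_iff_false, iff_false, not_not]
    exact ord_algebraic v (not_not.1 hx)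

end
end GFq

namespace GFq
open IntermediateField

section
variable {Fq K : Type*} [Field Fq] [Field K] [Algebra Fq K]

variable (Fq) in
/-- Riemann–Roch space. -/
def RR [Finite Fq] (D : Place K → ℤ) : Submodule Fq K where
  carrier := {x | ∀ v : Place K, v.ge x (-D v)}
  add_mem' h h' := fun v => (h v).add (h' v)
  zero_mem' := fun v => Place.ge_zero _
  smul_mem' c x h := fun v => (h v).smul c

theorem mem_RR [Finite Fq] {D : Place K → ℤ} {x : K} : x ∈ RR Fq D ↔ ∀ v : Place K, v.ge x (-D v) := Iff.rfl

theorem RR_step [Finite Fq] [h : GF Fq K] (D D' : Place K → ℤ) (v : Place K) (hv : D' v = D v + 1)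
    (hw : ∀ w, w ≠ v → D' w = D w) [FiniteDimensional Fq (RR Fq D)] :
    FiniteDimensional Fq (RR Fq D') ∧ Module.finrank Fq (RR Fq D') ≤ Module.finrank Fq (RR Fq D) + v.deg Fq := by
  obtain ⟨p, hp, hpo⟩ := v.exists_ord (D v + 1)
  have hO : ∀ x : RR Fq D', v.ge (p * x) 0 := fun x => by
    rw [Place.ge_mul_iff hp, hpo]
    have := x.2 v
    rw [hv] at this
    simpa using this
  let f0 : RR Fq D' →ₗ[Fq] v.O :=
    { toFun := fun x => ⟨p * x, hO x⟩
      map_add' := fun x y => Subtype.ext (by simp [mul_add])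
      map_smul' := fun c x => Subtype.ext (by rw [coe_smul_O]; simp) }
  let f : RR Fq D' →ₗ[Fq] v.κ := (Ideal.Quotient.mkₐ Fq v.I).toLinearMap ∘ₗ f0
  have hker : ∀ x : LinearMap.ker f, (x : K) ∈ RR Fq D := by
    rintro ⟨x, hx⟩ w
    by_cases hwv : w = v
    · subst hwv
      have h1 : Ideal.Quotient.mk w.I (f0 x) = 0 := hx
      rw [Ideal.Quotient.eq_zero_iff_mem, Place.mem_I] at h1
      have h2 : w.ge (p * x) 1 := h1
      rw [Place.ge_mul_iff hp, hpo] at h2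
      exact h2.mono (by omega)
    · have := x.2 w
      rw [hw w hwv] at this; exact this
  let g : LinearMap.ker f →ₗ[Fq] RR Fq D :=
    { toFun := fun x => ⟨x, hker x⟩
      map_add' := fun x y => rfl
      map_smul' := fun c x => rfl }
  have hg : Function.Injective g := fun x y hxy => by
    have : ((x : RR Fq D') : K) = y := congrArg (fun z : RR Fq D => (z : K)) hxy
    exact Subtype.ext (Subtype.ext this)
  have hfk : FiniteDimensional Fq (LinearMap.ker f) := Module.Finite.of_injective g hg
  have hfq : FiniteDimensional Fq (RR Fq D' ⧸ LinearMap.ker f) :=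
    Module.Finite.equiv f.quotKerEquivRange.symm
  have hfd : FiniteDimensional Fq (RR Fq D') := Module.Finite.of_submodule_quotient (LinearMap.ker f)
  refine ⟨hfd, ?_⟩
  rw [← f.finrank_range_add_finrank_ker, add_comm]
  exact add_le_add (LinearMap.finrank_le_finrank_of_injective hg) (Submodule.finrank_le _)

theorem RR_add [Finite Fq] [h : GF Fq K] (E : Place K →₀ ℕ) : ∀ (D : Place K → ℤ), 
    FiniteDimensional Fq (RR Fq D) →
    FiniteDimensional Fq (RR Fq (fun v => D v + E v)) ∧
      Module.finrank Fq (RR Fq (fun v => D v + E v)) ≤ Module.finrank Fq (RR Fq D) + E.sum fun v n => n * v.deg Fq := by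
  classical
  induction E using Finsupp.induction_linear with
  | zero =>
    intro D hD
    have e : (fun v => D v + ((0 : Place K →₀ ℕ) v : ℕ)) = D := by funext v; simp
    rw [e]; simpa using hD
  | add E F hE hF =>
    intro D hD
    obtain ⟨h1, h2⟩ := hE D hD
    obtain ⟨h3, h4⟩ := hF _ h1
    have e : (fun v => D v + ((E + F) v : ℕ)) = fun v => D v + (E v : ℤ) + F v := by
      funext v; simp [add_assoc]
    rw [e]
    refine ⟨h3, h4.trans ?_⟩
    rw [Finsupp.sum_add_index' (by simp) (by intros; ring)]
    omega
  | single v n =>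
    induction n with
    | zero =>
      intro D hD
      have e : (fun w => D w + ((Finsupp.single v 0 : Place K →₀ ℕ) w : ℕ)) = D := by funext v; simp
      rw [e]; simpa using hD
    | succ n ih =>
      intro D hD
      obtain ⟨h1, h2⟩ := ih D hD
      have h3 := RR_step (Fq := Fq) (fun w => D w + (Finsupp.single v n w : ℕ))
        (fun w => D w + (Finsupp.single v (n+1) w : ℕ)) v (by simp [add_assoc])
        (fun w hw => by simp [Finsupp.single_apply, Ne.symm hw])
      refine ⟨h3.1, h3.2.trans ?_⟩
      simp only [Finsupp.sum_single_index, zero_mul] at h2 ⊢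
      linarith

variable (Fq) in
theorem exists_place [h : GF Fq K] : Nonempty (Place K) := by
  obtain ⟨x, hx⟩ := h.exists_transc
  obtain ⟨v, -⟩ := exists_pole hx
  exact ⟨v⟩

theorem const_of_ge [h : GF Fq K] {x : K} (hx : ∀ v : Place K, v.ge x 0) : IsAlgebraic Fq x := by
  by_contra ht
  obtain ⟨v, hv⟩ := exists_pole ht
  rcases hx v with h1 | h1
  · rw [h1, v.ord_zero] at hv; omega
  · omega

instance RR_zero_finite [Finite Fq] [h : GF Fq K] : FiniteDimensional Fq (RR Fq (fun _ : Place K => 0)) := by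
  obtain ⟨v⟩ := exists_place Fq (K := K)
  let f0 : RR Fq (fun _ : Place K => 0) →ₗ[Fq] v.O :=
    { toFun := fun x => ⟨x, v.mem_O.2 (by simpa using x.2 v)⟩
      map_add' := fun x y => Subtype.ext (by simp)
      map_smul' := fun c x => Subtype.ext (by rw [coe_smul_O]; simp) }
  let f : RR Fq (fun _ : Place K => 0) →ₗ[Fq] v.κ := (Ideal.Quotient.mkₐ Fq v.I).toLinearMap ∘ₗ f0
  refine Module.Finite.of_injective f ?_
  rw [← LinearMap.ker_eq_bot, LinearMap.ker_eq_bot']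
  intro x hx
  have h1 : Ideal.Quotient.mk v.I (f0 x) = 0 := hx
  rw [Ideal.Quotient.eq_zero_iff_mem, Place.mem_I] at h1
  have h2 : v.ge (x : K) 1 := h1
  have h3 := const_of_ge (Fq := Fq) (x := (x : K)) (fun w => by simpa using x.2 w)
  rcases h2 with h2 | h2
  · exact Subtype.ext h2
  · rw [ord_algebraic v h3] at h2; omega

variable (Fq) in
/-- the pole divisor -/
noncomputable def poles [h : GF Fq K] (x : K) : Place K →₀ ℕ :=
  Finsupp.onFinset (finite_supp Fq x).toFinset (fun v => (-v.ord x).toNat) (by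
    intro v hv
    simp only [Set.Finite.mem_toFinset, Set.mem_ofPred_eq]
    omega)

theorem poles_apply [h : GF Fq K] (x : K) (v : Place K) : poles Fq x v = (-v.ord x).toNat := rfl

variable (Fq) in
noncomputable def degN [Finite Fq] (E : Place K →₀ ℕ) : ℕ := E.sum fun v n => n * v.deg Fq

/-- linear independence of `ω_j y^i`. -/
theorem linInd_pow [h : GF Fq K] {y : K} (hy : Transcendental Fq y) {ι : Type*} [Fintype ι] (ω : ι → K)
    (hω : LinearIndependent Fq⟮y⟯ ω) (n : ℕ) :
    LinearIndependent Fq (fun k : ι × Fin n => ω k.1 * y ^ (k.2 : ℕ)) := by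
  rw [Fintype.linearIndependent_iff] at hω ⊢
  intro c hc
  rw [Fintype.sum_prod_type] at hc
  let P : ι → Polynomial Fq := fun j => ∑ i : Fin n, Polynomial.monomial i (c (j, i))
  have hP : ∀ j i, (P j).coeff (i : Fin n) = c (j, i) := by
    intro j i
    simp only [P, Polynomial.finsetSum_coeff, Polynomial.coeff_monomial]
    rw [Finset.sum_eq_single i]
    · simp
    · intro b _ hb
      rw [if_neg]; intro hh; exact hb (Fin.ext hh)
    · simp
  have hev : ∀ j, ∑ i, c (j, i) • (ω j * y ^ (i : ℕ)) = Polynomial.aeval y (P j) * ω j := by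
    intro j
    simp only [P, map_sum, Polynomial.aeval_monomial, Finset.sum_mul, Algebra.smul_def]
    exact Finset.sum_congr rfl fun i _ => by ring
  simp only [hev] at hc
  have hmem : ∀ j, Polynomial.aeval y (P j) ∈ Fq⟮y⟯ := fun j =>
    IntermediateField.algebra_adjoin_le_adjoin _ _ (Polynomial.aeval_mem_adjoin_singleton _ _)
  have h1 := hω (fun j => ⟨_, hmem j⟩) (by
    simp only [IntermediateField.smul_def, smul_eq_mul]; exact hc)
  rintro ⟨j, i⟩
  have h2 : Polynomial.aeval y (P j) = 0 := congrArg Subtype.val (h1 j)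
  have h3 : P j = 0 := by
    by_contra hne; exact hy ⟨P j, hne, h2⟩
  rw [← hP j i, h3]; simp

theorem finrank_le_poles [Finite Fq] [h : GF Fq K] {y : K} (hy : Transcendental Fq y) :
    Module.finrank Fq⟮y⟯ K ≤ degN Fq (poles Fq y) := by
  have := GF.finite_adjoin hy
  set d := Module.finrank Fq⟮y⟯ K with hd
  let ω := Module.finBasis Fq⟮y⟯ K
  set P := poles Fq y with hPdef
  let E : Place K →₀ ℕ := ∑ j, poles Fq (ω j)
  set l0 := Module.finrank Fq (RR Fq (fun _ : Place K => 0)) with hl0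
  have key : ∀ n : ℕ, d * n ≤ l0 + (n * degN Fq P + degN Fq E) := by
    intro n
    have h1 := RR_add (Fq := Fq) (n • P + E) (fun _ : Place K => 0) RR_zero_finite
    have hdeg : (n • P + E).sum (fun v n => n * v.deg Fq) = n * degN Fq P + degN Fq E := by
      rw [Finsupp.sum_add_index' (by simp) (by intros; ring), Finsupp.sum_smul_index' (by simp)]
      simp only [degN, Finsupp.sum, Finset.mul_sum, smul_eq_mul, mul_assoc]
    rw [hdeg] at h1
    obtain ⟨h1, h2⟩ := h1
    refine le_trans ?_ h2
    have hmem : ∀ k : Fin d × Fin n, ω k.1 * y ^ (k.2 : ℕ) ∈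
        RR Fq (fun v : Place K => (0:ℤ) + ((n • P + E) v : ℕ)) := by
      rintro ⟨j, i⟩ v
      have hEj : poles Fq (ω j) v ≤ E v := by
        simp only [E, Finsupp.finsetSum_apply]
        exact Finset.single_le_sum (f := fun j => poles Fq (ω j) v) (fun _ _ => Nat.zero_le _) (Finset.mem_univ j)
      right
      have hy0 : y ≠ 0 := by rintro rfl; exact hy isAlgebraic_zero
      have hωj : ω j ≠ 0 := ω.ne_zero j
      rw [v.ord_mul _ _ hωj (pow_ne_zero _ hy0), v.ord_pow]
      simp only [Finsupp.add_apply, Finsupp.smul_apply, smul_eq_mul, hPdef, poles_apply] at hEj ⊢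
      have hi : (i : ℕ) ≤ n := i.2.le
      push_cast
      have h3 : (i:ℤ) * v.ord y ≥ - (n * ((-v.ord y).toNat : ℤ)) := by
        have a1 : -((-v.ord y).toNat : ℤ) ≤ v.ord y := by omega
        have a2 : (0:ℤ) ≤ ((-v.ord y).toNat : ℤ) := by omega
        have a3 : ((i:ℕ):ℤ) ≤ n := by exact_mod_cast hi
        have a4 : (0:ℤ) ≤ ((i:ℕ):ℤ) := by positivity
        nlinarith
      omega
    have hli := linInd_pow hy ω ω.linearIndependent n
    have hli' : LinearIndependent Fq (fun k : Fin d × Fin n => (⟨_, hmem k⟩ : RR Fq (fun v : Place K => (0:ℤ) + ((n • P + E) v : ℕ)))) :=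
      LinearIndependent.of_comp (Submodule.subtype _) hli
    have := hli'.fintype_card_le_finrank
    simpa using this
  by_contra hlt
  push Not at hlt
  have := key (l0 + degN Fq E + 1)
  nlinarith

theorem degN_cast [Finite Fq] [h : GF Fq K] (x : K) (Z : Finset (Place K)) (hZ : ∀ v, v.ord x < 0 → v ∈ Z) :
    (degN Fq (poles Fq x) : ℤ) = ∑ v ∈ Z, (max (-v.ord x) 0) * v.deg Fq := by
  unfold degN
  rw [Finsupp.sum_of_support_subset (s := Z) _ (by
    intro v hv; rw [Finsupp.mem_support_iff, poles_apply] at hv; apply hZ; omega) _ (by simp)]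
  push_cast
  refine Finset.sum_congr rfl fun v _ => ?_
  rw [poles_apply]; congr 1; exact Int.toNat_eq_max _

theorem poles_deg [Finite Fq] [h : GF Fq K] {y : K} (hy : Transcendental Fq y) :
    Module.finrank Fq⟮y⟯ K = degN Fq (poles Fq y) := by
  refine le_antisymm (finrank_le_poles hy) ?_
  have hy' : Transcendental Fq y⁻¹ := fun h => hy (by simpa using h.inv)
  have h1 := sum_ord_le hy' ((finite_zeros hy').toFinset) (by intro v hv; simpa using hv)
  have e : Fq⟮y⁻¹⟯ = Fq⟮y⟯ := by
    apply le_antisymm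
    · rw [IntermediateField.adjoin_simple_le_iff]; exact inv_mem (mem_adjoin_simple_self Fq y)
    · rw [IntermediateField.adjoin_simple_le_iff]
      have := inv_mem (mem_adjoin_simple_self Fq y⁻¹)
      simpa using this
  rw [e] at h1
  have h2 := degN_cast (Fq := Fq) y ((finite_zeros hy').toFinset) (by
    intro v hv; simp [v.ord_inv]; exact hv)
  have h3 : (degN Fq (poles Fq y) : ℤ) ≤ (Module.finrank Fq⟮y⟯ K : ℕ) := by
    rw [h2]; refine le_trans (le_of_eq ?_) h1
    refine Finset.sum_congr rfl fun v hv => ?_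
    have : 0 < v.ord y⁻¹ := by simpa using hv
    rw [v.ord_inv] at this ⊢
    rw [max_eq_left this.le]
  exact_mod_cast h3

variable (Fq) in
/-- Product formula. -/
theorem product_formula [Finite Fq] [h : GF Fq K] (x : K) (Z : Finset (Place K)) (hZ : ∀ v, v.ord x ≠ 0 → v ∈ Z) :
    ∑ v ∈ Z, v.ord x * v.deg Fq = 0 := by
  by_cases hx : Transcendental Fq x
  swap
  · refine Finset.sum_eq_zero fun v _ => ?_
    rw [ord_algebraic v (not_not.1 hx)]; simp
  have hx' : Transcendental Fq x⁻¹ := fun h => hx (by simpa using h.inv)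
  have e : Fq⟮x⁻¹⟯ = Fq⟮x⟯ := by
    apply le_antisymm
    · rw [IntermediateField.adjoin_simple_le_iff]; exact inv_mem (mem_adjoin_simple_self Fq x)
    · rw [IntermediateField.adjoin_simple_le_iff]
      have := inv_mem (mem_adjoin_simple_self Fq x⁻¹)
      simpa using this
  have h1 := poles_deg hx
  have h2 := poles_deg hx'
  rw [e, h1] at h2
  have h3 : (degN Fq (poles Fq x) : ℤ) = degN Fq (poles Fq x⁻¹) := by exact_mod_cast h2
  rw [degN_cast x Z (fun v hv => hZ v hv.ne), degN_cast x⁻¹ Z (fun v hv => hZ v (by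
    rw [v.ord_inv] at hv; omega)), ← sub_eq_zero, ← Finset.sum_sub_distrib] at h3
  rw [← neg_eq_zero, ← h3, ← Finset.sum_neg_distrib]
  refine Finset.sum_congr rfl fun v _ => ?_
  rw [v.ord_inv, ← sub_mul, ← neg_mul]; congr 1
  rcases le_total (v.ord x) 0 with h | h
  · rw [max_eq_left (by omega), max_eq_right (by omega)]; ring
  · rw [max_eq_right (by omega), max_eq_left (by omega)]; ring

end
end GFq

namespace GFq
open IntermediateField

section
variable {Fq K : Type*} [Field Fq] [Field K] [Algebra Fq K]

theorem RR_mono [Finite Fq] {D D' : Place K → ℤ} (h : ∀ v, D v ≤ D' v) : RR Fq D ≤ RR Fq D' :=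
  fun x hx v => (hx v).mono (by have := h v; omega)

theorem ge_pow_card [Finite Fq] [h : GF Fq K] (v : Place K) {t : K} (ht : v.ge t 0) (N : ℕ) (hN : v.deg Fq ∣ N) :
    v.ge (t ^ (Nat.card Fq ^ N) - t) 1 := by
  obtain ⟨k, rfl⟩ := hN
  have hfin := finite_κ (Fq := Fq) v
  have := Fintype.ofFinite v.κ
  rw [pow_mul, ← card_κ, ← v.res_eq (ht.pow _) ht, v.res_pow ht,
    Nat.card_eq_fintype_card]
  exact FiniteField.pow_card_pow k _

theorem pow_sub_ne [Finite Fq] {t : K} (ht : Transcendental Fq t) {N : ℕ} (hN : N ≠ 0) :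
    t ^ (Nat.card Fq ^ N) - t ≠ 0 := by
  intro h0
  have : 1 < Nat.card Fq ^ N := Nat.one_lt_pow hN (Finite.one_lt_card)
  refine ht ⟨Polynomial.X ^ (Nat.card Fq ^ N) - Polynomial.X, FiniteField.X_pow_card_sub_X_ne_zero _ this, ?_⟩
  simpa using h0

variable (K) in
theorem finite_deg_le [Finite Fq] [h : GF Fq K] (B : ℕ) : {v : Place K | v.deg Fq ≤ B}.Finite := by
  obtain ⟨t, ht⟩ := h.exists_transc
  refine ((finite_supp Fq t).union (finite_supp Fq (t ^ (Nat.card Fq ^ (Nat.factorial B)) - t))).subset ?_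
  intro v hv
  by_cases h0 : v.ord t = 0
  · right
    have := ge_pow_card (Fq := Fq) v (t := t) (Place.ge_of_ord h0.ge) (Nat.factorial B)
      (Nat.dvd_factorial (deg_pos v) hv)
    have := this.le (pow_sub_ne ht (Nat.factorial_ne_zero B))
    change _ ≠ _; omega
  · exact Or.inl h0

variable (Fq) in
theorem exists_place_notMem [h : GF Fq K] (Z : Finset (Place K)) : ∃ v : Place K, v ∉ Z := by
  classical
  by_contra hc
  push Not at hc
  have := h.fin
  obtain ⟨v0⟩ := exists_place Fq (K := K)
  obtain ⟨p, hp, hp1⟩ := v0.exists_unif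
  obtain ⟨z, hz⟩ := Place.approx Z (fun v => if v = v0 then p else 1) (fun v => if v = v0 then 2 else 1)
  have h0 := hz v0 (hc v0)
  rw [if_pos rfl, if_pos rfl] at h0
  have h1 := Place.ord_eq_of_sub hp (h0.mono (by omega))
  have hpf := product_formula Fq z Z (fun v _ => hc v)
  rw [Finset.sum_eq_single v0] at hpf
  · rw [h1.2, hp1] at hpf
    have := deg_pos (Fq := Fq) v0
    omega
  · intro w _ hw
    have := hz w (hc w)
    rw [if_neg hw, if_neg hw] at this
    rw [(Place.unit_of_sub_one le_rfl this).2]; simp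
  · intro hh; exact absurd (hc v0) hh

theorem exists_kill [Finite Fq] [h : GF Fq K] {t : K} (ht : Transcendental Fq t) (E : Place K →₀ ℕ) :
    ∃ g : K, g ∈ Fq⟮t⟯ ∧ g ≠ 0 ∧ ∀ v : Place K, v.ge t 0 → v.ge g (E v) := by
  classical
  induction E using Finsupp.induction_linear with
  | zero => exact ⟨1, one_mem _, one_ne_zero, fun v _ => by simpa using Place.ge_one⟩
  | add E F hE hF =>
    obtain ⟨g, h1, h2, h3⟩ := hE
    obtain ⟨g', h1', h2', h3'⟩ := hF
    exact ⟨g * g', mul_mem h1 h1', mul_ne_zero h2 h2', fun v hv => by simpa using (h3 v hv).mul (h3' v hv)⟩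
  | single w n =>
    refine ⟨(t ^ (Nat.card Fq ^ (w.deg Fq)) - t) ^ n, ?_, ?_, ?_⟩
    · exact pow_mem (sub_mem (pow_mem (mem_adjoin_simple_self Fq t) _) (mem_adjoin_simple_self Fq t)) _
    · exact pow_ne_zero _ (pow_sub_ne ht (deg_pos w).ne')
    · intro v hv
      by_cases hw : v = w
      · subst hw
        have h1 := ge_pow_card (Fq := Fq) v hv _ dvd_rfl
        right
        have h2 := h1.le (pow_sub_ne ht (deg_pos v).ne')
        rw [v.ord_pow]; simp only [Finsupp.single_eq_same]
        nlinarith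
      · rw [Finsupp.single_eq_of_ne hw]
        have h1 : v.ge (t ^ (Nat.card Fq ^ (w.deg Fq)) - t) 0 := Place.ge.sub (Place.ge.pow hv _) hv
        simpa using h1.pow n

/-- Riemann's inequality along multiples of the poles of `t`. -/
theorem riemann [Finite Fq] [h : GF Fq K] {t : K} (ht : Transcendental Fq t) :
    ∃ C : ℕ, ∀ n : ℕ, degN Fq (poles Fq t) * n ≤
      Module.finrank Fq (RR Fq (fun v : Place K => ((n : ℤ) + C) * poles Fq t v)) := by
  have := GF.finite_adjoin ht
  rw [← poles_deg ht]
  set d := Module.finrank Fq⟮t⟯ K with hd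
  let ω := Module.finBasis Fq⟮t⟯ K
  set P := poles Fq t with hPdef
  let E : Place K →₀ ℕ := ∑ j, poles Fq (ω j)
  obtain ⟨g, hg, hg0, hgE⟩ := exists_kill ht E
  have hEj : ∀ v j, poles Fq (ω j) v ≤ E v := by
    intro v j
    simp only [E, Finsupp.finsetSum_apply]
    exact Finset.single_le_sum (f := fun j => poles Fq (ω j) v) (fun _ _ => Nat.zero_le _) (Finset.mem_univ j)
  have hgne : (⟨g, hg⟩ : Fq⟮t⟯) ≠ 0 := fun hh => hg0 (congrArg Subtype.val hh)
  have hli : LinearIndependent Fq⟮t⟯ (fun j => g * ω j) := by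
    have h1 := ω.linearIndependent.units_smul (fun _ => Units.mk0 _ hgne)
    exact h1
  let C := (∑ v ∈ P.support, (- v.ord g).toNat) + ∑ v ∈ P.support, E v
  refine ⟨C, fun n => ?_⟩
  have hmem : ∀ k : Fin d × Fin n, (g * ω k.1) * t ^ (k.2 : ℕ) ∈
        RR Fq (fun v : Place K => ((n : ℤ) + C) * P v) := by
    rintro ⟨j, i⟩ v
    have ht0 : t ≠ 0 := by rintro rfl; exact ht isAlgebraic_zero
    have hωj : ω j ≠ 0 := ω.ne_zero j
    have hωE : - (E v : ℤ) ≤ v.ord (ω j) := by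
      have := hEj v j; rw [poles_apply] at this; omega
    by_cases hv : v.ge t 0
    · have h1 : v.ge (g * ω j) 0 := by
        have := (hgE v hv).mul (Place.ge_of_ord hωE)
        simpa using this
      have h2 := h1.mul0 (Place.ge.pow hv i)
      refine h2.mono ?_
      have : (0:ℤ) ≤ ((n : ℤ) + C) * P v := by positivity
      simpa using this
    · have hv' := (Place.not_ge.1 hv).2
      have hP : (P v : ℤ) = - v.ord t := by rw [hPdef, poles_apply]; omega
      have hvs : v ∈ P.support := by rw [Finsupp.mem_support_iff]; omega
      have hC1 : (- v.ord g).toNat ≤ ∑ v ∈ P.support, (- v.ord g).toNat :=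
        Finset.single_le_sum (f := fun v : Place K => (- v.ord g).toNat) (fun _ _ => Nat.zero_le _) hvs
      have hC2 : E v ≤ ∑ v ∈ P.support, E v :=
        Finset.single_le_sum (f := fun v : Place K => E v) (fun _ _ => Nat.zero_le _) hvs
      have hC : - (C : ℤ) ≤ v.ord g + v.ord (ω j) := by
        have : (- v.ord g).toNat + E v ≤ C := add_le_add hC1 hC2
        omega
      right
      rw [v.ord_mul _ _ (mul_ne_zero hg0 hωj) (pow_ne_zero _ ht0), v.ord_pow, v.ord_mul _ _ hg0 hωj]
      simp only [hP]
      have hi : ((i : ℕ) : ℤ) ≤ n := by exact_mod_cast i.2.le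
      have hi0 : (0:ℤ) ≤ ((i:ℕ):ℤ) := by positivity
      have hC0 : (0:ℤ) ≤ C := by positivity
      nlinarith
  have hli' : LinearIndependent Fq (fun k : Fin d × Fin n => (⟨_, hmem k⟩ : RR Fq (fun v : Place K => ((n : ℤ) + C) * P v))) :=
    LinearIndependent.of_comp (Submodule.subtype _) (linInd_pow ht _ hli n)
  have hfd : FiniteDimensional Fq (RR Fq (fun v : Place K => ((n : ℤ) + C) * P v)) := by
    have := (RR_add (Fq := Fq) ((n + C) • P) (fun _ : Place K => 0) RR_zero_finite).1
    have e0 : (fun v : Place K => (0:ℤ) + (((n + C) • P) v : ℕ)) = fun v : Place K => ((n : ℤ) + C) * P v := by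
      funext v; simp
    rwa [e0] at this
  have := hli'.fintype_card_le_finrank
  simpa using this

theorem exists_in_RR [Finite Fq] [h : GF Fq K] {t : K} (ht : Transcendental Fq t) :
    ∃ C : ℕ, ∀ (n : ℕ) (F : Place K →₀ ℕ), degN Fq F < degN Fq (poles Fq t) * n →
      ∃ x : K, x ≠ 0 ∧ ∀ v : Place K, (F v : ℤ) - ((n : ℤ) + C) * poles Fq t v ≤ v.ord x := by
  obtain ⟨C, hC⟩ := riemann ht
  refine ⟨C, fun n F hF => ?_⟩
  set P := poles Fq t with hPdef
  have hfd : FiniteDimensional Fq (RR Fq (fun v : Place K => ((n : ℤ) + C) * P v)) := by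
    have := (RR_add (Fq := Fq) ((n + C) • P) (fun _ : Place K => 0) RR_zero_finite).1
    have e0 : (fun v : Place K => (0:ℤ) + (((n + C) • P) v : ℕ)) = fun v : Place K => ((n : ℤ) + C) * P v := by
      funext v; simp
    rwa [e0] at this
  have hle : RR Fq (fun v : Place K => ((n : ℤ) + C) * P v - F v) ≤ RR Fq (fun v : Place K => ((n : ℤ) + C) * P v) :=
    RR_mono fun v => by omega
  have hfd' : FiniteDimensional Fq (RR Fq (fun v : Place K => ((n : ℤ) + C) * P v - F v)) :=
    Submodule.finiteDimensional_of_le hle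
  have h1 := (RR_add (Fq := Fq) F _ hfd').2
  have e : (fun v : Place K => ((n : ℤ) + C) * P v - F v + F v) = fun v : Place K => ((n : ℤ) + C) * P v := by
    funext v; ring
  rw [e] at h1
  have h2 := hC n
  have h3 : 0 < Module.finrank Fq (RR Fq (fun v : Place K => ((n : ℤ) + C) * P v - F v)) := by
    change _ ≤ _ + degN Fq F at h1
    omega
  obtain ⟨x, hx⟩ := Module.finrank_pos_iff_exists_ne_zero.1 h3
  refine ⟨x, fun hh => hx (Subtype.ext hh), fun v => ?_⟩
  have := (x.2 v).le (fun hh => hx (Subtype.ext hh))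
  dsimp only at this; linarith

theorem degN_eq [Finite Fq] (E : Place K →₀ ℕ) (Z : Finset (Place K)) (hZ : E.support ⊆ Z) :
    (degN Fq E : ℤ) = ∑ v ∈ Z, (E v : ℤ) * v.deg Fq := by
  unfold degN
  rw [Finsupp.sum_of_support_subset (s := Z) _ hZ _ (by simp)]
  push_cast; rfl

/-- The excess divisor of the element given by Riemann. -/
theorem exists_excess [Finite Fq] [h : GF Fq K] {t : K} (ht : Transcendental Fq t) :
    ∃ C : ℕ, ∀ (n : ℕ) (F : Place K →₀ ℕ), degN Fq F < degN Fq (poles Fq t) * n →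
      ∃ x : K, x ≠ 0 ∧ ∃ E : Place K →₀ ℕ, (∀ v : Place K, v.ord x = (F v : ℤ) - ((n : ℤ) + C) * poles Fq t v + E v)
        ∧ degN Fq E + degN Fq F = (n + C) * degN Fq (poles Fq t) := by
  classical
  obtain ⟨C, hC⟩ := exists_in_RR ht
  refine ⟨C, fun n F hF => ?_⟩
  obtain ⟨x, hx, hxo⟩ := hC n F hF
  set P := poles Fq t
  let Z : Finset (Place K) := (finite_supp Fq x).toFinset ∪ F.support ∪ P.support
  let E : Place K →₀ ℕ := Finsupp.onFinset Z (fun v => (v.ord x - ((F v : ℤ) - ((n : ℤ) + C) * P v)).toNat) (by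
    intro v hv
    by_contra hvZ
    apply hv
    simp only [Z, Finset.mem_union, not_or, Set.Finite.mem_toFinset, Set.mem_ofPred_eq, not_not,
      Finsupp.notMem_support_iff] at hvZ
    rw [hvZ.1.1, hvZ.1.2, hvZ.2]; simp)
  have hE : ∀ v, v.ord x = (F v : ℤ) - ((n : ℤ) + C) * P v + E v := by
    intro v
    have := hxo v
    have e : E v = (v.ord x - ((F v : ℤ) - ((n : ℤ) + C) * P v)).toNat := rfl
    omega
  refine ⟨x, hx, E, hE, ?_⟩
  have hpf := product_formula Fq x Z (fun v hv => by
    simp only [Z, Finset.mem_union, Set.Finite.mem_toFinset, Set.mem_ofPred_eq]; exact Or.inl (Or.inl hv))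
  have h1 := degN_eq (Fq := Fq) E Z Finsupp.support_onFinset_subset
  have h2 := degN_eq (Fq := Fq) F Z (fun v hv => by
    simp only [Z, Finset.mem_union]; exact Or.inl (Or.inr hv))
  have h3 := degN_eq (Fq := Fq) P Z (fun v hv => by
    simp only [Z, Finset.mem_union]; exact Or.inr hv)
  have h4 : ((degN Fq E + degN Fq F : ℕ) : ℤ) = ((n + C) * degN Fq P : ℕ) := by
    push_cast
    rw [h1, h2, h3, ← sub_eq_zero, ← hpf, Finset.mul_sum, ← Finset.sum_add_distrib, ← Finset.sum_sub_distrib]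
    refine Finset.sum_congr rfl fun v _ => ?_
    rw [hE v]; ring
  exact_mod_cast h4

theorem degN_pos [Finite Fq] [h : GF Fq K] {t : K} (ht : Transcendental Fq t) : 0 < degN Fq (poles Fq t) := by
  have := GF.finite_adjoin ht
  rw [← poles_deg ht]; exact Module.finrank_pos

theorem le_degN [Finite Fq] [h : GF Fq K] (E : Place K →₀ ℕ) (v : Place K) : E v * v.deg Fq ≤ degN Fq E := by
  by_cases hv : v ∈ E.support
  · exact Finset.single_le_sum (f := fun v : Place K => E v * v.deg Fq) (fun _ _ => Nat.zero_le _) hv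
  · rw [Finsupp.notMem_support_iff] at hv; simp [hv]

theorem exists_unit [Finite Fq] [h : GF Fq K] {t : K} (ht : Transcendental Fq t) (v : Place K) [DecidableEq (Place K)] :
    ∃ u : K, u ≠ 0 ∧ ∃ j n : ℕ, 0 < j ∧ 0 < n ∧
      ∀ w : Place K, w.ord u = (if w = v then (j : ℤ) else 0) - n * poles Fq t w := by
  obtain ⟨C, hC⟩ := exists_excess ht
  set P := poles Fq t
  set d := degN Fq P with hd
  have hd0 : 0 < d := degN_pos ht
  have hx : ∀ k : ℕ, ∃ x : K, x ≠ 0 ∧ ∃ E : Place K →₀ ℕ,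
      (∀ w : Place K, w.ord x = ((Finsupp.single v (d * k) w : ℕ) : ℤ) - (((k * v.deg Fq + 1 : ℕ) : ℤ) + C) * P w + E w)
        ∧ degN Fq E = (1 + C) * d := by
    intro k
    have hF : degN Fq (Finsupp.single v (d * k)) = d * k * v.deg Fq := by
      unfold degN; rw [Finsupp.sum_single_index (by simp)]
    obtain ⟨x, hx, E, hE, hdeg⟩ := hC (k * v.deg Fq + 1) (Finsupp.single v (d * k)) (by
      rw [hF]; nlinarith)
    refine ⟨x, hx, E, hE, ?_⟩
    rw [hF] at hdeg
    nlinarith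
  choose x hx0 E hE hdeg using hx
  let B := (1 + C) * d
  have hfin := finite_deg_le (Fq := Fq) K B
  have : Finite {v : Place K | v.deg Fq ≤ B} := hfin
  have hle : ∀ k w, E k w ≤ B := fun k w => by
    have h1 := le_degN (Fq := Fq) (E k) w
    have h2 := deg_pos (Fq := Fq) w
    rw [hdeg k] at h1
    exact le_trans (Nat.le_mul_of_pos_right _ h2) h1
  have hz : ∀ k w, ¬ w.deg Fq ≤ B → E k w = 0 := fun k w hw => by
    have h1 := le_degN (Fq := Fq) (E k) w
    rw [hdeg k] at h1
    by_contra h0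
    exact hw (le_trans (Nat.le_mul_of_pos_left _ (Nat.pos_of_ne_zero h0)) h1)
  obtain ⟨k, k', hkk, heq⟩ := Finite.exists_ne_map_eq_of_infinite
    (fun k : ℕ => fun w : {v : Place K | v.deg Fq ≤ B} => (⟨E k w, Nat.lt_succ_of_le (hle k w)⟩ : Fin (B + 1)))
  have hEE : ∀ w, E k w = E k' w := by
    intro w
    by_cases hw : w.deg Fq ≤ B
    · have := congrFun heq ⟨w, hw⟩
      exact congrArg Fin.val this
    · rw [hz k w hw, hz k' w hw]
  have main : ∀ k k' : ℕ, k' < k → (∀ w, E k w = E k' w) → ∃ u : K, u ≠ 0 ∧ ∃ j n : ℕ, 0 < j ∧ 0 < n ∧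
      ∀ w : Place K, w.ord u = (if w = v then (j : ℤ) else 0) - n * P w := by
    intro k k' hlt hEE
    refine ⟨x k / x k', div_ne_zero (hx0 k) (hx0 k'), d * (k - k'), (k - k') * v.deg Fq, ?_, ?_, ?_⟩
    · exact Nat.mul_pos hd0 (by omega)
    · exact Nat.mul_pos (by omega) (deg_pos v)
    · intro w
      rw [w.ord_div (hx0 k) (hx0 k'), hE k w, hE k' w, hEE w]
      have : ((k - k' : ℕ) : ℤ) = k - k' := by omega
      rw [Finsupp.single_apply, Finsupp.single_apply]
      push_cast
      rw [this]
      by_cases hw : w = v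
      · subst hw; simp; ring
      · simp [hw, Ne.symm hw]; ring
  rcases lt_or_gt_of_ne hkk with hlt | hlt
  · exact main k' k hlt fun w => (hEE w).symm
  · exact main k k' hlt hEE

variable (Fq K) in
/-- Outside a finite set every place is principal. -/
theorem exists_pid [h : GF Fq K] : ∃ S0 : Finset (Place K), ∀ v ∉ S0, ∃ x : K, x ≠ 0 ∧ v.ord x = 1 ∧
    ∀ w ∉ S0, w ≠ v → w.ord x = 0 := by
  classical
  have hfinq := h.fin
  obtain ⟨t, ht⟩ := h.exists_transc
  obtain ⟨C, hC⟩ := exists_excess ht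
  set P := poles Fq t
  set d := degN Fq P with hd
  have hd0 : 0 < d := degN_pos ht
  refine ⟨(finite_deg_le (Fq := Fq) K ((C + 1) * d)).toFinset ∪ P.support, fun v hv => ?_⟩
  have hF : degN Fq (Finsupp.single v 1) = v.deg Fq := by
    unfold degN; rw [Finsupp.sum_single_index (by simp)]; simp
  have hdm := Nat.div_add_mod (v.deg Fq) d
  have hml := Nat.mod_lt (v.deg Fq) hd0
  obtain ⟨x, hx, E, hE, hdeg⟩ := hC (v.deg Fq / d + 1) (Finsupp.single v 1) (by
    rw [hF, mul_add]; omega)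
  have hz : ∀ w, w ∉ (finite_deg_le (Fq := Fq) K ((C + 1) * d)).toFinset ∪ P.support → E w = 0 ∧ P w = 0 := by
    intro w hw
    simp only [Finset.mem_union, not_or, Set.Finite.mem_toFinset, Set.mem_ofPred_eq, not_le,
      Finsupp.notMem_support_iff] at hw
    refine ⟨?_, hw.2⟩
    by_contra h0
    have h1 := le_degN (Fq := Fq) E w
    have h2 := Nat.le_mul_of_pos_left (w.deg Fq) (Nat.pos_of_ne_zero h0)
    rw [hF] at hdeg
    have hc1 : d * (v.deg Fq / d) + d + C * d = (v.deg Fq / d + 1 + C) * d := by ring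
    have hc2 : (C + 1) * d = C * d + d := by ring
    omega
  refine ⟨x, hx, ?_, ?_⟩
  · rw [hE v, (hz v hv).1, (hz v hv).2]; simp
  · intro w hw hwv
    rw [hE w, (hz w hw).1, (hz w hw).2]; simp [Ne.symm hwv]

end
end GFq

namespace GFq
open IntermediateField

theorem card_quot_fin {N : Type*} [AddCommGroup N] [Finite N] :
    Nat.card (N ⧸ (nsmulAddMonoidHom (α := N) 2).range) = Nat.card (nsmulAddMonoidHom (α := N) 2).ker := by
  have h1 := AddSubgroup.card_eq_card_quotient_mul_card_addSubgroup (nsmulAddMonoidHom (α := N) 2).range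
  have h2 := AddSubgroup.card_eq_card_quotient_mul_card_addSubgroup (nsmulAddMonoidHom (α := N) 2).ker
  have h3 := Nat.card_congr (QuotientAddGroup.quotientKerEquivRange (nsmulAddMonoidHom (α := N) 2)).toEquiv
  rw [h3, h1, mul_comm] at h2
  exact Nat.eq_of_mul_eq_mul_left Nat.card_pos h2

theorem card_quot_two {G Λ : Type*} [AddCommGroup G] [AddCommGroup Λ] [Module.Free ℤ Λ] [Module.Finite ℤ Λ]
    (f : G →+ Λ) (hf : Function.Surjective f) [Finite f.ker] :
    Nat.card (G ⧸ (nsmulAddMonoidHom (α := G) 2).range) =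
      2 ^ Module.finrank ℤ Λ * Nat.card (nsmulAddMonoidHom (α := f.ker) 2).ker := by
  classical
  let b := Module.finBasis ℤ Λ
  choose g hg using fun i => hf (b i)
  let sec : Λ →ₗ[ℤ] G := b.constr ℤ g
  have hsec : ∀ l, f (sec l) = l := by
    intro l
    have : (f.toIntLinearMap ∘ₗ sec) = LinearMap.id := by
      apply b.ext; intro i
      simp [sec, hg]
    exact LinearMap.congr_fun this l
  let p : G →+ f.ker :=
    { toFun := fun x => ⟨x - sec (f x), by rw [AddMonoidHom.mem_ker, map_sub, hsec, sub_self]⟩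
      map_zero' := by ext; simp
      map_add' := fun x y => by ext; simp; abel }
  let Θ : G →+ (Fin (Module.finrank ℤ Λ) → ZMod 2) × (f.ker ⧸ (nsmulAddMonoidHom (α := f.ker) 2).range) :=
    { toFun := fun x => (fun i => ((b.repr (f x) i : ℤ) : ZMod 2), QuotientAddGroup.mk (p x))
      map_zero' := by
        ext
        · simp
        · simp
      map_add' := fun x y => by
        ext
        · simp
        · simp }
  have hΘ : Function.Surjective Θ := by
    rintro ⟨c, n⟩
    obtain ⟨n, rfl⟩ := QuotientAddGroup.mk_surjective n
    choose c' hc' using fun i => ZMod.intCast_surjective (c i)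
    let l : Λ := ∑ i, c' i • b i
    have hf' : f (sec l + n) = l := by rw [map_add, hsec, n.2, add_zero]
    refine ⟨sec l + n, ?_⟩
    ext1
    · funext i
      change ((b.repr (f (sec l + n)) i : ℤ) : ZMod 2) = c i
      rw [hf', ← hc' i]
      simp only [l]
      rw [b.repr_sum_self]
    · change QuotientAddGroup.mk (p (sec l + n)) = _
      congr 1
      apply Subtype.ext
      change sec l + n - sec (f (sec l + n)) = n
      rw [hf']; abel
  have hker : Θ.ker = (nsmulAddMonoidHom (α := G) 2).range := by
    ext x
    constructor
    · intro hx
      have hx' : Θ x = 0 := hx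
      have h1 : ∀ i, ((b.repr (f x) i : ℤ) : ZMod 2) = 0 := fun i => congrFun (congrArg Prod.fst hx') i
      have h2 : QuotientAddGroup.mk (p x) = (0 : f.ker ⧸ (nsmulAddMonoidHom (α := f.ker) 2).range) := congrArg Prod.snd hx'
      rw [QuotientAddGroup.eq_zero_iff] at h2
      obtain ⟨n, hn⟩ := h2
      have h3 : ∀ i, ∃ m : ℤ, b.repr (f x) i = 2 * m := fun i => by
        have := (ZMod.intCast_zmod_eq_zero_iff_dvd _ 2).1 (h1 i)
        exact_mod_cast this
      choose m hm using h3
      refine ⟨sec (∑ i, m i • b i) + n, ?_⟩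
      have e1 : f x = (2 : ℤ) • ∑ i, m i • b i := by
        conv_lhs => rw [← b.sum_repr (f x)]
        rw [Finset.smul_sum]
        exact Finset.sum_congr rfl fun i _ => by rw [hm i, mul_smul]
      have e2 : x - sec (f x) = 2 • (n : G) := by
        have := congrArg Subtype.val hn
        exact this.symm
      rw [e1, map_smul] at e2
      change 2 • (sec (∑ i, m i • b i) + (n : G)) = x
      rw [smul_add, ← e2, two_zsmul, two_nsmul]; abel
    · rintro ⟨y, rfl⟩
      change Θ (2 • y) = 0
      rw [map_nsmul]
      ext1
      · funext i
        change 2 • (Θ y).1 i = 0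
        rw [nsmul_eq_mul]
        have : ((2 : ℕ) : ZMod 2) = 0 := rfl
        rw [this, zero_mul]
      · change 2 • (QuotientAddGroup.mk (p y) : f.ker ⧸ (nsmulAddMonoidHom (α := f.ker) 2).range) = 0
        rw [← QuotientAddGroup.mk_nsmul, QuotientAddGroup.eq_zero_iff]
        exact ⟨p y, rfl⟩
  rw [← hker, Nat.card_congr (QuotientAddGroup.quotientKerEquivOfSurjective Θ hΘ).toEquiv, Nat.card_prod,
    card_quot_fin]
  simp

section
variable {K : Type*} [Field K]

/-- S-units, written additively. -/
def Usub (S : Finset (Place K)) : AddSubgroup (Additive Kˣ) where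
  carrier := {x | ∀ v : Place K, v ∉ S → v.ord (x.toMul : K) = 0}
  zero_mem' := fun v _ => v.ord_one
  add_mem' := fun {x y} hx hy v hv => by
    change v.ord ((x.toMul : K) * (y.toMul : K)) = 0
    rw [v.ord_mul _ _ (Units.ne_zero _) (Units.ne_zero _), hx v hv, hy v hv, add_zero]
  neg_mem' := fun {x} hx v hv => by
    change v.ord (((x.toMul)⁻¹ : Kˣ) : K) = 0
    rw [Units.val_inv_eq_inv_val, v.ord_inv, hx v hv, neg_zero]

/-- S-units as a type -/
def U (S : Finset (Place K)) : Type _ := Usub S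

instance (S : Finset (Place K)) : AddCommGroup (U S) := inferInstanceAs (AddCommGroup (Usub S))

namespace U
variable {S : Finset (Place K)}

/-- underlying field element -/
def val (x : U S) : K := ((Additive.toMul (Subtype.val (p := fun y : Additive Kˣ => y ∈ Usub S) x) : Kˣ) : K)

theorem val_ne (x : U S) : x.val ≠ 0 := Units.ne_zero _
theorem val_ord (x : U S) {v : Place K} (hv : v ∉ S) : v.ord x.val = 0 := Subtype.property (p := fun y => y ∈ Usub S) x v hv
theorem val_add (x y : U S) : (x + y).val = x.val * y.val := rfl
theorem val_zero : (0 : U S).val = 1 := rfl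
theorem val_neg (x : U S) : (-x).val = x.val⁻¹ := Units.val_inv_eq_inv_val _
theorem val_two (x : U S) : (2 • x).val = x.val ^ 2 := by rw [two_nsmul, val_add, sq]
theorem ext {x y : U S} (h : x.val = y.val) : x = y := Subtype.ext (Units.ext h)
theorem val_sub (x y : U S) : (x - y).val = x.val / y.val := by
  rw [sub_eq_add_neg, val_add, val_neg, div_eq_mul_inv]

/-- constructor -/
def mk (x : K) (hx : x ≠ 0) (h : ∀ v : Place K, v ∉ S → v.ord x = 0) : U S :=
  (⟨Additive.ofMul (Units.mk0 x hx), h⟩ : Usub S)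
theorem val_mk {x : K} (hx : x ≠ 0) (h : ∀ v : Place K, v ∉ S → v.ord x = 0) : (mk x hx h).val = x := rfl

/-- doubles of `U S` -/
def dbl (S : Finset (Place K)) : AddSubgroup (U S) := (nsmulAddMonoidHom (α := U S) 2).range

theorem mem_dbl {x : U S} : x ∈ dbl S ↔ IsSquare x.val := by
  constructor
  · rintro ⟨y, rfl⟩
    exact ⟨y.val, val_add y y ▸ by change (2 • y).val = _; rw [two_nsmul]⟩
  · rintro ⟨z, hz⟩
    have hz0 : z ≠ 0 := by rintro rfl; exact x.val_ne (by simpa using hz)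
    refine ⟨mk z hz0 fun v hv => ?_, ext ?_⟩
    · have := x.val_ord hv
      rw [hz, v.ord_mul _ _ hz0 hz0] at this; omega
    · change (2 • mk z hz0 _).val = _
      rw [val_two, val_mk, hz, sq]

/-- vector of orders -/
def ordv (S : Finset (Place K)) : U S →+ (S → ℤ) where
  toFun x := fun v => v.1.ord x.val
  map_zero' := by funext v; exact v.1.ord_one
  map_add' x y := by funext v; exact v.1.ord_mul _ _ x.val_ne y.val_ne

end U

variable (Fq : Type*) [Field Fq] [Algebra Fq K]

theorem finrank_ordv [h : GF Fq K] {t : K} (ht : Transcendental Fq t) {S : Finset (Place K)}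
    (hS : ∀ v, v.ord t < 0 → v ∈ S) :
    Module.finrank ℤ (LinearMap.range (U.ordv S).toIntLinearMap) + 1 = S.card := by
  classical
  have hfin := h.fin
  let Λ := LinearMap.range (U.ordv S).toIntLinearMap
  let D : S → ℤ := fun v => poles Fq t v
  let deg : (S → ℤ) →ₗ[ℤ] ℤ := ∑ v : S, (v.1.deg Fq : ℤ) • LinearMap.proj v
  have hdeg : ∀ x : S → ℤ, deg x = ∑ v : S, (v.1.deg Fq : ℤ) * x v := by intro x; simp [deg]
  have hΛ0 : ∀ l ∈ Λ, deg l = 0 := by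
    rintro _ ⟨x, rfl⟩
    rw [hdeg, ← product_formula Fq x.val S (fun v hv => by by_contra hc; exact hv (x.val_ord hc))]
    rw [← Finset.sum_coe_sort S]
    exact Finset.sum_congr rfl fun v _ => mul_comm _ _
  have hD : deg D ≠ 0 := by
    rw [hdeg]
    have h1 := degN_eq (Fq := Fq) (poles Fq t) S (fun v hv => by
      rw [Finsupp.mem_support_iff, poles_apply] at hv; exact hS v (by omega))
    have h2 : ∑ v : S, (v.1.deg Fq : ℤ) * D v = (degN Fq (poles Fq t) : ℤ) := by
      rw [h1, ← Finset.sum_coe_sort S]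
      exact Finset.sum_congr rfl fun v _ => mul_comm _ _
    rw [h2]
    have := degN_pos (Fq := Fq) ht
    omega
  -- upper bound
  let F : Λ × ℤ →ₗ[ℤ] (S → ℤ) := LinearMap.coprod Λ.subtype (LinearMap.toSpanSingleton ℤ _ D)
  have hF : Function.Injective F := by
    rw [← LinearMap.ker_eq_bot, LinearMap.ker_eq_bot']
    rintro ⟨l, m⟩ h0
    have h1 : (l : S → ℤ) + m • D = 0 := by simpa [F] using h0
    have h2 := congrArg deg h1
    rw [map_add, map_smul, hΛ0 l l.2, map_zero, zero_add, smul_eq_mul] at h2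
    have hm : m = 0 := (mul_eq_zero.1 h2).resolve_right hD
    subst hm
    rw [zero_smul, add_zero] at h1
    ext1
    · exact Subtype.ext h1
    · rfl
  have hle := LinearMap.finrank_le_finrank_of_injective hF
  -- lower bound
  have hu : ∀ v : S, ∃ l ∈ Λ, ∃ j n : ℤ, 0 < j ∧ l = Pi.single v j - n • D := by
    intro v
    obtain ⟨u, hu0, j, n, hj, hn, hu⟩ := exists_unit ht v.1
    refine ⟨_, ⟨U.mk u hu0 fun w hw => ?_, rfl⟩, j, n, by exact_mod_cast hj, ?_⟩
    · rw [hu w, if_neg (fun hh : w = v.1 => hw (hh ▸ v.2)), poles_apply]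
      have : ¬ w.ord t < 0 := fun hh => hw (hS w hh)
      have : (-w.ord t).toNat = 0 := by omega
      rw [this]; simp
    · funext w
      change w.1.ord u = _
      rw [hu w]
      simp only [Pi.sub_apply, Pi.smul_apply, smul_eq_mul, Pi.single_apply, D, Subtype.ext_iff]
  choose l hl j n hj hljn using hu
  let H : (S → ℤ) →ₗ[ℤ] Λ × ℤ := (Pi.basisFun ℤ S).constr ℤ fun v => (⟨l v, hl v⟩, n v)
  have hH : Function.Injective H := by
    have hFH : ∀ x, F (H x) = fun v => x v * j v := by
      have : F ∘ₗ H = LinearMap.pi fun v => j v • LinearMap.proj v := by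
        apply (Pi.basisFun ℤ S).ext
        intro v
        rw [LinearMap.comp_apply, Module.Basis.constr_basis]
        have : F (⟨l v, hl v⟩, n v) = l v + n v • D := by simp [F]
        rw [this, hljn v]
        funext w
        by_cases hw : w = v
        · subst hw; simp
        · simp [Pi.single_apply, hw]
      intro x
      have h1 := LinearMap.congr_fun this x
      rw [LinearMap.comp_apply] at h1
      rw [h1]; funext v; simp [mul_comm]
    rw [← LinearMap.ker_eq_bot, LinearMap.ker_eq_bot']
    intro x hx
    have h1 := hFH x
    rw [hx, map_zero] at h1
    funext v
    have h2 := congrFun h1 v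
    exact (mul_eq_zero.1 h2.symm).resolve_right (hj v).ne'
  have hge := LinearMap.finrank_le_finrank_of_injective hH
  have e1 : Module.finrank ℤ (Λ × ℤ) = Module.finrank ℤ Λ + 1 := by
    rw [Module.finrank_prod, Module.finrank_self]
  have e2 : Module.finrank ℤ (S → ℤ) = S.card := by
    rw [Module.finrank_fintype_fun_eq_card, Fintype.card_coe]
  rw [e1, e2] at hle hge
  exact le_antisymm hle hge

/-- number of square classes of `S`-units -/
theorem card_U [h : GF Fq K] (h2 : (2 : Fq) ≠ 0) {t : K} (ht : Transcendental Fq t) {S : Finset (Place K)}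
    (hS : ∀ v, v.ord t < 0 → v ∈ S) :
    Nat.card (U S ⧸ U.dbl S) = 2 ^ S.card := by
  have hfin := h.fin
  let f : U S →+ LinearMap.range (U.ordv S).toIntLinearMap := (U.ordv S).toIntLinearMap.rangeRestrict.toAddMonoidHom
  have hf : Function.Surjective f := (U.ordv S).toIntLinearMap.surjective_rangeRestrict
  have hmemk : ∀ x : U S, x ∈ f.ker ↔ ∀ v : Place K, v.ord x.val = 0 := by
    intro x
    constructor
    · intro hx v
      by_cases hv : v ∈ S
      · have : U.ordv S x = 0 := congrArg Subtype.val hx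
        exact congrFun this ⟨v, hv⟩
      · exact x.val_ord hv
    · intro hx
      exact Subtype.ext (by funext v; exact hx v)
  have hfk : Finite f.ker := by
    have : Finite (RR Fq (fun _ : Place K => 0)) := Module.finite_of_finite Fq
    refine Finite.of_injective (β := RR Fq (fun _ : Place K => 0))
      (fun x => ⟨x.1.val, fun v => Place.ge_of_ord (by rw [(hmemk x.1).1 x.2 v]; simp)⟩) ?_
    intro x y hxy
    exact Subtype.ext (U.ext (congrArg Subtype.val hxy))
  have h2K : (2 : K) ≠ 0 := by
    rw [← map_ofNat (algebraMap Fq K) 2]; exact (map_ne_zero _).2 h2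
  have hk2 : Nat.card (nsmulAddMonoidHom (α := f.ker) 2).ker = 2 := by
    have hone : ∀ v : Place K, v.ord (1 : K) = 0 := fun v => v.ord_one
    have hneg : ∀ v : Place K, v.ord (-1 : K) = 0 := fun v => v.ord_neg_one
    let m : U S := U.mk (-1) (by simp) fun v _ => hneg v
    have hm : m ∈ f.ker := (hmemk m).2 hneg
    have hm2 : 2 • (⟨m, hm⟩ : f.ker) = 0 := by
      apply Subtype.ext; apply U.ext
      change (2 • m).val = 1
      rw [U.val_two, U.val_mk]; ring
    rw [Nat.card_eq_two_iff]
    refine ⟨0, ⟨⟨m, hm⟩, hm2⟩, ?_, ?_⟩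
    · intro h0
      have h1 : (1 : K) = -1 := congrArg (fun z : (nsmulAddMonoidHom (α := f.ker) 2).ker => (z : U S).val) h0
      apply h2K
      linear_combination h1
    · ext x
      simp only [Set.mem_insert_iff, Set.mem_singleton_iff, Set.mem_univ, iff_true]
      have hx : 2 • (x : f.ker) = 0 := x.2
      have hx' : ((x : f.ker) : U S).val ^ 2 = 1 := by
        rw [← U.val_two]
        exact congrArg (fun z : f.ker => (z : U S).val) hx
      rcases sq_eq_one_iff.1 hx' with h1 | h1
      · left; exact Subtype.ext (Subtype.ext (U.ext h1))
      · right; exact Subtype.ext (Subtype.ext (U.ext h1))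
  have := card_quot_two f hf
  rw [hk2] at this
  change Nat.card (U S ⧸ (nsmulAddMonoidHom (α := U S) 2).range) = _
  rw [this, ← pow_succ, finrank_ordv Fq ht hS]

end
end GFq

namespace GFq
open IntermediateField

universe u

section
variable {K L : Type*} [Field K] [Field L] [Algebra K L]

/-- `w` lies over `v` -/
def Place.Over (w : Place L) (v : Place K) : Prop :=
  ∃ e : ℤ, 0 < e ∧ ∀ x : K, w.ord (algebraMap K L x) = e * v.ord x

namespace Place.Over
variable {w : Place L} {v : Place K}

theorem ge_one_iff (h : w.Over v) {x : K} : w.ge (algebraMap K L x) 1 ↔ v.ge x 1 := by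
  obtain ⟨e, he, h⟩ := h
  unfold Place.ge
  rw [h, map_eq_zero]
  refine or_congr Iff.rfl ⟨fun h => ?_, fun h => ?_⟩ <;> nlinarith

theorem ge_zero_iff (h : w.Over v) {x : K} : w.ge (algebraMap K L x) 0 ↔ v.ge x 0 := by
  obtain ⟨e, he, h⟩ := h
  unfold Place.ge
  rw [h, map_eq_zero]
  refine or_congr Iff.rfl ⟨fun h => ?_, fun h => ?_⟩ <;> nlinarith

theorem ord_zero_iff (h : w.Over v) {x : K} : w.ord (algebraMap K L x) = 0 ↔ v.ord x = 0 := by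
  obtain ⟨e, he, h⟩ := h
  rw [h]; simp [he.ne']

theorem ord_neg_iff (h : w.Over v) {x : K} : w.ord (algebraMap K L x) < 0 ↔ v.ord x < 0 := by
  obtain ⟨e, he, h⟩ := h
  rw [h]; constructor <;> intro h <;> nlinarith

theorem unique (h : w.Over v) {v' : Place K} (h' : w.Over v') : v = v' :=
  Place.eq_of_le fun _ hx => h'.ge_zero_iff.1 (h.ge_zero_iff.2 hx)

theorem lsq (h : w.Over v) {x : K} (hx : v.lsq x) : w.lsq (algebraMap K L x) := by
  obtain ⟨y, hy, hxy⟩ := hx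
  refine ⟨algebraMap K L y, by simpa using hy, ?_⟩
  have := h.ge_one_iff.2 hxy
  simpa using this

theorem h_zero (h : w.Over v) (hv : v.Good) (hw : w.Good) {a b : K} (ha : a ≠ 0) (hb : b ≠ 0)
    (h0 : v.h a b = 0) : w.h (algebraMap K L a) (algebraMap K L b) = 0 := by
  obtain ⟨x, y, hxy⟩ := Place.exists_norm_approx hv ha hb h0 1
  have hl := h.lsq (Place.lsq_of_sub_one le_rfl hxy)
  have hn := Place.lsq_ne_zero hl
  have ha' : algebraMap K L a ≠ 0 := by simpa using ha
  have hb' : algebraMap K L b ≠ 0 := by simpa using hb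
  rw [map_mul, map_sub, map_pow, map_mul, map_pow] at hl hn
  have hn2 := right_ne_zero_of_mul hn
  have := Place.h_lsq_right (a := algebraMap K L a) hl
  rwa [Place.h_mul_right hw hb' hn2, Place.h_norm hw ha' hn2, add_zero] at this

end Place.Over

/-- quadratic extension data -/
structure Quad (K L : Type*) [Field K] [Field L] [Algebra K L] (a : K) where
  θ : L
  sq : θ ^ 2 = algebraMap K L a
  σ : L →+* L
  σθ : σ θ = -θ
  σK : ∀ x, σ (algebraMap K L x) = algebraMap K L x
  span : ∀ z, ∃ x y : K, z = algebraMap K L x + algebraMap K L y * θ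
  nsq : ¬ IsSquare a

namespace Quad
variable {a : K} (Q : Quad K L a)

theorem a_ne (Q : Quad K L a) : a ≠ 0 := by rintro rfl; exact Q.nsq ⟨0, by simp⟩
theorem θ_ne : Q.θ ≠ 0 := fun h => Q.a_ne (by
  have := Q.sq; rw [h] at this; simpa using this.symm)
theorem σσ (z : L) : Q.σ (Q.σ z) = z := by
  obtain ⟨x, y, rfl⟩ := Q.span z
  simp [Q.σK, Q.σθ]
theorem exists_norm (z : L) : ∃ n : K, algebraMap K L n = z * Q.σ z ∧ ∃ x y : K, n = x ^ 2 - a * y ^ 2 := by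
  obtain ⟨x, y, rfl⟩ := Q.span z
  refine ⟨x ^ 2 - a * y ^ 2, ?_, x, y, rfl⟩
  simp only [map_add, map_mul, Q.σK, Q.σθ, map_sub, map_pow, ← Q.sq]; ring
/-- norm -/
noncomputable def N (z : L) : K := (Q.exists_norm z).choose
theorem N_spec (z : L) : algebraMap K L (Q.N z) = z * Q.σ z := (Q.exists_norm z).choose_spec.1
theorem N_form (z : L) : ∃ x y : K, Q.N z = x ^ 2 - a * y ^ 2 := (Q.exists_norm z).choose_spec.2
theorem σ_ne {z : L} (hz : z ≠ 0) : Q.σ z ≠ 0 := by simpa using hz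
theorem N_ne {z : L} (hz : z ≠ 0) : Q.N z ≠ 0 := fun h => by
  have := Q.N_spec z
  rw [h, map_zero] at this
  exact mul_ne_zero hz (Q.σ_ne hz) this.symm
theorem N_mul (y z : L) : Q.N (y * z) = Q.N y * Q.N z := by
  apply (algebraMap K L).injective
  rw [map_mul, N_spec, N_spec, N_spec, map_mul]; ring
theorem exists_trace (z : L) : ∃ x : K, algebraMap K L x = z + Q.σ z := by
  obtain ⟨x, y, rfl⟩ := Q.span z
  exact ⟨2 * x, by simp only [map_add, map_mul, Q.σK, Q.σθ, map_ofNat]; ring⟩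

theorem fd (Q : Quad K L a) : FiniteDimensional K L := by
  classical
  refine ⟨⟨{1, Q.θ}, ?_⟩⟩
  rw [eq_top_iff]
  rintro z -
  obtain ⟨x, y, rfl⟩ := Q.span z
  refine Submodule.add_mem _ ?_ ?_
  · rw [Algebra.algebraMap_eq_smul_one]
    exact Submodule.smul_mem _ _ (Submodule.subset_span (by simp))
  · rw [← Algebra.smul_def]
    exact Submodule.smul_mem _ _ (Submodule.subset_span (by simp))

/-- `x ∈ K` is a square in `L` -/
theorem sq_of_sq (Q : Quad K L a) {x : K} (h : IsSquare (algebraMap K L x)) (h2 : (2 : K) ≠ 0) : IsSquare x ∨ IsSquare (a * x) := by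
  obtain ⟨z, hz⟩ := h
  obtain ⟨p, q, rfl⟩ := Q.span z
  have hθ : ∀ c : K, algebraMap K L c ≠ Q.θ := fun c hc => Q.nsq ⟨c, (algebraMap K L).injective (by
    rw [← Q.sq, ← hc, map_mul]; ring)⟩
  have hpq : p * q = 0 := by
    by_contra hne
    apply hθ ((x - p ^ 2 - a * q ^ 2) / (2 * (p * q)))
    rw [map_div₀, div_eq_iff ((map_ne_zero _).2 (mul_ne_zero h2 hne))]
    simp only [map_sub, map_mul, map_pow, map_ofNat, hz, ← Q.sq]; ring
  rcases mul_eq_zero.1 hpq with rfl | rfl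
  · right
    refine ⟨a * q, (algebraMap K L).injective ?_⟩
    simp only [map_mul, hz, ← Q.sq, map_zero]; ring
  · left
    refine ⟨p, (algebraMap K L).injective ?_⟩
    simp only [map_mul, hz, map_zero]; ring

/-- conjugate place -/
def conj (w : Place L) : Place L where
  ord z := w.ord (Q.σ z)
  ord_zero := by rw [map_zero, w.ord_zero]
  ord_mul x y hx hy := by rw [map_mul, w.ord_mul _ _ (Q.σ_ne hx) (Q.σ_ne hy)]
  ord_add x y hx hy hxy := by
    have := Q.σ_ne hxy
    rw [map_add] at this ⊢
    exact w.ord_add _ _ (Q.σ_ne hx) (Q.σ_ne hy) this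
  surj := by
    obtain ⟨x, hx, h⟩ := w.surj
    exact ⟨Q.σ x, Q.σ_ne hx, by rw [Q.σσ, h]⟩

theorem conj_ord (w : Place L) (z : L) : (Q.conj w).ord z = w.ord (Q.σ z) := rfl
theorem conj_conj (w : Place L) : Q.conj (Q.conj w) = w := by
  ext z; rw [conj_ord, conj_ord, Q.σσ]
theorem conj_ge (w : Place L) (z : L) (n : ℤ) : (Q.conj w).ge z n ↔ w.ge (Q.σ z) n := by
  unfold Place.ge; rw [conj_ord, map_eq_zero]
theorem conj_over {w : Place L} {v : Place K} (h : w.Over v) : (Q.conj w).Over v := by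
  obtain ⟨e, he, h⟩ := h
  exact ⟨e, he, fun x => by rw [conj_ord, Q.σK, h]⟩
theorem conj_lsq (w : Place L) (z : L) : (Q.conj w).lsq z ↔ w.lsq (Q.σ z) := by
  constructor
  · rintro ⟨y, hy, h⟩
    refine ⟨Q.σ y, Q.σ_ne hy, ?_⟩
    rw [conj_ge] at h; simpa using h
  · rintro ⟨y, hy, h⟩
    refine ⟨Q.σ y, Q.σ_ne hy, ?_⟩
    rw [conj_ge]; simpa [Q.σσ] using h

theorem ord_N {w : Place L} {z : L} (hz : z ≠ 0) :
    w.ord (algebraMap K L (Q.N z)) = w.ord z + (Q.conj w).ord z := by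
  rw [N_spec, w.ord_mul _ _ hz (Q.σ_ne hz), conj_ord]

theorem over_unique {w w' : Place L} {v : Place K} (h : w.Over v) (h' : w'.Over v) : w' = w ∨ w' = Q.conj w := by
  classical
  by_contra hc
  push Not at hc
  obtain ⟨h1, h2⟩ := hc
  have h3 : Q.conj w' ≠ w := fun e => h2 (by rw [← e, conj_conj])
  have h4 : Q.conj w' ≠ Q.conj w := fun e => h1 (by rw [← Q.conj_conj w', e, conj_conj])
  obtain ⟨z, hz⟩ := Place.approx {w, Q.conj w, w', Q.conj w'}
    (fun p => if p = w ∨ p = Q.conj w then 1 else 0) (fun _ => 1)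
  have e1 := hz w (by simp)
  have e2 := hz (Q.conj w) (by simp)
  have e3 := hz w' (by simp)
  have e4 := hz (Q.conj w') (by simp)
  simp only [true_or, or_true, if_true, h1, h2, h3, h4, or_self, if_false, sub_zero] at e1 e2 e3 e4
  obtain ⟨hz0, o1⟩ := Place.unit_of_sub_one le_rfl e1
  obtain ⟨-, o2⟩ := Place.unit_of_sub_one le_rfl e2
  have o3 := e3.le hz0
  have o4 := e4.le hz0
  have a1 := Q.ord_N (w := w) hz0
  have a2 := Q.ord_N (w := w') hz0
  rw [o1, o2, add_zero, h.ord_zero_iff] at a1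
  rw [h'.ord_zero_iff.2 a1] at a2
  omega

theorem ne_conj_of_lsq {w : Place L} {v : Place K} (h : w.Over v) (hw : w.Good) (hl : v.lsq a) : w ≠ Q.conj w := by
  intro hc
  obtain ⟨y, hy, hl⟩ := hl
  have h1 := h.ge_one_iff.2 hl
  set z := Q.θ * algebraMap K L y with hz
  have e1 : algebraMap K L (a * y ^ 2 - 1) = (z - 1) * (z + 1) := by
    rw [map_sub, map_mul, ← Q.sq, map_pow, map_one]; ring
  have e2 : Q.σ z = -z := by rw [hz, map_mul, Q.σθ, Q.σK]; ring
  rw [e1] at h1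
  have e3 : w.ord (z - 1) = w.ord (z + 1) := by
    conv_lhs => rw [hc, conj_ord, map_sub, e2, map_one]
    rw [← w.ord_neg]; congr 1; ring
  have key : w.ge (z - 1) 1 ∧ w.ge (z + 1) 1 := by
    rcases h1 with h1 | h1
    · rcases mul_eq_zero.1 h1 with h1 | h1
      · exfalso
        have : z + 1 = 2 := by linear_combination h1
        have hz2 : Q.σ z = z := by rw [sub_eq_zero.1 h1, map_one]
        rw [hz2, sub_eq_zero.1 h1] at e2
        exact hw.two_ne (by linear_combination e2)
      · exfalso
        have hz1 : z = -1 := by linear_combination h1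
        have hz2 : Q.σ z = z := by rw [hz1, map_neg, map_one]
        rw [hz2, hz1] at e2
        exact hw.two_ne (by linear_combination -e2)
    · by_cases hA : z - 1 = 0
      · rw [hA, zero_mul, w.ord_zero] at h1; omega
      by_cases hB : z + 1 = 0
      · rw [hB, mul_zero, w.ord_zero] at h1; omega
      rw [w.ord_mul _ _ hA hB] at h1
      exact ⟨Or.inr (by omega), Or.inr (by omega)⟩
  have h2 : w.ge (2 : L) 1 := by
    have := key.2.sub key.1
    have e : z + 1 - (z - 1) = 2 := by ring
    rwa [e] at this
  have := h2.le hw.two_ne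
  rw [hw.ord_two] at this; omega

theorem split_approx {w : Place L} (hw : w.Good) (hne : w ≠ Q.conj w) (z : L) (n : ℤ) :
    ∃ x : K, w.ge (algebraMap K L x - z) n := by
  classical
  obtain ⟨y, hy⟩ := Place.approx {w, Q.conj w} (fun p => if p = w then z else Q.σ z) (fun _ => n)
  have e1 := hy w (by simp)
  have e2 := hy (Q.conj w) (by simp)
  simp only [if_true, hne.symm, if_false] at e1 e2
  rw [conj_ge, map_sub, Q.σσ] at e2
  obtain ⟨x, hx⟩ := Q.exists_trace y
  refine ⟨x / 2, ?_⟩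
  have h2 : algebraMap K L (x / 2) - z = (1/2) * ((y - z) + (Q.σ y - z)) := by
    have := hw.two_ne
    rw [map_div₀, hx, map_ofNat]; field_simp; ring
  rw [h2]
  exact hw.half.mul0' (e1.add e2)

theorem lsq_of_split {w : Place L} {v : Place K} (h : w.Over v) (hw : w.Good) (hne : w ≠ Q.conj w) {x : K}
    (hx : w.lsq (algebraMap K L x)) : v.lsq x := by
  obtain ⟨y, hy, hl⟩ := hx
  obtain ⟨y', hy'⟩ := Q.split_approx hw hne y (w.ord y + 1)
  obtain ⟨h1, h2⟩ := Place.ord_eq_of_sub hy hy'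
  have hl2 := Place.lsq_of_sub_one le_rfl hl
  have hly : w.lsq (y * algebraMap K L y') := Place.lsq_of_close hy hy'
  -- direct
  have hy0 : y' ≠ 0 := by simpa using h1
  refine ⟨y', hy0, h.ge_one_iff.1 ?_⟩
  have hu : w.ge (algebraMap K L y' / y - 1) 1 := by
    have e : algebraMap K L y' / y - 1 = (algebraMap K L y' - y) / y := by field_simp
    rw [e, Place.ge_div_iff hy, add_comm]; exact hy'
  obtain ⟨hu0, hu1⟩ := Place.unit_of_sub_one le_rfl hu
  obtain ⟨ha0, ha1⟩ := Place.unit_of_sub_one le_rfl hl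
  have e : algebraMap K L (x * y' ^ 2 - 1) = (algebraMap K L x * y ^ 2) * ((algebraMap K L y' / y - 1) * (algebraMap K L y' / y + 1))
      + (algebraMap K L x * y ^ 2 - 1) := by
    rw [map_sub, map_mul, map_pow, map_one]; field_simp; ring
  rw [e]
  exact ((Place.ge_of_ord ha1.ge).mul0' (hu.mul0 ((Place.ge_of_ord hu1.ge).add Place.ge_one))).add hl

theorem lsq_a (Q : Quad K L a) (w : Place L) : w.lsq (algebraMap K L a) := by
  rw [← Q.sq]; exact Place.lsq_of_eq_sq Q.θ_ne

theorem lsq_of_ne_conj {w : Place L} {v : Place K} (h : w.Over v) (hw : w.Good) (hne : w ≠ Q.conj w) : v.lsq a :=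
  Q.lsq_of_split h hw hne (Q.lsq_a w)

theorem e_one_of_split {w : Place L} {v : Place K} (h : w.Over v) (hne : w ≠ Q.conj w) :
    ∀ x : K, w.ord (algebraMap K L x) = v.ord x := by
  classical
  obtain ⟨e, he, h⟩ := h
  obtain ⟨π, hπ, hπ1⟩ := w.surj
  obtain ⟨y, hy⟩ := Place.approx {w, Q.conj w} (fun p => if p = w then π else 1) (fun _ => 2)
  have e1 := hy w (by simp)
  have e2 := hy (Q.conj w) (by simp)
  simp only [if_true, hne.symm, if_false] at e1 e2
  obtain ⟨hy0, o1⟩ := Place.ord_eq_of_sub hπ (by rw [hπ1]; exact e1)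
  obtain ⟨-, o2⟩ := Place.unit_of_sub_one (by norm_num) e2
  have := Q.ord_N (w := w) hy0
  rw [o1, o2, hπ1, h, add_zero] at this
  have : e = 1 := by
    have hd : e ∣ 1 := ⟨_, this.symm⟩
    exact Int.eq_one_of_dvd_one he.le hd
  intro x; rw [h, this, one_mul]

theorem e_one_of_unit (Q : Quad K L a) {w : Place L} {v : Place K} (h : w.Over v) (hw : w.Good) (ha : v.ord a = 0) :
    ∀ x : K, w.ord (algebraMap K L x) = v.ord x := by
  by_cases hne : w = Q.conj w
  swap
  · exact Q.e_one_of_split h hne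
  have hl : ¬ v.lsq a := fun hl => Q.ne_conj_of_lsq h hw hl hne
  have hoM := h
  obtain ⟨e, he, h⟩ := h
  have ha0 := Q.a_ne
  have key : ∀ x y : K, x ^ 2 - a * y ^ 2 ≠ 0 → ∃ k, v.ord (x ^ 2 - a * y ^ 2) = 2 * k := by
    intro x y hxy
    by_cases hy : y = 0
    · subst hy
      exact ⟨v.ord x, by simp [v.ord_pow]⟩
    by_cases hx : x = 0
    · subst hx
      refine ⟨v.ord y, ?_⟩
      have e0 : (0:K) ^ 2 - a * y ^ 2 = - (a * y ^ 2) := by ring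
      rw [e0, v.ord_neg, v.ord_mul _ _ ha0 (pow_ne_zero _ hy), v.ord_pow, ha]; push_cast; ring
    have hx2 : x ^ 2 ≠ 0 := pow_ne_zero _ hx
    have hay : a * y ^ 2 ≠ 0 := mul_ne_zero ha0 (pow_ne_zero _ hy)
    have oay : v.ord (a * y ^ 2) = 2 * v.ord y := by
      rw [v.ord_mul _ _ ha0 (pow_ne_zero _ hy), v.ord_pow, ha]; push_cast; ring
    have ox : v.ord (x ^ 2) = 2 * v.ord x := by rw [v.ord_pow]; push_cast; ring
    rcases lt_trichotomy (v.ord x) (v.ord y) with hlt | heq | hlt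
    · refine ⟨v.ord x, ?_⟩
      rw [← ox, (Place.ord_eq_of_sub hx2 (y := x ^ 2 - a * y ^ 2) ?_).2]
      have : x ^ 2 - a * y ^ 2 - x ^ 2 = - (a * y ^ 2) := by ring
      rw [this]; refine Place.ge.neg (Place.ge_of_ord ?_); omega
    · refine ⟨v.ord x, ?_⟩
      by_contra hcon
      apply hl
      have hge : v.ge (x ^ 2 - a * y ^ 2) (2 * v.ord x) := by
        have e0 : x ^ 2 - a * y ^ 2 = x ^ 2 - a * y ^ 2 := rfl
        exact (Place.ge_of_ord ox.ge).sub (Place.ge_of_ord (by omega))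
      have hgt : 2 * v.ord x + 1 ≤ v.ord (x ^ 2 - a * y ^ 2) := by
        have := hge.le hxy; omega
      refine ⟨y / x, div_ne_zero hy hx, ?_⟩
      have : a * (y / x) ^ 2 - 1 = (a * y ^ 2 - x ^ 2) / x ^ 2 := by field_simp
      rw [this, Place.ge_div_iff hx2, Place.ge_sub_comm, ox]
      exact Place.ge_of_ord (by omega)
    · refine ⟨v.ord y, ?_⟩
      have := (Place.ord_eq_of_sub (v := v) (x := -(a * y ^ 2)) (neg_ne_zero.2 hay) (y := x ^ 2 - a * y ^ 2) ?_).2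
      · rw [this, v.ord_neg, oay]
      have : x ^ 2 - a * y ^ 2 - -(a * y ^ 2) = x ^ 2 := by ring
      rw [this, v.ord_neg]; refine Place.ge_of_ord ?_; omega
  obtain ⟨π, hπ, hπ1⟩ := w.surj
  have h1 := Q.ord_N (w := w) hπ
  rw [← hne, hπ1, h] at h1
  obtain ⟨x, y, hxy⟩ := Q.N_form π
  obtain ⟨k, hk⟩ := key x y (hxy ▸ Q.N_ne hπ)
  rw [hxy, hk] at h1
  have : e = 1 := Int.eq_one_of_dvd_one he.le ⟨k, by linarith⟩
  intro z; rw [h, this, one_mul]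

end Quad

theorem exists_quad {K : Type u} [Field K] {a : K} (ha : ¬ IsSquare a) :
    ∃ (L : Type u) (_ : Field L) (_ : Algebra K L), Nonempty (Quad K L a) := by
  have : Fact (∀ r : K, r ^ 2 ≠ a + 0 * r) := ⟨fun r hr => ha ⟨r, by rw [zero_mul, add_zero] at hr; rw [← hr, sq]⟩⟩
  refine ⟨QuadraticAlgebra K a 0, inferInstance, inferInstance, ⟨⟨QuadraticAlgebra.omega, ?_,
    starRingEnd _, ?_, ?_, ?_, ha⟩⟩⟩
  · rw [sq, QuadraticAlgebra.omega_mul_omega_eq_mk]; rfl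
  · rw [starRingEnd_apply]; ext <;> simp
  · intro x; rw [starRingEnd_apply]; ext <;> simp
  · intro z
    refine ⟨z.re, z.im, ?_⟩
    ext <;> simp

end
end GFq

namespace GFq
open IntermediateField Algebra
universe u
/-- global function field of odd characteristic -/
class Glob (K : Type*) [Field K] : Prop where
  out : ∃ k : Subfield K, GF k K
  two : (2 : K) ≠ 0

section
variable {K : Type*} [Field K]

theorem Glob.two' [h : Glob K] (k : Subfield K) : (2 : k) ≠ 0 := fun hc => h.two (by
  have := congrArg (algebraMap k K) hc
  rwa [map_ofNat, map_zero] at this)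

theorem Place.gd [h : Glob K] (v : Place K) : v.Good := by
  obtain ⟨k, hk⟩ := h.out
  exact good (Fq := k) (Glob.two' k) v

theorem fsupp [h : Glob K] (x : K) : {v : Place K | v.ord x ≠ 0}.Finite := by
  obtain ⟨k, hk⟩ := h.out
  exact finite_supp k x

theorem GF.of_range {Fq : Type*} [Field Fq] [Algebra Fq K] [h : GF Fq K] : GF (algebraMap Fq K).fieldRange K := by
  have := h.fin
  let f := (algebraMap Fq K).rangeRestrictField
  let _ : Algebra Fq (algebraMap Fq K).fieldRange := f.toAlgebra
  have : IsScalarTower Fq (algebraMap Fq K).fieldRange K := IsScalarTower.of_algebraMap_eq fun x => rfl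
  have hs : Function.Surjective (algebraMap Fq (algebraMap Fq K).fieldRange) := by
    rintro ⟨_, y, rfl⟩
    exact ⟨y, rfl⟩
  have : Algebra.IsAlgebraic Fq (algebraMap Fq K).fieldRange := ⟨fun x => by
    obtain ⟨y, rfl⟩ := hs x
    exact isAlgebraic_algebraMap y⟩
  refine ⟨Finite.of_surjective _ hs, ?_, ?_⟩
  · have := h.ess
    exact Algebra.EssFiniteType.of_comp Fq _ K
  · have e := lift_trdeg_add_eq Fq (algebraMap Fq K).fieldRange K
    rw [h.trdeg, trdeg_eq_zero (R := Fq)] at e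
    simpa using e

theorem Glob.of_finite {L : Type*} [Field L] [Algebra K L] [FiniteDimensional K L] [h : Glob K] : Glob L := by
  refine ⟨?_, ?_⟩
  · obtain ⟨k, hk⟩ := h.out
    have : GF k L := GF.of_finite (K := K)
    exact ⟨_, GF.of_range (Fq := k)⟩
  · have := (map_ne_zero (algebraMap K L)).2 h.two
    rwa [map_ofNat] at this

theorem Place.exists_over {L : Type*} [Field L] [Algebra K L] [FiniteDimensional K L] (v : Place K) :
    ∃ w : Place L, w.Over v := by
  obtain ⟨w, e, he, h⟩ := v.exists_ext (L := L)
  exact ⟨w, e, he, h⟩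

theorem Place.exists_under {L : Type*} [Field L] [Algebra K L] [FiniteDimensional K L] (w : Place L) :
    ∃ v : Place K, w.Over v := by
  obtain ⟨v, e, he, h⟩ := w.exists_restr (K := K)
  exact ⟨v, e, he, h⟩

/-- `S` contains the poles of a nonconstant function -/
def HasT (S : Finset (Place K)) : Prop :=
  ∃ t : K, (∃ v : Place K, v.ord t < 0) ∧ ∀ v : Place K, v.ord t < 0 → v ∈ S

/-- the ring of `S`-integers is principal -/
def Pid (S : Finset (Place K)) : Prop :=
  ∀ v ∉ S, ∃ x : K, x ≠ 0 ∧ v.ord x = 1 ∧ ∀ w ∉ S, w ≠ v → w.ord x = 0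

/-- big enough -/
def Big (S : Finset (Place K)) : Prop := HasT S ∧ Pid S

theorem HasT.mono {S T : Finset (Place K)} (h : HasT S) (hST : S ⊆ T) : HasT T := by
  obtain ⟨t, h1, h2⟩ := h
  exact ⟨t, h1, fun v hv => hST (h2 v hv)⟩

theorem Big.mono {S T : Finset (Place K)} (h : Big S) (hST : S ⊆ T) : Big T := by
  refine ⟨h.1.mono hST, fun v hv => ?_⟩
  obtain ⟨x, h1, h2, h3⟩ := h.2 v (fun hc => hv (hST hc))
  exact ⟨x, h1, h2, fun w hw => h3 w (fun hc => hw (hST hc))⟩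

theorem exists_hasT [h : Glob K] : ∃ S : Finset (Place K), HasT S := by
  obtain ⟨k, hk⟩ := h.out
  obtain ⟨t, ht⟩ := hk.exists_transc
  obtain ⟨v, hv⟩ := exists_pole ht
  exact ⟨(fsupp t).toFinset, t, ⟨v, hv⟩, fun w hw => by simpa using hw.ne⟩

theorem exists_big [h : Glob K] (Z : Finset (Place K)) : ∃ S : Finset (Place K), Z ⊆ S ∧ Big S := by
  classical
  obtain ⟨k, hk⟩ := h.out
  obtain ⟨S1, h1⟩ := exists_hasT (K := K)
  obtain ⟨S0, h0⟩ := exists_pid k K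
  refine ⟨Z ∪ (S1 ∪ S0), Finset.subset_union_left, h1.mono ?_, ?_⟩
  · exact Finset.subset_union_left.trans Finset.subset_union_right
  · intro v hv
    simp only [Finset.mem_union, not_or] at hv
    obtain ⟨x, h1, h2, h3⟩ := h0 v hv.2.2
    refine ⟨x, h1, h2, fun w hw => ?_⟩
    simp only [Finset.mem_union, not_or] at hw
    exact h3 w hw.2.2

theorem HasT.index [h : Glob K] {S : Finset (Place K)} (hS : HasT S) : (U.dbl S).index = 2 ^ S.card := by
  obtain ⟨k, hk⟩ := h.out
  obtain ⟨t, ⟨v, hv⟩, ht⟩ := hS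
  have := hk.fin
  exact card_U k (Glob.two' k) (transc_of_ord v hv.ne) ht

theorem Pid.realize {S : Finset (Place K)} (hS : Pid S) (D : Place K → ℤ) (hD : {v | D v ≠ 0}.Finite) :
    ∃ c : K, c ≠ 0 ∧ ∀ v ∉ S, v.ord c = D v := by
  classical
  have : ∀ v : Place K, ∃ x : K, x ≠ 0 ∧ (v ∉ S → v.ord x = 1 ∧ ∀ w ∉ S, w ≠ v → w.ord x = 0) := by
    intro v
    by_cases hv : v ∈ S
    · exact ⟨1, one_ne_zero, fun h => absurd hv h⟩
    · obtain ⟨x, h1, h2⟩ := hS v hv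
      exact ⟨x, h1, fun _ => h2⟩
  choose x hx0 hx using this
  set T := hD.toFinset \ S
  refine ⟨∏ v ∈ T, x v ^ D v, Finset.prod_ne_zero_iff.2 fun v _ => zpow_ne_zero _ (hx0 v), fun v hv => ?_⟩
  rw [v.ord_prod T (fun w => x w ^ D w) fun w _ => zpow_ne_zero _ (hx0 w)]
  have e : ∀ w ∈ T, v.ord (x w ^ D w) = if w = v then D v else 0 := by
    intro w hw
    rw [Place.ord_zpow]
    have hwS : w ∉ S := (Finset.mem_sdiff.1 hw).2
    split_ifs with hwv
    · subst hwv; rw [(hx w hwS).1, mul_one]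
    · rw [(hx w hwS).2 v hv (Ne.symm hwv), mul_zero]
  rw [Finset.sum_congr rfl e, Finset.sum_ite_eq']
  split_ifs with hT
  · rfl
  · by_contra hc
    exact hT (Finset.mem_sdiff.2 ⟨by simpa using Ne.symm hc, hv⟩)
end
end GFq

namespace GFq
universe u
variable {K : Type u} [Field K]

theorem norm_index_aux {L : Type u} [Field L] [Algebra K L] [Glob K] {a : K} (Q : Quad K L a) {S : Finset (Place K)} (hS : Big S)
    (haS : ∀ v ∉ S, v.ord a = 0) (H : AddSubgroup (U S))
    (hH : ∀ x : U S, (∃ p q : K, x.val = p ^ 2 - a * q ^ 2) → x ∈ H) [DecidablePred fun v : Place K => ¬ v.lsq a] :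
    2 * H.index ≤ 2 ^ (S.filter fun v => ¬ v.lsq a).card := by
  classical
  have := Q.fd
  have : Glob L := Glob.of_finite (K := K)
  choose wv hwv using fun v : Place K => v.exists_over (L := L)
  choose un hun using fun w : Place L => w.exists_under (K := K)
  have hinj : Function.Injective wv := fun v v' h => (hwv v).unique (h ▸ hwv v')
  let SL : Finset (Place L) := S.biUnion fun v => {wv v, Q.conj (wv v)}
  have hSL : ∀ {w : Place L} {v : Place K}, w.Over v → (w ∈ SL ↔ v ∈ S) := by
    intro w v h
    simp only [SL, Finset.mem_biUnion, Finset.mem_insert, Finset.mem_singleton]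
    constructor
    · rintro ⟨v', h1, rfl | rfl⟩
      · rwa [h.unique (hwv v')]
      · rwa [h.unique (Q.conj_over (hwv v'))]
    · intro hv
      exact ⟨v, hv, Q.over_unique (hwv v) h⟩
  have hcard : SL.card + (S.filter fun v => ¬ v.lsq a).card = 2 * S.card := by
    rw [Finset.card_biUnion, Finset.card_filter, ← Finset.sum_add_distrib, Finset.sum_congr rfl (g := fun _ => 2)]
    · rw [Finset.sum_const, smul_eq_mul, mul_comm]
    · intro v _
      by_cases hl : v.lsq a
      · rw [Finset.card_pair (Q.ne_conj_of_lsq (hwv v) (wv v).gd hl)]; simp [hl]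
      · have : wv v = Q.conj (wv v) := by
          by_contra hc; exact hl (Q.lsq_of_ne_conj (hwv v) (wv v).gd hc)
        rw [← this]; simp [hl]
    · intro v _ v' _ hne
      rw [Function.onFun, Finset.disjoint_left]
      intro w h1 h2
      simp only [Finset.mem_insert, Finset.mem_singleton] at h1 h2
      have e1 : w.Over v := by rcases h1 with rfl | rfl; exacts [hwv v, Q.conj_over (hwv v)]
      have e2 : w.Over v' := by rcases h2 with rfl | rfl; exacts [hwv v', Q.conj_over (hwv v')]
      exact hne (e1.unique e2)
  have hNord : ∀ z : L, z ≠ 0 → ∀ v ∉ S, v.ord (Q.N z) = (wv v).ord z + (Q.conj (wv v)).ord z := by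
    intro z hz v hv
    rw [← Q.ord_N hz, Q.e_one_of_unit (hwv v) (wv v).gd (haS v hv)]
  let N : U SL →+ U S := AddMonoidHom.mk' (fun z => U.mk (Q.N z.val) (Q.N_ne z.val_ne) (by
    intro v hv
    rw [hNord _ z.val_ne v hv, z.val_ord (by rwa [hSL (hwv v)]), z.val_ord (by rwa [hSL (Q.conj_over (hwv v))]), add_zero])) (by
    intro x y; apply U.ext; simp only [U.val_add, U.val_mk, Q.N_mul])
  have hN : ∀ z, (N z).val = Q.N z.val := fun z => rfl
  let ι : U S →+ U SL := AddMonoidHom.mk' (fun x => U.mk (algebraMap K L x.val) (by simpa using x.val_ne) (by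
    intro w hw
    rw [(hun w).ord_zero_iff]
    exact x.val_ord (by rwa [← hSL (hun w)]))) (by
    intro x y; apply U.ext; simp only [U.val_add, U.val_mk, map_mul])
  have hι : ∀ x, (ι x).val = algebraMap K L x.val := fun x => rfl
  have hker : (U.dbl S).comap N ≤ ι.range ⊔ U.dbl SL := by
    intro z hz
    rw [AddSubgroup.mem_comap, U.mem_dbl, hN] at hz
    obtain ⟨y, hy⟩ := hz
    have hz0 := z.val_ne
    have hy0 : y ≠ 0 := by rintro rfl; exact Q.N_ne hz0 (by simpa using hy)
    have hy0' : algebraMap K L y ≠ 0 := by simpa using hy0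
    have hyS : ∀ v ∉ S, v.ord y = 0 := by
      intro v hv
      have h1 := (N z).val_ord hv
      rw [hN, hy, v.ord_mul _ _ hy0 hy0] at h1
      omega
    have hzσ : z.val * Q.σ z.val = algebraMap K L y * algebraMap K L y := by
      rw [← Q.N_spec, hy, map_mul]
    have : ∃ u : L, u ≠ 0 ∧ u * algebraMap K L y = z.val * Q.σ u := by
      by_cases h1 : algebraMap K L y + z.val = 0
      · refine ⟨Q.θ, Q.θ_ne, ?_⟩
        rw [Q.σθ, eq_neg_of_add_eq_zero_right h1]; ring
      · refine ⟨algebraMap K L y + z.val, h1, ?_⟩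
        rw [map_add, Q.σK, mul_add, hzσ]; ring
    obtain ⟨u, hu0, hu⟩ := this
    have hu2 : u ^ 2 * algebraMap K L y = z.val * algebraMap K L (Q.N u) := by
      rw [Q.N_spec, sq, mul_assoc, hu]; ring
    have hNu := Q.N_ne hu0
    have hNu' : algebraMap K L (Q.N u) ≠ 0 := by simpa using hNu
    have hconj : ∀ v ∉ S, (Q.conj (wv v)).ord u = (wv v).ord u := by
      intro v hv
      have h1 := congrArg (wv v).ord hu
      rw [(wv v).ord_mul _ _ hu0 hy0', (wv v).ord_mul _ _ hz0 (Q.σ_ne hu0), ← Q.conj_ord,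
        Q.e_one_of_unit (hwv v) (wv v).gd (haS v hv), hyS v hv, z.val_ord (by rwa [hSL (hwv v)])] at h1
      omega
    obtain ⟨c, hc0, hc⟩ := hS.2.realize (fun v => (wv v).ord u)
      (((fsupp u).preimage hinj.injOn).subset fun v hv => hv)
    have hc0' : algebraMap K L c ≠ 0 := by simpa using hc0
    have hx : ∀ v ∉ S, v.ord (y * c ^ 2 / Q.N u) = 0 := by
      intro v hv
      rw [v.ord_div (mul_ne_zero hy0 (pow_ne_zero _ hc0)) hNu, v.ord_mul _ _ hy0 (pow_ne_zero _ hc0), v.ord_pow,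
        hyS v hv, hc v hv, hNord u hu0 v hv, hconj v hv]
      push_cast; ring
    have hx0 : y * c ^ 2 / Q.N u ≠ 0 := div_ne_zero (mul_ne_zero hy0 (pow_ne_zero _ hc0)) hNu
    have huc : ∀ w ∉ SL, w.ord (u / algebraMap K L c) = 0 := by
      intro w hw
      set v := un w
      have hwv' : w.Over v := hun w
      have hv : v ∉ S := by rwa [← hSL (hun w)]
      rw [w.ord_div hu0 hc0', Q.e_one_of_unit hwv' w.gd (haS v hv), hc v hv]
      rcases Q.over_unique (hwv v) hwv' with h | h
      · rw [h]; ring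
      · have := hconj v hv
        rw [← h] at this; rw [this]; ring
    have hz : z = ι (U.mk _ hx0 hx) + 2 • U.mk _ (div_ne_zero hu0 hc0') huc := by
      apply U.ext
      rw [U.val_add, hι, U.val_two, U.val_mk, U.val_mk]
      simp only [map_div₀, map_mul, map_pow]
      field_simp
      linear_combination -hu2
    rw [hz]
    exact AddSubgroup.add_mem_sup ⟨_, rfl⟩ ⟨_, rfl⟩
  -- indices
  have iS := hS.1.index
  have iL : (U.dbl SL).index = 2 ^ SL.card := by
    apply HasT.index
    obtain ⟨t, ⟨v, hv⟩, ht⟩ := hS.1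
    refine ⟨algebraMap K L t, ⟨wv v, (hwv v).ord_neg_iff.2 hv⟩, fun w hw => ?_⟩
    rw [hSL (hun w)]
    exact ht _ ((hun w).ord_neg_iff.1 hw)
  have nS : ∀ M : AddSubgroup (U S), (U.dbl S).relIndex M ≠ 0 := fun M h => by
    have := AddSubgroup.index_eq_zero_of_relIndex_eq_zero h
    rw [iS] at this; simp at this
  have nL : ∀ M : AddSubgroup (U SL), (U.dbl SL).relIndex M ≠ 0 := fun M h => by
    have := AddSubgroup.index_eq_zero_of_relIndex_eq_zero h
    rw [iL] at this; simp at this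
  have c1 : U.dbl SL ≤ (U.dbl S).comap N := by
    rintro z ⟨y, rfl⟩
    exact ⟨N y, by simp⟩
  have e1 := AddSubgroup.relIndex_mul_index c1
  have e2 : ((U.dbl S).comap N).index ≤ (U.dbl S).relIndex H := by
    rw [AddSubgroup.index_comap]
    refine AddSubgroup.relIndex_le_of_le_right ?_ (nS _)
    rintro _ ⟨z, rfl⟩
    exact hH _ (Q.N_form z.val)
  have c3 : U.dbl S ≤ H := by
    intro x hx
    rw [U.mem_dbl] at hx
    obtain ⟨y, hy⟩ := hx
    exact hH _ ⟨y, 0, by rw [hy]; ring⟩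
  have e3 := AddSubgroup.relIndex_mul_index c3
  have e4 : (U.dbl SL).relIndex ((U.dbl S).comap N) ≤ ((U.dbl SL).comap ι).index := by
    rw [AddSubgroup.index_comap, ← AddSubgroup.relIndex_sup_right ι.range]
    exact AddSubgroup.relIndex_le_of_le_right hker (nL _)
  have c5 : U.dbl S ≤ (U.dbl SL).comap ι := by
    rintro z ⟨y, rfl⟩
    exact ⟨ι y, by simp⟩
  have e5 := AddSubgroup.relIndex_mul_index c5
  have e6 : 2 ≤ (U.dbl S).relIndex ((U.dbl SL).comap ι) := by
    have h0 := nS ((U.dbl SL).comap ι)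
    have h1 : (U.dbl S).relIndex ((U.dbl SL).comap ι) ≠ 1 := by
      intro h
      rw [AddSubgroup.relIndex_eq_one] at h
      have := h (x := U.mk a Q.a_ne haS) (by
        rw [AddSubgroup.mem_comap, U.mem_dbl, hι, U.val_mk, ← Q.sq]
        exact ⟨Q.θ, sq _⟩)
      rw [U.mem_dbl] at this
      exact Q.nsq this
    omega
  rw [iL] at e1
  rw [iS] at e3 e5
  have p1 : 2 ^ SL.card * H.index ≤ ((U.dbl SL).comap ι).index * 2 ^ S.card := by
    rw [← e1, ← e3]
    calc _ ≤ ((U.dbl SL).comap ι).index * (U.dbl S).relIndex H * H.index := by gcongr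
      _ = _ := by ring
  have p2 : 2 * ((U.dbl SL).comap ι).index ≤ 2 ^ S.card := by
    rw [← e5]; gcongr
  have p3 : 2 ^ SL.card * (2 * H.index) ≤ 2 ^ SL.card * 2 ^ (S.filter fun v => ¬ v.lsq a).card := by
    rw [← pow_add, hcard, two_mul S.card, pow_add]
    calc _ = 2 * (2 ^ SL.card * H.index) := by ring
      _ ≤ 2 * (((U.dbl SL).comap ι).index * 2 ^ S.card) := by gcongr
      _ = 2 * ((U.dbl SL).comap ι).index * 2 ^ S.card := by ring
      _ ≤ _ := by gcongr
  exact Nat.le_of_mul_le_mul_left p3 (by positivity)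

theorem norm_index [Glob K] {a : K} (ha : ¬ IsSquare a) {S : Finset (Place K)} (hS : Big S)
    (haS : ∀ v ∉ S, v.ord a = 0) (H : AddSubgroup (U S))
    (hH : ∀ x : U S, (∃ p q : K, x.val = p ^ 2 - a * q ^ 2) → x ∈ H) [DecidablePred fun v : Place K => ¬ v.lsq a] :
    2 * H.index ≤ 2 ^ (S.filter fun v => ¬ v.lsq a).card := by
  obtain ⟨L, _, _, ⟨Q⟩⟩ := exists_quad ha
  exact norm_index_aux Q hS haS H hH
end GFq

namespace GFq
universe u

theorem surj_of_single {G T : Type*} [AddCommGroup G] [Finite T] [DecidableEq T] (f : G →+ (T → ZMod 2))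
    (h : ∀ t, ∃ g, f g = Pi.single t 1) : Function.Surjective f := by
  have := Fintype.ofFinite T
  intro y
  choose g hg using h
  refine ⟨∑ t, (y t).val • g t, ?_⟩
  rw [map_sum]
  simp only [map_nsmul, hg]
  ext t
  rw [Finset.sum_apply, Finset.sum_eq_single t]
  · rw [Pi.smul_apply, Pi.single_eq_same, nsmul_eq_mul, mul_one, ZMod.natCast_zmod_val]
  · intro b _ hb
    rw [Pi.smul_apply, Pi.single_eq_of_ne hb.symm, smul_zero]
  · simp

theorem zmod2_cases (x : ZMod 2) : x = 0 ∨ x = 1 := by revert x; decide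

/-- independent subfamily -/
theorem exists_indep {G I : Type*} [AddCommGroup G] (D : AddSubgroup G) (hD : D.index ≠ 0)
    (f : I → (G →+ ZMod 2)) (hf : ∀ i, ∀ x ∈ D, f i x = 0) :
    ∃ T : Finset I, (∀ y : I → ZMod 2, ∃ x, ∀ i ∈ T, f i x = y i) ∧
      (∀ x, (∀ i ∈ T, f i x = 0) → ∀ i, f i x = 0) ∧
      ∃ φ : G →+ (T → ZMod 2), Function.Surjective φ ∧ ∀ x t, φ x t = f t x := by
  classical
  let φ : ∀ T : Finset I, G →+ (T → ZMod 2) := fun T => AddMonoidHom.mk' (fun x t => f t x) (by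
    intro x y; ext t; simp)
  have hφ : ∀ T x t, φ T x t = f t x := fun _ _ _ => rfl
  have hb : ∀ T : Finset I, Function.Surjective (φ T) → 2 ^ T.card ≤ D.index := by
    intro T hT
    have h1 := AddSubgroup.index_ker (φ T)
    rw [AddMonoidHom.range_eq_top.2 hT, AddSubgroup.card_top] at h1
    have h2 : Nat.card (T → ZMod 2) = 2 ^ T.card := by simp
    rw [← h2, ← h1]
    refine Nat.le_of_dvd (Nat.pos_of_ne_zero hD) (AddSubgroup.index_dvd_of_le ?_)
    intro x hx
    rw [AddMonoidHom.mem_ker]; ext t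
    rw [hφ]; exact hf _ x hx
  have hex : ∃ n, ∃ T : Finset I, Function.Surjective (φ T) ∧ T.card = n :=
    ⟨0, ∅, fun y => ⟨0, Subsingleton.elim _ _⟩, rfl⟩
  let P : ℕ → Prop := fun n => ∃ T : Finset I, Function.Surjective (φ T) ∧ T.card = n
  have hPb : ∀ n, P n → n ≤ D.index := by
    rintro n ⟨T, hT, rfl⟩
    exact (Nat.lt_two_pow_self).le.trans (hb T hT)
  have hmax : P (Nat.findGreatest P D.index) := by
    obtain ⟨n, hn⟩ := hex
    exact Nat.findGreatest_spec (P := P) (hPb n hn) hn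
  obtain ⟨T, hT, hTc⟩ := hmax
  refine ⟨T, fun y => ?_, fun x hx i => ?_, φ T, hT, hφ T⟩
  · obtain ⟨x, hx⟩ := hT fun t => y t
    exact ⟨x, fun i hi => by rw [← hφ T x ⟨i, hi⟩, hx]⟩
  · by_contra hi
    have hi1 : f i x = 1 := (zmod2_cases _).resolve_left hi
    have hiT : i ∉ T := fun h => hi (hx i h)
    have hs : Function.Surjective (φ (insert i T)) := by
      intro y
      obtain ⟨x0, hx0⟩ := hT fun t => y ⟨t, Finset.mem_insert_of_mem t.2⟩
      refine ⟨x0 + (y ⟨i, Finset.mem_insert_self _ _⟩ - f i x0).val • x, ?_⟩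
      ext ⟨j, hj⟩
      rw [hφ, map_add, map_nsmul]
      dsimp only
      rcases Finset.mem_insert.1 hj with rfl | hj'
      · rw [hi1]; simp
      · rw [hx j hj', ← hφ T x0 ⟨j, hj'⟩, hx0]; simp
    have := Nat.le_findGreatest (P := P) (hPb _ ⟨_, hs, rfl⟩) ⟨_, hs, rfl⟩
    rw [← hTc, Finset.card_insert_of_notMem hiT] at this
    omega

variable {K : Type u} [Field K]

/-- Hilbert symbol homomorphism -/
noncomputable def U.hh [Glob K] {S : Finset (Place K)} (v : Place K) (a : K) : U S →+ ZMod 2 :=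
  AddMonoidHom.mk' (fun x => v.h a x.val) fun x y => by
    rw [U.val_add, Place.h_mul_right v.gd x.val_ne y.val_ne]
theorem U.hh_apply [Glob K] {S : Finset (Place K)} (v : Place K) (a : K) (x : U S) : U.hh v a x = v.h a x.val := rfl

noncomputable def U.rh [Glob K] {S : Finset (Place K)} (v : Place K) : U S →+ ZMod 2 :=
  AddMonoidHom.mk' (fun x => v.r x.val) fun x y => by
    rw [U.val_add, Place.r_mul v.gd x.val_ne y.val_ne]
theorem U.rh_apply [Glob K] {S : Finset (Place K)} (v : Place K) (x : U S) : U.rh v x = v.r x.val := rfl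

/-- joint Hilbert symbol map -/
noncomputable def U.ph [Glob K] {S : Finset (Place K)} (T : Finset (Place K)) (a : K) : U S →+ (T → ZMod 2) :=
  AddMonoidHom.mk' (fun x t => t.1.h a x.val) fun x y => by
    ext t
    exact (U.hh t.1 a).map_add x y
theorem U.ph_apply [Glob K] {S : Finset (Place K)} (T : Finset (Place K)) (a : K) (x : U S) (t : T) :
    U.ph T a x t = t.1.h a x.val := rfl

/-- local classes -/
noncomputable def U.ps [Glob K] {S : Finset (Place K)} (T : Finset (Place K)) : U S →+ (T → ZMod 2 × ZMod 2) :=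
  AddMonoidHom.mk' (fun x t => (t.1.o x.val, t.1.r x.val)) fun x y => by
    ext t
    · simp [U.val_add, Place.o_mul x.val_ne y.val_ne]
    · simp [U.val_add, Place.r_mul t.1.gd x.val_ne y.val_ne]
theorem U.ps_apply [Glob K] {S : Finset (Place K)} (T : Finset (Place K)) (x : U S) (t : T) :
    U.ps T x t = (t.1.o x.val, t.1.r x.val) := rfl

open Classical in
theorem norm_index_ph [Glob K] {a : K} (ha : ¬ IsSquare a) {S : Finset (Place K)} (hS : Big S)
    (haS : ∀ v ∉ S, v.ord a = 0) (T : Finset (Place K)) (hT : Function.Surjective (U.ph (S := S) T a)) :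
    T.card < (S.filter fun v => ¬ v.lsq a).card := by
  have ha0 : a ≠ 0 := by rintro rfl; exact ha ⟨0, by simp⟩
  have h := norm_index ha hS haS (U.ph (S := S) T a).ker (by
    rintro x ⟨p, q, hx⟩
    rw [AddMonoidHom.mem_ker]; ext t
    rw [U.ph_apply, hx]
    exact Place.h_norm t.1.gd ha0 (hx ▸ x.val_ne))
  rw [AddSubgroup.index_ker, AddMonoidHom.range_eq_top.2 hT, AddSubgroup.card_top] at h
  have h2 : Nat.card (T → ZMod 2) = 2 ^ T.card := by simp
  rw [h2, ← pow_succ', Nat.pow_le_pow_iff_right (by norm_num)] at h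
  exact h

theorem exists_nonlsq_mem [Glob K] {a : K} (ha : ¬ IsSquare a) {S : Finset (Place K)} (hS : Big S)
    (haS : ∀ v ∉ S, v.ord a = 0) : ∃ v ∈ S, ¬ v.lsq a := by
  classical
  have := norm_index_ph ha hS haS ∅ (fun y => ⟨0, Subsingleton.elim _ _⟩)
  rw [Finset.card_empty, Finset.card_pos] at this
  obtain ⟨v, hv⟩ := this
  rw [Finset.mem_filter] at hv
  exact ⟨v, hv⟩

/-- weak Chebotarev -/
theorem exists_nonlsq [Glob K] {a : K} (ha : ¬ IsSquare a) (S : Finset (Place K)) : ∃ v ∉ S, ¬ v.lsq a := by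
  classical
  have ha0 : a ≠ 0 := by rintro rfl; exact ha ⟨0, by simp⟩
  by_contra hc
  push Not at hc
  have : ∀ v : Place K, ∃ c : K, c ≠ 0 ∧ (¬ v.lsq a → v.h a c = 1) := by
    intro v
    by_cases h : v.lsq a
    · exact ⟨1, one_ne_zero, fun h' => absurd h h'⟩
    · obtain ⟨c, hc, h1⟩ := Place.exists_h_one v.gd ha0 h
      exact ⟨c, hc, fun _ => h1⟩
  choose c hc0 hc1 using this
  have : ∀ v : Place K, ∃ x : K, ∀ w ∈ insert v S, w.ge (x - if w = v then c v else 1) (w.ord (if w = v then c v else 1) + 1) :=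
    fun v => Place.approx (insert v S) (fun w => if w = v then c v else 1) _
  choose x hx using this
  have hx0 : ∀ v, x v ≠ 0 := fun v => (Place.ord_eq_of_sub (by simp [hc0]) (hx v v (by simp))).1
  obtain ⟨S', hSS', hS'⟩ := exists_big (S ∪ ((fsupp a).toFinset ∪ S.biUnion fun v => (fsupp (x v)).toFinset))
  have haS : ∀ v ∉ S', v.ord a = 0 := by
    intro v hv
    by_contra hne
    exact hv (hSS' (by simp [hne]))
  have hxS : ∀ w ∈ S, ∀ v ∉ S', v.ord (x w) = 0 := by
    intro w hw v hv
    by_contra hne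
    refine hv (hSS' ?_)
    simp only [Finset.mem_union, Finset.mem_biUnion]
    exact Or.inr (Or.inr ⟨w, hw, by simpa using hne⟩)
  have hSsub : S ⊆ S' := fun v hv => hSS' (by simp [hv])
  have := norm_index_ph ha hS' haS (S'.filter fun v => ¬ v.lsq a) (surj_of_single _ ?_)
  · exact lt_irrefl _ this
  rintro ⟨t, ht⟩
  rw [Finset.mem_filter] at ht
  have htS : t ∈ S := by
    by_contra h
    exact ht.2 (hc t h)
  refine ⟨U.mk (x t) (hx0 t) (hxS t htS), ?_⟩
  ext ⟨w, hw⟩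
  rw [Finset.mem_filter] at hw
  have hwS : w ∈ S := by
    by_contra h
    exact hw.2 (hc w h)
  rw [U.ph_apply, U.val_mk, Pi.single_apply]
  have h1 := hx t w (by simp [hwS])
  simp only [Subtype.mk.injEq]
  by_cases hwt : w = t
  · subst hwt
    simp only [if_true] at h1 ⊢
    have := Place.close_o_r w.gd (hc0 w) h1
    rw [← hc1 w ht.2]
    unfold Place.h; rw [this.1, this.2]
  · rw [if_neg hwt] at h1 ⊢
    rw [Place.ord_one] at h1
    exact Place.h_lsq_right (Place.lsq_of_sub_one le_rfl (by simpa using h1))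
end GFq

namespace GFq
universe u
variable {K : Type u} [Field K]

theorem Place.exists_over_finset {L : Type*} [Field L] [Algebra K L] {a : K} (Q : Quad K L a) (S : Finset (Place K)) :
    ∃ T : Finset (Place L), ∀ (w : Place L) (v : Place K), w.Over v → v ∈ S → w ∈ T := by
  classical
  have := Q.fd
  choose wv hwv using fun v : Place K => v.exists_over (L := L)
  refine ⟨S.biUnion fun v => {wv v, Q.conj (wv v)}, fun w v h hv => ?_⟩
  simp only [Finset.mem_biUnion, Finset.mem_insert, Finset.mem_singleton]
  exact ⟨v, hv, Q.over_unique (hwv v) h⟩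

theorem ne_zero_of_nsq {a : K} (ha : ¬ IsSquare a) : a ≠ 0 := by rintro rfl; exact ha ⟨0, by simp⟩

theorem exists_split_nonlsq [Glob K] {a : K} (ha : ¬ IsSquare a) {S : Finset (Place K)}
    (haS : ∀ v ∉ S, v.ord a = 0) {x : K} (hxS : ∀ v ∉ S, v.ord x = 0) (hx : ¬ IsSquare x)
    (hax : ¬ IsSquare (a * x)) : ∃ v ∉ S, v.lsq a ∧ ¬ v.lsq x := by
  obtain ⟨L, _, _, ⟨Q⟩⟩ := exists_quad ha
  have := Q.fd
  have : Glob L := Glob.of_finite (K := K)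
  obtain ⟨T, hT⟩ := Place.exists_over_finset Q S
  have hxL : ¬ IsSquare (algebraMap K L x) := fun h => (Q.sq_of_sq h Glob.two).elim hx hax
  obtain ⟨w, hw, hwx⟩ := exists_nonlsq hxL T
  obtain ⟨v, hv⟩ := w.exists_under (K := K)
  have hvS : v ∉ S := fun h => hw (hT w v hv h)
  have h1 : ¬ v.lsq x := fun h => hwx (hv.lsq h)
  refine ⟨v, hvS, ?_, h1⟩
  by_contra h2
  have h3 := Place.unit_nonlsq_mul v.gd Q.a_ne (ne_zero_of_nsq hx) (haS v hvS) (hxS v hvS) h2 h1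
  have h4 := hv.lsq h3
  rw [map_mul] at h4
  exact hwx (Place.lsq_cancel (Q.lsq_a w) h4)

theorem exists_T [Glob K] {a : K} (ha : ¬ IsSquare a) {S : Finset (Place K)} (hS : Big S)
    (haS : ∀ v ∉ S, v.ord a = 0) : ∃ T : Finset (Place K), (∀ v ∈ T, v ∉ S ∧ v.lsq a) ∧
    (∀ y : Place K → ZMod 2, ∃ x : U S, ∀ v ∈ T, v.r x.val = y v) ∧ S.card ≤ T.card + 1 := by
  classical
  have iS := hS.1.index
  obtain ⟨T, h1, h2, φ, h3, h4⟩ := exists_indep (U.dbl S) (by rw [iS]; positivity)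
    (fun v : {v : Place K // v ∉ S ∧ v.lsq a} => U.rh (S := S) v.1) (by
      intro i x hx
      rw [U.mem_dbl] at hx
      obtain ⟨y, hy⟩ := hx
      rw [U.rh_apply, hy, ← sq]
      refine Place.r_sq ?_
      rintro rfl; exact x.val_ne (by simpa using hy))
  refine ⟨T.map (Function.Embedding.subtype _), ?_, ?_, ?_⟩
  · intro v hv
    simp only [Finset.mem_map] at hv
    obtain ⟨w, -, rfl⟩ := hv
    exact w.2
  · intro y
    obtain ⟨x, hx⟩ := h1 fun v => y v.1
    refine ⟨x, fun v hv => ?_⟩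
    simp only [Finset.mem_map] at hv
    obtain ⟨w, hw, rfl⟩ := hv
    exact hx w hw
  · rw [Finset.card_map]
    have hker : ∀ x, x ∈ φ.ker ↔ x ∈ U.dbl S ∨ U.mk a (ne_zero_of_nsq ha) haS + x ∈ U.dbl S := by
      intro x
      constructor
      · intro hx
        rw [U.mem_dbl, U.mem_dbl, U.val_add, U.val_mk]
        by_contra hc
        push Not at hc
        obtain ⟨v, hv, hl, hnl⟩ := exists_split_nonlsq ha haS (fun v hv => x.val_ord hv) hc.1 hc.2
        have := h2 x (fun i hi => by
          rw [← h4 x ⟨i, hi⟩, AddMonoidHom.mem_ker.1 hx]; rfl) ⟨v, hv, hl⟩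
        rw [U.rh_apply] at this
        exact hnl ((Place.lsq_iff x.val_ne).2 ⟨Place.o_unit (x.val_ord hv), this⟩)
      · intro hx
        rw [AddMonoidHom.mem_ker]
        ext t
        rw [h4, U.rh_apply]
        rw [U.mem_dbl, U.mem_dbl, U.val_add, U.val_mk] at hx
        rcases hx with ⟨y, hy⟩ | ⟨y, hy⟩
        · rw [hy, ← sq]
          refine Place.r_sq ?_
          rintro rfl; exact x.val_ne (by simpa using hy)
        · apply Place.r_lsq
          refine Place.lsq_cancel t.1.2.2 ?_
          rw [hy, ← sq]
          refine Place.lsq_of_eq_sq ?_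
          rintro rfl; exact mul_ne_zero (ne_zero_of_nsq ha) x.val_ne (by simpa using hy)
    have e1 : (U.dbl S).relIndex φ.ker = 2 := by
      rw [AddSubgroup.relIndex_eq_two_iff_exists_notMem_and]
      refine ⟨U.mk a (ne_zero_of_nsq ha) haS, ?_, ?_, ?_⟩
      · rw [hker]; right; rw [← two_nsmul]; exact ⟨_, rfl⟩
      · rw [U.mem_dbl]; exact ha
      · intro b hb
        rw [hker] at hb
        rw [add_comm b]; exact hb.symm
    have e2 := AddSubgroup.relIndex_mul_index (H := U.dbl S) (K := φ.ker) (fun x hx => (hker x).2 (Or.inl hx))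
    rw [e1, AddSubgroup.index_ker, AddMonoidHom.range_eq_top.2 h3, AddSubgroup.card_top, iS] at e2
    have h2 : Nat.card (T → ZMod 2) = 2 ^ T.card := by simp
    rw [h2, ← pow_succ'] at e2
    exact (Nat.pow_right_injective le_rfl e2).ge

/-- no nontrivial `S ∪ T` unit is a local square on `S` -/
theorem sq_of_lsq [Glob K] [DecidableEq (Place K)] {S T : Finset (Place K)} (hS : Big S) (hTS : ∀ v ∈ T, v ∉ S)
    (hT : ∀ y : Place K → ZMod 2, ∃ x : U S, ∀ v ∈ T, v.r x.val = y v)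
    (b : U (S ∪ T)) (hb : ∀ v ∈ S, v.lsq b.val) : IsSquare b.val := by
  classical
  by_contra hns
  have lift : ∀ y : Place K → ZMod 2, ∃ x : K, x ≠ 0 ∧ (∀ v ∉ S, v.ord x = 0) ∧ ∀ v ∈ T, v.r x = y v := by
    intro y
    obtain ⟨x, hx⟩ := hT y
    exact ⟨x.val, x.val_ne, fun v hv => x.val_ord hv, hx⟩
  set T1 := (S ∪ T).filter fun v => ¬ v.lsq b.val with hT1
  have hT1T : ∀ v ∈ T1, v ∈ T ∧ v ∉ S ∧ ¬ v.lsq b.val := by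
    intro v hv
    rw [hT1, Finset.mem_filter, Finset.mem_union] at hv
    have : v ∈ T := hv.1.resolve_left fun h => hv.2 (hb v h)
    exact ⟨this, hTS v this, hv.2⟩
  have := norm_index_ph hns (hS.mono Finset.subset_union_left) (fun v hv => b.val_ord hv) T1 (surj_of_single _ ?_)
  · exact lt_irrefl _ this
  rintro ⟨t, ht⟩
  obtain ⟨htT, htS, htl⟩ := hT1T t ht
  have hsub : ∀ v : Place K, v ∉ S ∪ T → v ∉ S ∧ v ≠ t := by
    intro v hv
    rw [Finset.mem_union, not_or] at hv
    exact ⟨hv.1, fun h => hv.2 (h ▸ htT)⟩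
  rcases zmod2_cases (t.o b.val) with ho | ho
  · have hr : t.r b.val = 1 := by
      rw [Place.lsq_iff b.val_ne] at htl
      exact (zmod2_cases _).resolve_left fun h => htl ⟨ho, h⟩
    obtain ⟨x, hx0, hx1, hx⟩ := hS.2 t htS
    obtain ⟨y, hy0, hyS, hy⟩ := lift fun v => v.r x
    refine ⟨U.mk (x * y) (mul_ne_zero hx0 hy0) (fun v hv => by
      rw [v.ord_mul _ _ hx0 hy0, hx v (hsub v hv).1 (hsub v hv).2, hyS v (hsub v hv).1, add_zero]), ?_⟩
    ext ⟨w, hw⟩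
    obtain ⟨hwT, hwS, hwl⟩ := hT1T w hw
    rw [U.ph_apply, U.val_mk, Pi.single_apply]
    simp only [Subtype.mk.injEq]
    unfold Place.h
    rw [Place.o_mul hx0 hy0, Place.r_mul w.gd hx0 hy0, hy w hwT, CharTwo.add_self_eq_zero, Place.o_unit (hyS w hwS)]
    by_cases hwt : w = t
    · subst hwt
      rw [ho, hr, if_pos rfl]
      simp [Place.o, hx1]
    · rw [if_neg hwt, Place.o_unit (hx w hwS hwt)]; ring
  · obtain ⟨y, hy0, hyS, hy⟩ := lift fun v => if v = t then 1 else 0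
    refine ⟨U.mk y hy0 (fun v hv => hyS v (hsub v hv).1), ?_⟩
    ext ⟨w, hw⟩
    obtain ⟨hwT, hwS, hwl⟩ := hT1T w hw
    rw [U.ph_apply, U.val_mk, Pi.single_apply]
    simp only [Subtype.mk.injEq]
    unfold Place.h
    rw [hy w hwT, Place.o_unit (hyS w hwS)]
    by_cases hwt : w = t
    · subst hwt
      rw [ho, if_pos rfl]; ring
    · rw [if_neg hwt]; ring

open Classical in
/-- the main index-two statement -/
theorem index_two [Glob K] {a : K} (ha : ¬ IsSquare a) (Z : Finset (Place K)) :
    ∃ S : Finset (Place K), Z ⊆ S ∧ Big S ∧ (∀ v ∉ S, v.ord a = 0) ∧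
      (U.ph (S := S) (S.filter fun v => ¬ v.lsq a) a).range.index ≤ 2 ∧
      (U.ph (S := S) (S.filter fun v => ¬ v.lsq a) a).range.index ≠ 0 := by
  have ha0 := ne_zero_of_nsq ha
  obtain ⟨S, hZS, hS⟩ := exists_big (Z ∪ (fsupp a).toFinset)
  have haS : ∀ v ∉ S, v.ord a = 0 := by
    intro v hv
    by_contra hne
    exact hv (hZS (by simp [hne]))
  obtain ⟨T, hT1, hT2, hT3⟩ := exists_T ha hS haS
  have hB := hS.mono (T := S ∪ T) Finset.subset_union_left
  refine ⟨S ∪ T, fun v hv => Finset.mem_union_left _ (hZS (Finset.mem_union_left _ hv)), hB,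
    fun v hv => haS v (fun h => hv (Finset.mem_union_left _ h)), ?_⟩
  have hNS : ((S ∪ T).filter fun v => ¬ v.lsq a) = S.filter fun v => ¬ v.lsq a := by
    ext v
    simp only [Finset.mem_filter, Finset.mem_union]
    constructor
    · rintro ⟨h1 | h1, h2⟩
      · exact ⟨h1, h2⟩
      · exact absurd (hT1 v h1).2 h2
    · rintro ⟨h1, h2⟩; exact ⟨Or.inl h1, h2⟩
  rw [hNS]
  set NS := S.filter fun v => ¬ v.lsq a
  have hps : (U.ps (S := S ∪ T) S).ker = U.dbl (S ∪ T) := by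
    ext x
    rw [AddMonoidHom.mem_ker, U.mem_dbl]
    constructor
    · intro hx
      refine sq_of_lsq hS (fun v hv => (hT1 v hv).1) hT2 x fun v hv => ?_
      rw [Place.lsq_iff x.val_ne]
      have := congrFun hx ⟨v, hv⟩
      rw [U.ps_apply] at this
      exact ⟨congrArg Prod.fst this, congrArg Prod.snd this⟩
    · rintro ⟨y, hy⟩
      have hy0 : y ≠ 0 := by rintro rfl; exact x.val_ne (by simpa using hy)
      ext t
      · rw [U.ps_apply, hy, ← sq]; exact Place.o_sq hy0
      · rw [U.ps_apply, hy, ← sq]; exact Place.r_sq hy0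
  have c1 : Nat.card (U.ps (S := S ∪ T) S).range = 2 ^ (S.card + T.card) := by
    rw [← AddSubgroup.index_ker, hps, hB.1.index, Finset.card_union_of_disjoint]
    rw [Finset.disjoint_left]
    exact fun v h1 h2 => (hT1 v h2).1 h1
  have c2 := AddSubgroup.card_mul_index (U.ps (S := S ∪ T) S).range
  have c3 : Nat.card (S → ZMod 2 × ZMod 2) = 2 ^ (S.card + S.card) := by
    simp [pow_add, mul_pow]
    rw [← mul_pow]; norm_num
  rw [c1, c3] at c2
  have c4 : (U.ps (S := S ∪ T) S).range.index ≤ 2 := by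
    by_contra hc
    push Not at hc
    have : 2 ^ (S.card + T.card) * 2 < 2 ^ (S.card + S.card) := by
      rw [← c2]; gcongr
    rw [← pow_succ] at this
    have := (Nat.pow_lt_pow_iff_right (by norm_num)).1 this
    omega
  have c5 : (U.ps (S := S ∪ T) S).range.index ≠ 0 := by
    intro h
    rw [h, mul_zero] at c2
    exact (pow_ne_zero _ (two_ne_zero)) c2.symm
  let P : (S → ZMod 2 × ZMod 2) →+ (NS → ZMod 2) := AddMonoidHom.mk'
    (fun y t => t.1.o a * (y ⟨t.1, (Finset.mem_filter.1 t.2).1⟩).1 * t.1.r (-1) +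
      t.1.r a * (y ⟨t.1, (Finset.mem_filter.1 t.2).1⟩).1 + t.1.o a * (y ⟨t.1, (Finset.mem_filter.1 t.2).1⟩).2)
    (by intro x y; ext t; simp; ring)
  have hP : (U.ph (S := S ∪ T) NS a) = P.comp (U.ps S) := by
    ext x t
    rw [U.ph_apply]
    rfl
  have hPs : Function.Surjective P := by
    intro y
    choose c hc0 hc1 using fun v : NS => Place.exists_h_one v.1.gd ha0 (Finset.mem_filter.1 v.2).2
    refine ⟨fun v => if h : v.1 ∈ NS then (y ⟨v.1, h⟩ * v.1.o (c ⟨v.1, h⟩), y ⟨v.1, h⟩ * v.1.r (c ⟨v.1, h⟩)) else 0, ?_⟩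
    ext t
    simp only [P, AddMonoidHom.mk'_apply, t.2, dif_pos]
    have := hc1 t
    unfold Place.h at this
    linear_combination y t * this
  have hr : (U.ph (S := S ∪ T) NS a).range = (U.ps (S := S ∪ T) S).range.map P := by
    rw [hP, AddMonoidHom.range_comp]
  have hd := AddSubgroup.index_map_dvd (U.ps (S := S ∪ T) S).range hPs
  rw [← hr] at hd
  exact ⟨(Nat.le_of_dvd (Nat.pos_of_ne_zero c5) hd).trans c4, fun h => c5 (by rw [h] at hd; exact zero_dvd_iff.1 hd)⟩
end GFq

namespace GFq
universe u
variable {K : Type u} [Field K]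

theorem norm_add {a b : K} (p q p' q' : K) : (p ^ 2 - a * q ^ 2) * (p' ^ 2 - a * q' ^ 2) =
    (p * p' + a * q * q') ^ 2 - a * (p * q' + q * p') ^ 2 := by ring

/-- norm subgroup -/
noncomputable def U.nrm (S : Finset (Place K)) (a : K) : AddSubgroup (U S) where
  carrier := {x | ∃ p q : K, x.val = p ^ 2 - a * q ^ 2}
  zero_mem' := ⟨1, 0, by rw [U.val_zero]; ring⟩
  add_mem' := by
    rintro x y ⟨p, q, h⟩ ⟨p', q', h'⟩
    exact ⟨_, _, by rw [U.val_add, h, h', norm_add (b := 0)]⟩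
  neg_mem' := by
    rintro x ⟨p, q, h⟩
    refine ⟨p / x.val, q / x.val, ?_⟩
    have := x.val_ne
    rw [U.val_neg]
    field_simp
    exact h
theorem U.mem_nrm {S : Finset (Place K)} {a : K} {x : U S} : x ∈ U.nrm S a ↔ ∃ p q : K, x.val = p ^ 2 - a * q ^ 2 := Iff.rfl

theorem norm_of_sq (h2 : (2 : K) ≠ 0) {a : K} (ha0 : a ≠ 0) (ha : IsSquare a) (b : K) : ∃ p q : K, b = p ^ 2 - a * q ^ 2 := by
  obtain ⟨s, rfl⟩ := ha
  have hs : s ≠ 0 := by rintro rfl; simp at ha0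
  refine ⟨(b + 1) / 2, (b - 1) / (2 * s), ?_⟩
  field_simp
  ring

/-- Hasse norm theorem -/
theorem norm_of_h [Glob K] {a b : K} (ha0 : a ≠ 0) (hb0 : b ≠ 0) (h : ∀ v : Place K, v.h a b = 0) :
    ∃ p q : K, b = p ^ 2 - a * q ^ 2 := by
  classical
  by_cases ha : IsSquare a
  · exact norm_of_sq Glob.two ha0 ha b
  obtain ⟨S, hbS, hS, haS, hi, hi0⟩ := index_two ha (fsupp b).toFinset
  have hbS' : ∀ v ∉ S, v.ord b = 0 := by
    intro v hv
    by_contra hne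
    exact hv (hbS (by simp [hne]))
  set NS := S.filter fun v => ¬ v.lsq a
  set φ := U.ph (S := S) NS a
  have h1 := norm_index ha hS haS (U.nrm S a) (fun x hx => hx)
  have hle : U.nrm S a ≤ φ.ker := by
    rintro x ⟨p, q, hx⟩
    rw [AddMonoidHom.mem_ker]; ext t
    rw [U.ph_apply, hx]
    exact Place.h_norm t.1.gd ha0 (hx ▸ x.val_ne)
  have h2 := AddSubgroup.card_mul_index φ.range
  have h3 : Nat.card (NS → ZMod 2) = 2 ^ NS.card := by simp
  rw [← AddSubgroup.index_ker, h3] at h2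
  have h4 := AddSubgroup.relIndex_mul_index hle
  have h5 : (U.nrm S a).relIndex φ.ker ≤ 1 := by
    have k0 : 0 < φ.ker.index := Nat.pos_of_ne_zero fun h => by
      rw [h, zero_mul] at h2; exact (pow_ne_zero _ two_ne_zero) h2.symm
    rw [← h2, ← h4] at h1
    nlinarith
  have h6 : (U.nrm S a).relIndex φ.ker ≠ 0 := by
    have hd : U.dbl S ≤ U.nrm S a := by
      intro x hx
      rw [U.mem_dbl] at hx
      obtain ⟨y, hy⟩ := hx
      exact ⟨y, 0, by rw [hy]; ring⟩
    intro h0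
    rw [h0, zero_mul] at h4
    have := AddSubgroup.index_dvd_of_le hd
    rw [← h4, hS.1.index, zero_dvd_iff] at this
    exact (pow_ne_zero _ two_ne_zero) this
  have h7 : (U.nrm S a).relIndex φ.ker = 1 := by omega
  rw [AddSubgroup.relIndex_eq_one] at h7
  have := h7 (x := U.mk b hb0 hbS') (by
    rw [AddMonoidHom.mem_ker]; ext t
    rw [U.ph_apply]; exact h _)
  exact this

theorem exists_two [Glob K] {a : K} (ha : ¬ IsSquare a) {v0 v1 : Place K} (hne : v0 ≠ v1)
    (h0 : ¬ v0.lsq a) (h1 : ¬ v1.lsq a) : ∃ x : K, x ≠ 0 ∧ (∃ v : Place K, v.h a x = 1) ∧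
      ∀ v : Place K, v.h a x = 1 → v = v0 ∨ v = v1 := by
  classical
  obtain ⟨S, hbS, hS, haS, hi, hi0⟩ := index_two ha {v0, v1}
  set NS := S.filter fun v => ¬ v.lsq a
  set φ := U.ph (S := S) NS a
  have m0 : v0 ∈ NS := Finset.mem_filter.2 ⟨hbS (by simp), h0⟩
  have m1 : v1 ∈ NS := Finset.mem_filter.2 ⟨hbS (by simp), h1⟩
  let e0 : NS → ZMod 2 := Pi.single ⟨v0, m0⟩ 1
  let e1 : NS → ZMod 2 := Pi.single ⟨v1, m1⟩ 1
  have key : ∃ e ∈ φ.range, (e = e0 ∨ e = e1 ∨ e = e0 + e1) := by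
    by_cases hc : φ.range.index = 1
    · rw [AddSubgroup.index_eq_one] at hc
      exact ⟨e0, by rw [hc]; trivial, Or.inl rfl⟩
    · have h2 : φ.range.index = 2 := by omega
      have := AddSubgroup.add_mem_iff_of_index_two h2 (a := e0) (b := e1)
      by_cases k0 : e0 ∈ φ.range
      · exact ⟨_, k0, Or.inl rfl⟩
      by_cases k1 : e1 ∈ φ.range
      · exact ⟨_, k1, Or.inr (Or.inl rfl)⟩
      exact ⟨_, this.2 (by tauto), Or.inr (Or.inr rfl)⟩
  obtain ⟨e, ⟨x, hx⟩, he⟩ := key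
  have hxv : ∀ v (hv : v ∈ NS), v.h a x.val = e ⟨v, hv⟩ := by
    intro v hv; rw [← hx]; rfl
  have hne' : (⟨v0, m0⟩ : NS) ≠ ⟨v1, m1⟩ := fun h => hne (congrArg Subtype.val h)
  refine ⟨x.val, x.val_ne, ?_, ?_⟩
  · rcases he with rfl | rfl | rfl
    · exact ⟨v0, by rw [hxv v0 m0]; simp [e0]⟩
    · exact ⟨v1, by rw [hxv v1 m1]; simp [e1]⟩
    · refine ⟨v0, ?_⟩
      rw [hxv v0 m0, Pi.add_apply]
      simp only [e0, e1]
      rw [Pi.single_eq_same, Pi.single_eq_of_ne hne', add_zero]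
  · intro v hv
    by_cases hvN : v ∈ NS
    · rw [hxv v hvN] at hv
      by_contra hc
      push Not at hc
      have n0 : (⟨v, hvN⟩ : NS) ≠ ⟨v0, m0⟩ := fun h => hc.1 (congrArg Subtype.val h)
      have n1 : (⟨v, hvN⟩ : NS) ≠ ⟨v1, m1⟩ := fun h => hc.2 (congrArg Subtype.val h)
      rcases he with rfl | rfl | rfl
      · simp only [e0] at hv; rw [Pi.single_eq_of_ne n0] at hv; exact absurd hv (by decide)
      · simp only [e1] at hv; rw [Pi.single_eq_of_ne n1] at hv; exact absurd hv (by decide)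
      · simp only [e0, e1, Pi.add_apply] at hv; rw [Pi.single_eq_of_ne n0, Pi.single_eq_of_ne n1] at hv
        exact absurd hv (by decide)
    · exfalso
      by_cases hvS : v ∈ S
      · have : v.lsq a := by
          by_contra h; exact hvN (Finset.mem_filter.2 ⟨hvS, h⟩)
        rw [Place.h_lsq_left this] at hv
        exact absurd hv (by decide)
      · unfold Place.h at hv
        rw [Place.o_unit (haS v hvS), Place.o_unit (x.val_ord hvS)] at hv
        simp at hv
end GFq

namespace GFq
universe u
variable {K : Type u} [Field K]

theorem h_aux : ∀ oa ra ob rb od rd e : ZMod 2, ¬ (od = 0 ∧ rd = 0) →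
   (oa * ob * e + ra * ob + oa * rb = 0) ∨ (oa * (ob + od) * e + ra * (ob + od) + oa * (rb + rd) = 0) ∨
   ((oa + od) * ob * e + (ra + rd) * ob + (oa + od) * rb = 0) ∨
   ((oa + od) * (ob + od) * e + (ra + rd) * (ob + od) + (oa + od) * (rb + rd) = 0) := by decide

theorem Quad.h_zero_of_nonlsq {L : Type*} [Field L] [Algebra K L] {d : K} (Q : Quad K L d) {w : Place L} {v : Place K}
    (h : w.Over v) (hv : v.Good) (hw : w.Good) (hd : ¬ v.lsq d) {a b : K} (ha : a ≠ 0) (hb : b ≠ 0) :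
    w.h (algebraMap K L a) (algebraMap K L b) = 0 := by
  have hd0 := Q.a_ne
  have had := mul_ne_zero ha hd0
  have hbd := mul_ne_zero hb hd0
  have ha' : algebraMap K L a ≠ 0 := by simpa using ha
  have hb' : algebraMap K L b ≠ 0 := by simpa using hb
  have hd' : algebraMap K L d ≠ 0 := by simpa using hd0
  rw [Place.lsq_iff hd0] at hd
  have e1 : ∀ x : L, w.h x (algebraMap K L (b * d)) = w.h x (algebraMap K L b) := by
    intro x
    rw [map_mul, Place.h_mul_right hw hb' hd', Place.h_lsq_right (Q.lsq_a w), add_zero]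
  have e2 : ∀ x : L, w.h (algebraMap K L (a * d)) x = w.h (algebraMap K L a) x := by
    intro x
    rw [map_mul, Place.h_mul_left hw ha' hd', Place.h_lsq_left (Q.lsq_a w), add_zero]
  rcases h_aux (v.o a) (v.r a) (v.o b) (v.r b) (v.o d) (v.r d) (v.r (-1)) hd with h1 | h1 | h1 | h1
  · exact h.h_zero hv hw ha hb h1
  · rw [← Place.o_mul hb hd0, ← Place.r_mul hv hb hd0] at h1
    rw [← e1]; exact h.h_zero hv hw ha hbd h1
  · rw [← Place.o_mul ha hd0, ← Place.r_mul hv ha hd0] at h1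
    rw [← e2]; exact h.h_zero hv hw had hb h1
  · rw [← Place.o_mul hb hd0, ← Place.r_mul hv hb hd0, ← Place.o_mul ha hd0, ← Place.r_mul hv ha hd0] at h1
    rw [← e1, ← e2]; exact h.h_zero hv hw had hbd h1

/-- Hasse principle in dimension four -/
theorem hasse4 [Glob K] {a b d : K} (ha : a ≠ 0) (hb : b ≠ 0) (hd : d ≠ 0)
    (H : ∀ x0 x1 x2 x3 : K, x0 ^ 2 - a * x1 ^ 2 - b * x2 ^ 2 + a * b * d * x3 ^ 2 = 0 →
      x0 = 0 ∧ x1 = 0 ∧ x2 = 0 ∧ x3 = 0) : ∃ v : Place K, v.lsq d ∧ v.h a b = 1 := by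
  by_contra hc
  push Not at hc
  by_cases hds : IsSquare d
  · obtain ⟨s, hs⟩ := hds
    have hs0 : s ≠ 0 := by rintro rfl; exact hd (by simpa using hs)
    obtain ⟨p, q, hpq⟩ := norm_of_h ha hb (fun v => (zmod2_cases _).resolve_right
      (hc v (by rw [hs, ← sq]; exact Place.lsq_of_eq_sq hs0)))
    exact one_ne_zero (H p q 1 0 (by rw [hpq]; ring)).2.2.1
  · obtain ⟨L, _, _, ⟨Q⟩⟩ := exists_quad hds
    have := Q.fd
    have : Glob L := Glob.of_finite (K := K)
    have ha' : algebraMap K L a ≠ 0 := by simpa using ha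
    have hb' : algebraMap K L b ≠ 0 := by simpa using hb
    obtain ⟨P, R, hPR⟩ := norm_of_h ha' hb' (fun w => by
      obtain ⟨v, hv⟩ := w.exists_under (K := K)
      by_cases hl : v.lsq d
      · exact hv.h_zero v.gd w.gd ha hb ((zmod2_cases _).resolve_right (hc v hl))
      · exact Q.h_zero_of_nonlsq hv v.gd w.gd hl ha hb)
    obtain ⟨p, p', rfl⟩ := Q.span P
    obtain ⟨r, r', rfl⟩ := Q.span R
    have hθ : ∀ c : K, algebraMap K L c ≠ Q.θ := fun c hc => Q.nsq ⟨c, (algebraMap K L).injective (by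
      rw [← Q.sq, ← hc, map_mul]; ring)⟩
    have h2 : (2 : K) ≠ 0 := Glob.two
    have hE : algebraMap K L (b - (p ^ 2 + d * p' ^ 2 - a * (r ^ 2 + d * r' ^ 2))) =
        algebraMap K L (2 * (p * p' - a * r * r')) * Q.θ := by
      simp only [map_sub, map_add, map_mul, map_pow, map_ofNat, ← Q.sq, hPR]; ring
    have hO : p * p' - a * r * r' = 0 := by
      by_contra hne
      apply hθ ((b - (p ^ 2 + d * p' ^ 2 - a * (r ^ 2 + d * r' ^ 2))) / (2 * (p * p' - a * r * r')))
      rw [map_div₀, div_eq_iff ((map_ne_zero _).2 (mul_ne_zero h2 hne)), hE]; ring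
    rw [hO, mul_zero, map_zero, zero_mul, map_eq_zero] at hE
    have hq := H (a * b * (-r')) (-b * p') (-a * (p * r' - r * p')) (p' ^ 2 - a * r' ^ 2) (by
      have : b = p ^ 2 + d * p' ^ 2 - a * (r ^ 2 + d * r' ^ 2) := by linear_combination hE
      linear_combination (a * b) * (p' ^ 2 - a * r' ^ 2) * hE * (-1) - a * b * (p * p' - a * r * r') * hO)
    have hq' := H p' r' 0 0 (by linear_combination hq.2.2.2)
    have := H p r 1 0 (by rw [hq'.1, hq'.2.1] at hE; linear_combination -hE)
    exact one_ne_zero this.2.2.1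
end GFq

namespace GFq
universe u
variable {K : Type u} [Field K]

theorem Place.h_zero_iff {v : Place K} (hv : v.Good) {a b : K} (ha : a ≠ 0) (hb : b ≠ 0) :
    v.h a b = 0 ↔ ∃ x y : K, x ^ 2 - a * y ^ 2 ≠ 0 ∧ v.lsq (b * (x ^ 2 - a * y ^ 2)) := by
  constructor
  · exact exists_norm_loc hv ha hb
  · rintro ⟨x, y, h1, h2⟩
    have := h_lsq_right (a := a) h2
    rwa [h_mul_right hv hb h1, h_norm hv ha h1, add_zero] at this

theorem zmod2_eq {x y : ZMod 2} (h : x = 0 ↔ y = 0) : x = y := by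
  revert x y; decide

namespace Quad
variable {L : Type*} [Field L] [Algebra K L] {d : K} (Q : Quad K L d)

theorem h_conj {w : Place L} (hw : w.Good) (hw' : (Q.conj w).Good) {a b : L} (ha : a ≠ 0) (hb : b ≠ 0) :
    (Q.conj w).h a b = w.h (Q.σ a) (Q.σ b) := by
  apply zmod2_eq
  rw [Place.h_zero_iff hw' ha hb, Place.h_zero_iff hw (Q.σ_ne ha) (Q.σ_ne hb)]
  constructor
  · rintro ⟨x, y, h1, h2⟩
    refine ⟨Q.σ x, Q.σ y, ?_, ?_⟩
    · simpa using Q.σ_ne h1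
    · rw [conj_lsq] at h2; simpa using h2
  · rintro ⟨x, y, h1, h2⟩
    refine ⟨Q.σ x, Q.σ y, ?_, ?_⟩
    · have := Q.σ_ne h1
      simpa [Q.σσ] using this
    · rw [conj_lsq]; simpa [Q.σσ] using h2

theorem h_split {w : Place L} {v : Place K} (h : w.Over v) (hw : w.Good) (hv : v.Good) (hne : w ≠ Q.conj w) {a b : K}
    (ha : a ≠ 0) (hb : b ≠ 0) : w.h (algebraMap K L a) (algebraMap K L b) = v.h a b := by
  have ha' : algebraMap K L a ≠ 0 := by simpa using ha
  have hb' : algebraMap K L b ≠ 0 := by simpa using hb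
  apply zmod2_eq
  refine ⟨fun h0 => ?_, h.h_zero hv hw ha hb⟩
  obtain ⟨X, Y, h1, h2⟩ := (Place.h_zero_iff hw ha' hb').1 h0
  -- approximate
  have key : ∀ (n m : ℤ), ∃ x y : K, w.ge (algebraMap K L x ^ 2 - X ^ 2) n ∧ w.ge (algebraMap K L y ^ 2 - Y ^ 2) m := by
    have sq1 : ∀ (n : ℤ) (X : L), ∃ x : K, w.ge (algebraMap K L x ^ 2 - X ^ 2) n := by
      intro n X
      obtain ⟨k, hk⟩ : ∃ k : ℤ, w.ge X k := ⟨w.ord X, Place.ge_self⟩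
      obtain ⟨x, hx⟩ := Q.split_approx hw hne X (max k (n - k))
      refine ⟨x, ?_⟩
      have e : algebraMap K L x ^ 2 - X ^ 2 = (algebraMap K L x - X) * ((algebraMap K L x - X) + (X + X)) := by ring
      rw [e]
      have := (hx.mono (le_max_right k (n - k))).mul ((hx.mono (le_max_left k (n - k))).add (hk.add hk))
      exact this.mono (by omega)
    intro n m
    obtain ⟨x, hx⟩ := sq1 n X
    obtain ⟨y, hy⟩ := sq1 m Y
    exact ⟨x, y, hx, hy⟩
  set M := X ^ 2 - algebraMap K L a * Y ^ 2 with hM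
  obtain ⟨x, y, hx, hy⟩ := key (w.ord M + 1) (w.ord M + 1 - w.ord (algebraMap K L a))
  have hc : w.ge (algebraMap K L (x ^ 2 - a * y ^ 2) - M) (w.ord M + 1) := by
    have e : algebraMap K L (x ^ 2 - a * y ^ 2) - M = (algebraMap K L x ^ 2 - X ^ 2) -
        algebraMap K L a * (algebraMap K L y ^ 2 - Y ^ 2) := by
      simp only [map_sub, map_mul, map_pow, hM]; ring
    rw [e]
    refine hx.sub ?_
    have := Place.ge.mul (v := w) (x := algebraMap K L a) Place.ge_self hy
    exact this.mono (by omega)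
  have hm := Place.ord_eq_of_sub h1 hc
  have hm0 : x ^ 2 - a * y ^ 2 ≠ 0 := fun h => hm.1 (by rw [h, map_zero])
  have hl := Place.lsq_of_close h1 hc
  rw [Place.h_zero_iff hv ha hb]
  refine ⟨x, y, hm0, Q.lsq_of_split h hw hne ?_⟩
  have h3 := Place.lsq_mul h2 hl
  have e : algebraMap K L b * M * (M * algebraMap K L (x ^ 2 - a * y ^ 2)) = algebraMap K L (b * (x ^ 2 - a * y ^ 2)) * M ^ 2 := by
    rw [map_mul]; ring
  rwa [e, Place.lsq_mul_sq h1] at h3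

theorem proj_split {w : Place L} {v : Place K} (h : w.Over v) (hw : w.Good) (hw' : (Q.conj w).Good) (hv : v.Good) (hne : w ≠ Q.conj w) {a : K}
    (ha : a ≠ 0) {z : L} (hz : z ≠ 0) :
    v.h a (Q.N z) = w.h (algebraMap K L a) z + (Q.conj w).h (algebraMap K L a) z := by
  have ha' : algebraMap K L a ≠ 0 := by simpa using ha
  rw [← Q.h_split h hw hv hne ha (Q.N_ne hz), Q.N_spec, Place.h_mul_right hw hz (Q.σ_ne hz), Q.h_conj hw hw' ha' hz, Q.σK]

theorem lsq_unit_inert (Q : Quad K L d) {w : Place L} {v : Place K} (h : w.Over v) (hv : v.Good) (hd : v.ord d = 0) (hdl : ¬ v.lsq d)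
    {x : K} (hx0 : x ≠ 0) (hx : v.ord x = 0) : w.lsq (algebraMap K L x) := by
  by_cases hl : v.lsq x
  · exact h.lsq hl
  · have := h.lsq (Place.unit_nonlsq_mul hv Q.a_ne hx0 hd hx hdl hl)
    rw [map_mul] at this
    exact Place.lsq_cancel (Q.lsq_a w) this

theorem lsq_inert {w : Place L} {v : Place K} (h : w.Over v) (hv : v.Good) (hc : Q.conj w = w) (hd : v.ord d = 0) (hdl : ¬ v.lsq d)
    {u : L} (hu0 : u ≠ 0) (hu : w.ord u = 0) : w.lsq u ↔ v.lsq (Q.N u) := by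
  have hσ : ∀ z n, w.ge z n → w.ge (Q.σ z) n := by
    intro z n hz
    rw [← Q.conj_ge, hc]; exact hz
  constructor
  · rintro ⟨y, hy0, hy⟩
    refine ⟨Q.N y, Q.N_ne hy0, h.ge_one_iff.1 ?_⟩
    have e : algebraMap K L (Q.N u * Q.N y ^ 2 - 1) = (u * y ^ 2 - 1) * Q.σ (u * y ^ 2 - 1) + (u * y ^ 2 - 1) + Q.σ (u * y ^ 2 - 1) := by
      simp only [map_sub, map_mul, map_pow, Q.N_spec, map_one]; ring
    rw [e]
    exact (((hy.mul (hσ _ _ hy)).mono (by norm_num)).add hy).add (hσ _ _ hy)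
  · rintro ⟨y, hy0, hy⟩
    have hy0' : algebraMap K L y ≠ 0 := by simpa using hy0
    have h1 := h.ge_one_iff.2 hy
    set ζ := u * algebraMap K L y with hζ
    have hζ0 : ζ ≠ 0 := mul_ne_zero hu0 hy0'
    have e1 : algebraMap K L (Q.N u * y ^ 2 - 1) = ζ * Q.σ ζ - 1 := by
      simp only [hζ, map_sub, map_mul, map_pow, Q.N_spec, map_one, Q.σK]; ring
    rw [e1] at h1
    have h2 := (Place.unit_of_sub_one le_rfl h1).2
    rw [w.ord_mul _ _ hζ0 (Q.σ_ne hζ0), ← Q.conj_ord, hc] at h2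
    have h3 : w.ord ζ = 0 := by omega
    suffices hs : w.lsq ζ by
      have : w.lsq (ζ * algebraMap K L y) := by
        rw [hζ, mul_assoc, ← pow_two, Place.lsq_mul_sq hy0', ]
        have hyy : w.lsq (algebraMap K L y) := Q.lsq_unit_inert h hv hd hdl hy0 (by
          rw [hζ, w.ord_mul _ _ hu0 hy0', hu, zero_add] at h3
          exact h.ord_zero_iff.1 h3)
        rw [hζ, mul_comm] at hs
        exact Place.lsq_cancel hyy hs
      rwa [hζ, mul_assoc, ← pow_two, Place.lsq_mul_sq hy0'] at this
    have neg1 : w.lsq (-1 : L) := by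
      have := Q.lsq_unit_inert h hv hd hdl (x := -1) (by simp) (v.ord_neg_one)
      simpa using this
    by_cases hs : w.ge (1 + ζ) 1
    · have : w.lsq (-1 * ζ) := Place.lsq_of_sub_one le_rfl (by
        have e : -1 * ζ - 1 = -(1 + ζ) := by ring
        rw [e]; exact hs.neg)
      exact Place.lsq_cancel neg1 this
    · obtain ⟨s, hsdef⟩ : ∃ s, s = 1 + ζ := ⟨_, rfl⟩
      rw [← hsdef] at hs
      have hge0 : w.ge s 0 := by rw [hsdef]; exact Place.ge.add Place.ge_one (Place.ge_of_ord h3.ge)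
      have hs0 : s ≠ 0 := by rintro rfl; exact hs (Or.inl rfl)
      have hso : w.ord s = 0 := by
        have := hge0.le hs0
        by_contra hne
        exact hs (Or.inr (by omega))
      have hNs : w.lsq (algebraMap K L (Q.N s)) := Q.lsq_unit_inert h hv hd hdl (Q.N_ne hs0) (by
        rw [← h.ord_zero_iff, Q.ord_N hs0, hc, hso]; rfl)
      refine Place.lsq_cancel hNs ⟨s⁻¹, inv_ne_zero hs0, ?_⟩
      have e : algebraMap K L (Q.N s) * ζ * s⁻¹ ^ 2 - 1 = s⁻¹ * (ζ * Q.σ ζ - 1) := by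
        rw [Q.N_spec]
        have : Q.σ s = 1 + Q.σ ζ := by rw [hsdef, map_add, map_one]
        rw [this]
        field_simp
        rw [hsdef]; ring
      rw [e]
      exact Place.ge.mul0' (Place.ge_of_ord (by rw [w.ord_inv, hso]; rfl)) h1

theorem proj_inert {w : Place L} {v : Place K} (h : w.Over v) (hw : w.Good) (hv : v.Good) (hd : v.ord d = 0) (hdl : ¬ v.lsq d)
    {a : K} (ha : a ≠ 0) {z : L} (hz : z ≠ 0) : v.h a (Q.N z) = w.h (algebraMap K L a) z := by
  have ha' : algebraMap K L a ≠ 0 := by simpa using ha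
  have hc : Q.conj w = w := by
    by_contra hne
    exact hdl (Q.lsq_of_ne_conj h hw (Ne.symm hne))
  have he := Q.e_one_of_unit h hw hd
  obtain ⟨x, hx0, hx⟩ := v.exists_ord (w.ord z)
  have hx0' : algebraMap K L x ≠ 0 := by simpa using hx0
  obtain ⟨u, hu⟩ : ∃ u, z = algebraMap K L x * u := ⟨z / algebraMap K L x, by field_simp⟩
  have hu0 : u ≠ 0 := by rintro rfl; exact hz (by simpa using hu)
  have huo : w.ord u = 0 := by
    have := congrArg w.ord hu
    rw [w.ord_mul _ _ hx0' hu0, he, hx] at this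
    omega
  have hNx : Q.N (algebraMap K L x) = x ^ 2 := (algebraMap K L).injective (by
    rw [Q.N_spec, Q.σK, map_pow, pow_two])
  have hNu : v.ord (Q.N u) = 0 := by
    rw [← h.ord_zero_iff, Q.ord_N hu0, hc, huo]; rfl
  have hN0 := Q.N_ne hu0
  rw [hu, Q.N_mul, hNx, Place.h_mul_right hv (pow_ne_zero _ hx0) hN0, Place.h_lsq_right (Place.lsq_of_eq_sq hx0),
    Place.h_mul_right hw hx0' hu0, Q.h_zero_of_nonlsq h hv hw hdl ha hx0]
  congr 1
  have ho : w.o (algebraMap K L a) = v.o a := by unfold Place.o; rw [he]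
  have hr : w.r u = v.r (Q.N u) := by
    apply zmod2_eq
    have := Q.lsq_inert h hv hc hd hdl hu0 huo
    rw [Place.lsq_iff hu0, Place.lsq_iff hN0, Place.o_unit huo, Place.o_unit hNu] at this
    simpa using this
  unfold Place.h
  rw [ho, hr, Place.o_unit huo, Place.o_unit hNu]
  ring
end Quad

/-- changing the slot -/
theorem slot [Glob K] {a b e : K} (ha : a ≠ 0) (hb : b ≠ 0) (he : e ≠ 0)
    (h : ∀ v : Place K, v.h a b = 1 → ¬ v.lsq e) :
    (∃ x y z : K, e = a * x ^ 2 + b * y ^ 2 - a * b * z ^ 2) := by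
  have h2 : (2 : K) ≠ 0 := Glob.two
  by_contra hc
  push Not at hc
  obtain ⟨v, hv1, hv2⟩ := hasse4 ha hb he (by
    intro x0 x1 x2 x3 hx
    by_cases h3 : x3 = 0
    · subst h3
      by_contra hne
      -- isotropic ternary form represents everything
      have hiso : x0 ^ 2 - a * x1 ^ 2 - b * x2 ^ 2 = 0 := by linear_combination hx
      have hm : a * (b * x2) ^ 2 + b * (a * x1) ^ 2 - a * b * x0 ^ 2 = 0 := by linear_combination -a * b * hiso
      have : ∃ p q r : K, 2 * (a * (b * x2) * p + b * (a * x1) * q - a * b * x0 * r) = 1 := by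
        by_cases k0 : x0 = 0
        · by_cases k1 : x1 = 0
          · have k2 : x2 ≠ 0 := by tauto
            exact ⟨1 / (2 * (a * (b * x2))), 0, 0, by field_simp; simp [k0]⟩
          · exact ⟨0, 1 / (2 * (b * (a * x1))), 0, by field_simp; simp [k0]⟩
        · exact ⟨0, 0, - 1 / (2 * (a * b * x0)), by field_simp; simp⟩
      obtain ⟨p, q, r, hpqr⟩ := this
      set g := a * p ^ 2 + b * q ^ 2 - a * b * r ^ 2 with hg
      refine hc ((e - g) * (b * x2) + p) ((e - g) * (a * x1) + q) ((e - g) * x0 + r) ?_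
      linear_combination (-(e - g) ^ 2) * hm - (e - g) * hpqr - hg
    · exfalso
      refine hc (x2 / (a * x3)) (x1 / (b * x3)) (x0 / (a * b * x3)) ?_
      field_simp
      linear_combination hx)
  exact h v hv2 hv1

theorem slot' [Glob K] {a b e : K} (ha : a ≠ 0) (hb : b ≠ 0) (he : e ≠ 0)
    (h : ∀ v : Place K, v.h a b = 1 → ¬ v.lsq e) :
    ∃ c : K, c ≠ 0 ∧ ∀ v : Place K, v.h e c = v.h a b := by
  obtain ⟨x, y, z, hxyz⟩ := slot ha hb he h
  by_cases hn : y ^ 2 - a * z ^ 2 = 0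
  · have e1 : e = a * x ^ 2 := by linear_combination hxyz + b * hn
    have hx : x ≠ 0 := by rintro rfl; exact he (by simpa using e1)
    refine ⟨b, hb, fun v => ?_⟩
    rw [e1, Place.h_mul_left v.gd ha (pow_ne_zero _ hx), Place.h_lsq_left (Place.lsq_of_eq_sq hx), add_zero]
  set B := b * (y ^ 2 - a * z ^ 2) with hB
  have hB0 : B ≠ 0 := mul_ne_zero hb hn
  have hhB : ∀ v : Place K, v.h a B = v.h a b := fun v => by
    rw [hB, Place.h_mul_right v.gd hb hn, Place.h_norm v.gd ha hn, add_zero]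
  have e1 : e = a * x ^ 2 + B := by rw [hB]; linear_combination hxyz
  by_cases hx : x = 0
  · refine ⟨a, ha, fun v => ?_⟩
    rw [e1, hx, Place.h_comm, ← hhB]; simp
  refine ⟨-(a * B), neg_ne_zero.2 (mul_ne_zero ha hB0), fun v => ?_⟩
  have hA0 : a * x ^ 2 / e ≠ 0 := div_ne_zero (mul_ne_zero ha (pow_ne_zero _ hx)) he
  have hA1 : 1 - a * x ^ 2 / e = B / e := by field_simp; rw [e1]; ring
  have hA2 : 1 - a * x ^ 2 / e ≠ 0 := by rw [hA1]; exact div_ne_zero hB0 he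
  have hst := Place.steinberg v.gd hA0 hA2
  have r1 : a * x ^ 2 / e = (a * e) * (x / e) ^ 2 := by field_simp
  have r2 : B / e = (B * e) * (1 / e) ^ 2 := by field_simp
  have hxe : x / e ≠ 0 := div_ne_zero hx he
  have h1e : 1 / e ≠ 0 := div_ne_zero one_ne_zero he
  rw [hA1, r1, r2, Place.h_mul_left v.gd (mul_ne_zero ha he) (pow_ne_zero _ hxe), Place.h_lsq_left (Place.lsq_of_eq_sq hxe), add_zero,
    Place.h_mul_right v.gd (mul_ne_zero hB0 he) (pow_ne_zero _ h1e), Place.h_lsq_right (Place.lsq_of_eq_sq h1e), add_zero,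
    Place.h_mul_left v.gd ha he, Place.h_mul_right v.gd hB0 he, Place.h_mul_right v.gd hB0 he, hhB] at hst
  have hee := Place.h_neg_self v.gd he
  rw [← neg_one_mul, Place.h_mul_right v.gd (by simp) he] at hee
  rw [← neg_one_mul, Place.h_mul_right v.gd (by simp) (mul_ne_zero ha hB0), Place.h_mul_right v.gd ha hB0, Place.h_comm e a]
  generalize v.h a b = t1 at *
  generalize v.h a e = t2 at *
  generalize v.h e B = t3 at *
  generalize v.h e e = t4 at *
  generalize v.h e (-1) = t5 at *
  revert hst hee
  revert t1 t2 t3 t4 t5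
  decide
end GFq

namespace GFq
universe u

theorem ringChar_ne_two {F : Type*} [Field F] (h : (2 : F) ≠ 0) : ringChar F ≠ 2 := fun hc => h (by
  have := ringChar.Nat.cast_ringChar (R := F)
  rw [hc] at this
  exact_mod_cast this)

section
variable {K : Type u} [Field K]

/-- parity of the degree -/
theorem r_const {k : Type*} [Field k] [Algebra k K] [Finite k] [hk : GF k K] (h2 : (2 : k) ≠ 0) {ε : k} (hε : ¬ IsSquare ε)
    (v : Place K) : v.r (algebraMap k K ε) = (v.deg k : ZMod 2) := by
  classical
  have := Fintype.ofFinite k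
  have := finite_κ (Fq := k) v
  have := Fintype.ofFinite v.κ
  have hε0 : ε ≠ 0 := by rintro rfl; exact hε ⟨0, by simp⟩
  have hε0' : algebraMap k K ε ≠ 0 := by simpa using hε0
  have ho := ord_const v ε
  have h2κ : (2 : v.κ) ≠ 0 := by
    have : (2 : v.κ) = algebraMap k v.κ 2 := by rw [map_ofNat]
    rw [this]; exact (map_ne_zero _).2 h2
  have hc1 := ringChar_ne_two h2
  have hc2 := ringChar_ne_two h2κ
  apply zmod2_eq
  have e1 : v.r (algebraMap k K ε) = 0 ↔ v.lsq (algebraMap k K ε) := by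
    rw [Place.lsq_iff hε0', Place.o_unit ho]; simp
  rw [e1, Place.lsq_unit_iff hε0' ho]
  have e2 : v.res (algebraMap k K ε) (Place.ge_of_ord ho.ge) = algebraMap k v.κ ε := rfl
  have e3 : algebraMap k v.κ ε ≠ 0 := (map_ne_zero _).2 hε0
  rw [e2, FiniteField.isSquare_iff hc2 e3]
  have e4 : ε ^ (Fintype.card k / 2) = -1 := by
    rcases FiniteField.pow_dichotomy hc1 hε0 with h | h
    · exact absurd ((FiniteField.isSquare_iff hc1 hε0).2 h) hε
    · exact h
  obtain ⟨e, he⟩ : Odd (Fintype.card k) := Nat.odd_iff.2 (FiniteField.odd_card_of_char_ne_two hc1)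
  have hcard : Fintype.card v.κ = Fintype.card k ^ v.deg k := by
    have := card_κ (Fq := k) v
    simpa [Nat.card_eq_fintype_card] using this
  have hS : Fintype.card v.κ / 2 = (Fintype.card k / 2) * ∑ i ∈ Finset.range (v.deg k), Fintype.card k ^ i := by
    have := geom_sum_mul_add (2 * e) (v.deg k)
    rw [hcard, he, ← this]
    have h3 : (2 * e + 1) / 2 = e := by omega
    rw [h3]
    rw [show (∑ i ∈ Finset.range (v.deg k), (2 * e + 1) ^ i) * (2 * e) + 1 = 2 * (e * (∑ i ∈ Finset.range (v.deg k), (2 * e + 1) ^ i)) + 1 by ring]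
    omega
  rw [hS, pow_mul, ← map_pow, e4, map_neg, map_one]
  have h4 : ((∑ i ∈ Finset.range (v.deg k), Fintype.card k ^ i : ℕ) : ZMod 2) = (v.deg k : ZMod 2) := by
    have h5 : (Fintype.card k : ZMod 2) = 1 := by
      rw [he]; push_cast
      have : (2 : ZMod 2) = 0 := rfl
      rw [this]; simp
    push_cast
    simp [h5]
  rw [← h4, ZMod.natCast_eq_zero_iff_even]
  constructor
  · intro h
    by_contra hodd
    rw [Nat.not_even_iff_odd] at hodd
    rw [hodd.neg_one_pow] at h
    exact Ring.neg_one_ne_one_of_char_ne_two hc2 h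
  · intro h
    exact h.neg_one_pow

theorem sum_h_const {k : Type*} [Field k] [Algebra k K] [hk : GF k K] (h2 : (2 : k) ≠ 0) {ε : k} (hε : ¬ IsSquare ε)
    (c : K) (v : Place K) : ¬ (∀ w : Place K, w.h (algebraMap k K ε) c = 1 ↔ w = v) := by
  classical
  intro h
  have := hk.fin
  have hh : ∀ w : Place K, w.h (algebraMap k K ε) c = ((w.ord c * w.deg k : ℤ) : ZMod 2) := by
    intro w
    unfold Place.h
    rw [Place.o_unit (ord_const w ε), r_const h2 hε]
    unfold Place.o
    push_cast; ring
  set Z := insert v (finite_supp k c).toFinset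
  have hp := product_formula k c Z (fun w hw => by simp [Z, hw])
  have := congrArg (Int.cast : ℤ → ZMod 2) hp
  rw [Int.cast_sum] at this
  rw [Finset.sum_eq_single_of_mem v (by simp [Z])] at this
  · rw [← hh, (h v).2 rfl] at this
    simp at this
  · intro w _ hw
    rw [← hh]
    rcases zmod2_cases (w.h (algebraMap k K ε) c) with h0 | h0
    · exact h0
    · exact absurd ((h w).1 h0) hw

/-- a place which is the only ramified place of some quaternion algebra -/
def Bad (v : Place K) : Prop := ∃ a b : K, a ≠ 0 ∧ b ≠ 0 ∧ ∀ w : Place K, w.h a b = 1 ↔ w = v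

theorem odd_not_bad [Glob K] {k : Type*} [Field k] [Algebra k K] [Finite k] [hk : GF k K] (h2 : (2 : k) ≠ 0) {ε : k} (hε : ¬ IsSquare ε)
    (v : Place K) (hv : ¬ v.lsq (algebraMap k K ε)) : ¬ Bad v := by
  rintro ⟨a, b, ha, hb, h⟩
  have hε0 : ε ≠ 0 := by rintro rfl; exact hε ⟨0, by simp⟩
  have hε0' : algebraMap k K ε ≠ 0 := by simpa using hε0
  obtain ⟨c, hc, hc'⟩ := slot' ha hb hε0' (fun w hw => by rw [(h w).1 hw]; exact hv)
  exact sum_h_const h2 hε c v (fun w => by rw [hc', h])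

open Algebra in
theorem GF.larger {k L : Type*} [Field k] [Field L] [Algebra k L] [hk : GF k L] {s : L} (hs : IsAlgebraic k s)
    (hns : s ∉ Set.range (algebraMap k L)) : ∃ k' : Subfield L, GF k' L ∧ Nat.card k < Nat.card k' := by
  have := hk.fin
  have hfd : FiniteDimensional k (IntermediateField.adjoin k {s}) := IntermediateField.adjoin.finiteDimensional hs.isIntegral
  set E := IntermediateField.adjoin k {s} with hE
  have hfin : Finite E := Module.finite_of_finite k
  have hG : GF E L := by
    refine ⟨hfin, ?_, ?_⟩
    · have := hk.ess
      exact Algebra.EssFiniteType.of_comp k _ L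
    · have e := _root_.lift_trdeg_add_eq k E L
      rw [hk.trdeg, trdeg_eq_zero (R := k)] at e
      simpa using e
  refine ⟨_, GF.of_range (Fq := E), ?_⟩
  have h1 : Nat.card (algebraMap E L).fieldRange = Nat.card E := by
    refine (Nat.card_eq_of_bijective (algebraMap E L).rangeRestrictField ⟨?_, ?_⟩).symm
    · exact RingHom.injective _
    · rintro ⟨_, y, rfl⟩
      exact ⟨y, rfl⟩
  rw [h1]
  have hinj : Function.Injective (algebraMap k E) := RingHom.injective _
  refine lt_of_le_of_ne (Nat.card_le_card_of_injective _ hinj) fun hc => ?_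
  have hbij := (Nat.bijective_iff_injective_and_card (algebraMap k E)).2 ⟨hinj, hc⟩
  obtain ⟨y, hy⟩ := hbij.2 ⟨s, IntermediateField.mem_adjoin_simple_self k s⟩
  exact hns ⟨y, congrArg (algebraMap E L) hy⟩

theorem deg_lt {k : Type*} [Field k] [Algebra k K] [Finite k] [hk : GF k K] {L k' : Type*} [Field L] [Field k'] [Algebra k' L] [Finite k']
    [hk' : GF k' L] (v : Place K) (w : Place L) (h1 : Nat.card k < Nat.card k') (h2 : Nat.card w.κ ≤ Nat.card v.κ) :
    w.deg k' < v.deg k := by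
  rw [card_κ (Fq := k) v, card_κ (Fq := k') w] at h2
  by_contra hc
  push Not at hc
  have h3 : Nat.card k ^ v.deg k < Nat.card k' ^ v.deg k := Nat.pow_lt_pow_left h1 (deg_pos (Fq := k) v).ne'
  have h4 : Nat.card k' ^ v.deg k ≤ Nat.card k' ^ w.deg k' := Nat.pow_le_pow_right (by omega) hc
  omega

theorem Quad.card_split {L : Type*} [Field L] [Algebra K L] {d : K} (Q : Quad K L d) {w : Place L} {v : Place K} (h : w.Over v) (hw : w.Good)
    (hv : v.Good) (hne : w ≠ Q.conj w) : Nat.card w.κ ≤ Nat.card v.κ := by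
  have := hv.fin
  have key : ∀ ξ : w.κ, ∃ x : K, ∃ hx : v.ge x 0, w.res (algebraMap K L x) (h.ge_zero_iff.2 hx) = ξ := by
    intro ξ
    obtain ⟨z, hz, rfl⟩ := w.res_surj ξ
    obtain ⟨x, hx⟩ := Q.split_approx hw hne z 1
    have hx0 : v.ge x 0 := by
      rw [← h.ge_zero_iff]
      have := (hx.mono zero_le_one).add hz
      simpa using this
    exact ⟨x, hx0, (w.res_eq _ _).2 hx⟩
  choose x hx hx' using key
  refine Nat.card_le_card_of_injective (fun ξ => v.res (x ξ) (hx ξ)) fun ξ η he => ?_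
  rw [← hx' ξ, ← hx' η, w.res_eq, ← map_sub, h.ge_one_iff]
  exact (v.res_eq _ _).1 he
end

theorem no_bad_aux (n : ℕ) : ∀ (K : Type u) [Field K] [Glob K] (k : Subfield K) [Finite k] [GF k K] (v : Place K),
    v.deg k = n → ¬ Bad v := by
  induction n using Nat.strong_induction_on with
  | _ n ih =>
  intro K _ _ k _ _ v hn
  have h2 := Glob.two' k
  obtain ⟨ε, hε⟩ := FiniteField.exists_nonsquare (F := k) (ringChar_ne_two h2)
  by_cases hl : v.lsq (algebraMap k K ε)
  swap
  · exact odd_not_bad h2 hε v hl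
  have hε0 : ε ≠ 0 := by rintro rfl; exact hε ⟨0, by simp⟩
  have hε0' : algebraMap k K ε ≠ 0 := by simpa using hε0
  by_cases hsq : IsSquare (algebraMap k K ε)
  · obtain ⟨s, hs⟩ := hsq
    have halg : IsAlgebraic k s := by
      refine IsAlgebraic.of_pow (n := 2) (by norm_num) ?_
      rw [pow_two, ← hs]; exact isAlgebraic_algebraMap _
    obtain ⟨k', hk', hc⟩ := GF.larger halg (by
      rintro ⟨y, rfl⟩
      exact hε ⟨y, (algebraMap k K).injective (by rw [hs, map_mul])⟩)
    have := hk'.fin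
    exact ih _ (by rw [← hn]; exact deg_lt (k := k) (k' := k') v v hc le_rfl) K k' v rfl
  obtain ⟨L, _, _, ⟨Q⟩⟩ := exists_quad hsq
  have := Q.fd
  have hGL : Glob L := Glob.of_finite (K := K)
  have : GF k L := GF.of_finite (K := K)
  have halg : IsAlgebraic k Q.θ := by
    refine IsAlgebraic.of_pow (n := 2) (by norm_num) ?_
    rw [Q.sq, ← IsScalarTower.algebraMap_apply]; exact isAlgebraic_algebraMap _
  obtain ⟨k', hk', hc⟩ := GF.larger halg (by
    rintro ⟨y, hy⟩
    refine hε ⟨y, (algebraMap k L).injective ?_⟩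
    rw [map_mul, hy, ← pow_two, Q.sq, ← IsScalarTower.algebraMap_apply])
  have := hk'.fin
  obtain ⟨w, hw⟩ := v.exists_over (L := L)
  have hne := Q.ne_conj_of_lsq hw w.gd hl
  have hbw : ¬ Bad w := ih _ (by
    rw [← hn]; exact deg_lt (k := k) (k' := k') v w hc (Q.card_split hw w.gd v.gd hne)) L k' w rfl
  obtain ⟨v0, hv0, hl0⟩ := exists_nonlsq hsq {v}
  have hvv : v0 ≠ v := by simpa using hv0
  have hb0 : ¬ Bad v0 := odd_not_bad h2 hε v0 hl0
  obtain ⟨w0, hw0⟩ := v0.exists_over (L := L)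
  -- choose a
  obtain ⟨a1, ha1, ho1, hr1⟩ := Place.exists_loc v.gd 0 1
  obtain ⟨p, hp, hp1⟩ := v0.exists_unif
  classical
  obtain ⟨a, ha⟩ := Place.approx {v, v0} (fun u => if u = v then a1 else p) (fun u => u.ord (if u = v then a1 else p) + 1)
  have hav := ha v (by simp)
  have hav0 := ha v0 (by simp)
  simp only [if_true, if_neg hvv] at hav hav0
  have ha0 := (Place.ord_eq_of_sub ha1 hav).1
  have hanl : ¬ v.lsq a := by
    rw [Place.lsq_iff ha0, (Place.close_o_r v.gd ha1 hav).2, hr1]; simp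
  have hao : v0.ord a = 1 := by rw [(Place.ord_eq_of_sub hp hav0).2, hp1]
  have ha0' : algebraMap K L a ≠ 0 := by simpa using ha0
  have hunit : ∀ u : Place K, u.ord (algebraMap k K ε) = 0 := fun u => ord_const u ε
  have hanw : ¬ w.lsq (algebraMap K L a) := fun h => hanl (Q.lsq_of_split hw w.gd hne h)
  have hanw0 : ¬ w0.lsq (algebraMap K L a) := by
    intro h
    obtain ⟨y, hy, hy'⟩ := Place.lsq_ord h
    rw [Q.e_one_of_unit hw0 w0.gd (hunit v0), hao] at hy'
    omega
  have hww : w ≠ w0 := by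
    rintro rfl
    exact hvv (hw0.unique hw)
  have hansq : ¬ IsSquare (algebraMap K L a) := by
    rintro ⟨y, hy⟩
    rw [← pow_two] at hy
    apply hanw
    rw [hy]
    exact Place.lsq_of_eq_sq (by rintro rfl; exact ha0' (by simpa using hy))
  obtain ⟨x, hx0, hx1, hx⟩ := exists_two hansq hww hanw hanw0
  have h10 : ∀ t : ZMod 2, t ≠ 1 → t = 0 := by decide
  have hother : ∀ u : Place L, u ≠ w → u ≠ w0 → u.h (algebraMap K L a) x = 0 := by
    intro u hu hu0
    refine h10 _ fun hc => ?_
    rcases hx u hc with h | h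
    · exact hu h
    · exact hu0 h
  have hcw : Q.conj w ≠ w0 := by
    intro h
    have := Q.conj_over hw
    rw [h] at this
    exact hvv (hw0.unique this)
  set b := Q.N x with hb
  have hb00 : b ≠ 0 := Q.N_ne hx0
  have k0 : w0.h (algebraMap K L a) x = 1 := by
    by_contra hc
    refine hbw ⟨algebraMap K L a, x, ha0', hx0, fun u => ⟨fun hu => ?_, fun hu => ?_⟩⟩
    · rcases hx u hu with h | h
      · exact h
      · rw [h] at hu; exact absurd hu hc
    · obtain ⟨u', hu'⟩ := hx1
      rcases hx u' hu' with h | h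
      · rw [hu, ← h]; exact hu'
      · rw [h] at hu'; exact absurd hu' hc
  have j0 : v0.h a b = 1 := by
    rw [hb, Q.proj_inert hw0 w0.gd v0.gd (hunit _) hl0 ha0 hx0, k0]
  have jv : v.h a b = w.h (algebraMap K L a) x := by
    rw [hb, Q.proj_split hw w.gd (Place.gd _) v.gd hne ha0 hx0, hother _ hne.symm hcw, add_zero]
  have jo : ∀ u : Place K, u ≠ v → u ≠ v0 → u.h a b = 0 := by
    intro u hu hu0
    obtain ⟨w', hw'⟩ := u.exists_over (L := L)
    have key : ∀ w'' : Place L, w''.Over u → w''.h (algebraMap K L a) x = 0 := by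
      intro w'' h''
      refine hother _ ?_ ?_
      · rintro rfl; exact hu (h''.unique hw)
      · rintro rfl; exact hu0 (h''.unique hw0)
    by_cases hlu : u.lsq (algebraMap k K ε)
    · rw [hb, Q.proj_split hw' w'.gd (Place.gd _) u.gd (Q.ne_conj_of_lsq hw' w'.gd hlu) ha0 hx0, key _ hw', key _ (Q.conj_over hw'), add_zero]
    · rw [hb, Q.proj_inert hw' w'.gd u.gd (hunit _) hlu ha0 hx0, key _ hw']
  rintro ⟨a2, b2, ha2, hb2, hbad⟩
  rcases zmod2_cases (w.h (algebraMap K L a) x) with hz | hz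
  · refine hb0 ⟨a, b, ha0, hb00, fun u => ⟨fun hu => ?_, ?_⟩⟩
    · by_contra hne'
      by_cases huv : u = v
      · rw [huv, jv, hz] at hu; simp at hu
      · rw [jo u huv hne'] at hu; simp at hu
    · rintro rfl; exact j0
  · obtain ⟨c, hc0, hcc⟩ := slot' ha2 hb2 ha0 (fun u hu => by rw [(hbad u).1 hu]; exact hanl)
    have hcz : ∀ u : Place K, u ≠ v → u.h a c = 0 := by
      intro u hu
      rw [hcc]
      exact h10 _ fun h => hu ((hbad u).1 h)
    refine hb0 ⟨a, c * b, ha0, mul_ne_zero hc0 hb00, fun u => ?_⟩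
    rw [Place.h_mul_right u.gd hc0 hb00]
    by_cases huv : u = v
    · subst huv
      rw [hcc, (hbad u).2 rfl, jv, hz]
      exact ⟨fun h => absurd h (by decide), fun h => absurd h.symm hvv⟩
    · rw [hcz u huv, zero_add]
      refine ⟨fun hu => ?_, ?_⟩
      · by_contra h
        rw [jo u huv h] at hu; simp at hu
      · rintro rfl; exact j0

theorem no_bad {K : Type u} [Field K] [h : Glob K] (v : Place K) : ¬ Bad v := by
  obtain ⟨k, hk⟩ := h.out
  have := hk.fin
  exact no_bad_aux _ K k v rfl

theorem exists_pair_h {K : Type u} [Field K] [Glob K] {a : K} (ha0 : a ≠ 0) {v0 v1 : Place K} (hne : v0 ≠ v1)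
    (h0 : ¬ v0.lsq a) (h1 : ¬ v1.lsq a) : ∃ b : K, b ≠ 0 ∧ ∀ w : Place K, w.h a b = 1 ↔ w = v0 ∨ w = v1 := by
  have hns : ¬ IsSquare a := by
    rintro ⟨y, rfl⟩
    rw [← pow_two] at *
    exact h0 (Place.lsq_of_eq_sq (by rintro rfl; simp at ha0))
  obtain ⟨x, hx0, ⟨v, hv⟩, hx⟩ := exists_two hns hne h0 h1
  have key : ∀ u : Place K, u.h a x = 1 → ∃ u' ≠ u, u'.h a x = 1 := by
    intro u hu
    by_contra hc
    push Not at hc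
    exact no_bad u ⟨a, x, ha0, hx0, fun w => ⟨fun hw => by
      by_contra hne'; exact hc w hne' hw, fun hw => by rw [hw]; exact hu⟩⟩
  have both : v0.h a x = 1 ∧ v1.h a x = 1 := by
    obtain ⟨u, hu, hu'⟩ := key v hv
    rcases hx v hv with rfl | rfl <;> rcases hx u hu' with rfl | rfl
    · exact absurd rfl hu
    · exact ⟨hv, hu'⟩
    · exact ⟨hu', hv⟩
    · exact absurd rfl hu
  refine ⟨x, hx0, fun w => ⟨hx w, ?_⟩⟩
  rintro (rfl | rfl)
  · exact both.1
  · exact both.2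
end GFq

namespace GFq
universe u
variable {K : Type u} [Field K]

theorem exists_notMem [h : Glob K] (Z : Finset (Place K)) : ∃ v : Place K, v ∉ Z := by
  obtain ⟨k, hk⟩ := h.out
  exact exists_place_notMem k Z

theorem finite_h [Glob K] (a b : K) : {v : Place K | v.h a b = 1}.Finite := by
  refine ((fsupp a).union (fsupp b)).subset fun v hv => ?_
  simp only [Set.mem_union, Set.mem_ofPred_eq] at hv ⊢
  by_contra hc
  push Not at hc
  unfold Place.h at hv
  rw [Place.o_unit hc.1, Place.o_unit hc.2] at hv
  simp at hv

theorem Place.lsq_inv {v : Place K} {a : K} (h : v.lsq a) : v.lsq a⁻¹ := by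
  have h0 := lsq_ne_zero h
  have e : a⁻¹ = a * a⁻¹ ^ 2 := by field_simp
  rw [e, lsq_mul_sq (inv_ne_zero h0)]; exact h

theorem Place.sq_cont (v : Place K) (X : K) (n : ℤ) : ∃ N : ℤ, ∀ x, v.ge (x - X) N → v.ge (x ^ 2 - X ^ 2) n := by
  have hk : v.ge X (v.ord X) := Place.ge_self
  refine ⟨max (v.ord X) (n - v.ord X), fun x hx => ?_⟩
  have e : x ^ 2 - X ^ 2 = (x - X) * ((x - X) + (X + X)) := by ring
  rw [e]
  have := (hx.mono (le_max_right (v.ord X) (n - v.ord X))).mul ((hx.mono (le_max_left (v.ord X) (n - v.ord X))).add (hk.add hk))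
  exact this.mono (by omega)

theorem Place.norm_cont (v : Place K) (c X Y : K) (n : ℤ) : ∃ N : ℤ, ∀ x y, v.ge (x - X) N → v.ge (y - Y) N →
    v.ge ((x ^ 2 - c * y ^ 2) - (X ^ 2 - c * Y ^ 2)) n := by
  obtain ⟨N1, h1⟩ := v.sq_cont X n
  obtain ⟨N2, h2⟩ := v.sq_cont Y (n - v.ord c)
  refine ⟨max N1 N2, fun x y hx hy => ?_⟩
  have e : (x ^ 2 - c * y ^ 2) - (X ^ 2 - c * Y ^ 2) = (x ^ 2 - X ^ 2) - c * (y ^ 2 - Y ^ 2) := by ring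
  rw [e]
  have k1 := h1 x (hx.mono (le_max_left _ _))
  have k2 := h2 y (hy.mono (le_max_right _ _))
  have k3 : v.ge (c * (y ^ 2 - Y ^ 2)) (v.ord c + (n - v.ord c)) := Place.ge.mul Place.ge_self k2
  exact k1.sub (k3.mono (by omega))

/-- simultaneous approximation of norms -/
theorem norm_approx (c : K) (Z : Finset (Place K)) (X Y : Place K → K) (n : Place K → ℤ) :
    ∃ x y : K, ∀ v ∈ Z, v.ge ((x ^ 2 - c * y ^ 2) - (X v ^ 2 - c * Y v ^ 2)) (n v) := by
  choose N hN using fun v : Place K => v.norm_cont c (X v) (Y v) (n v)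
  obtain ⟨x, hx⟩ := Place.approx Z X N
  obtain ⟨y, hy⟩ := Place.approx Z Y N
  exact ⟨x, y, fun v hv => hN v x y (hx v hv) (hy v hv)⟩

theorem exists_nonlsq_h {v : Place K} (hv : v.Good) {c : K} (hc : c ≠ 0) : ∃ u : K, u ≠ 0 ∧ ¬ v.lsq u ∧ v.h c u = 0 := by
  by_cases h : v.lsq (-c)
  · obtain ⟨u, hu, ho, hr⟩ := Place.exists_loc hv 0 1
    refine ⟨u, hu, ?_, ?_⟩
    · rw [Place.lsq_iff hu, hr]; simp
    · have : c = (-1) * (-c) := by ring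
      rw [this, Place.h_mul_left hv (by simp) (by simpa using hc), Place.h_lsq_left h, add_zero]
      unfold Place.h
      rw [ho, Place.o_unit v.ord_neg_one]; simp
  · exact ⟨-c, by simpa using hc, h, Place.h_neg_self hv hc⟩

/-- five-dimensional forms are isotropic -/
theorem five [Glob K] (a0 a1 a2 a3 a4 : K) : ∃ x0 x1 x2 x3 x4 : K,
    a0 * x0 ^ 2 + a1 * x1 ^ 2 + a2 * x2 ^ 2 + a3 * x3 ^ 2 + a4 * x4 ^ 2 = 0 ∧
    ¬ (x0 = 0 ∧ x1 = 0 ∧ x2 = 0 ∧ x3 = 0 ∧ x4 = 0) := by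
  classical
  by_cases h0 : a0 = 0
  · exact ⟨1, 0, 0, 0, 0, by simp [h0], by simp⟩
  by_cases h1 : a1 = 0
  · exact ⟨0, 1, 0, 0, 0, by simp [h1], by simp⟩
  by_cases h2 : a2 = 0
  · exact ⟨0, 0, 1, 0, 0, by simp [h2], by simp⟩
  by_cases h3 : a3 = 0
  · exact ⟨0, 0, 0, 1, 0, by simp [h3], by simp⟩
  by_cases h4 : a4 = 0
  · exact ⟨0, 0, 0, 0, 1, by simp [h4], by simp⟩
  by_contra hcon
  push Not at hcon
  set A := -a1 / a0 with hA
  set B := -a2 / a0 with hB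
  set c := -a4 / a3 with hc
  have hA0 : A ≠ 0 := div_ne_zero (neg_ne_zero.2 h1) h0
  have hB0 : B ≠ 0 := div_ne_zero (neg_ne_zero.2 h2) h0
  have hc0 : c ≠ 0 := div_ne_zero (neg_ne_zero.2 h4) h3
  set f := a3 / (a0 * A * B) with hf
  have hf0 : f ≠ 0 := div_ne_zero h3 (mul_ne_zero (mul_ne_zero h0 hA0) hB0)
  have loc : ∀ v : Place K, ∃ x y : K, x ^ 2 - c * y ^ 2 ≠ 0 ∧ ¬ v.lsq (f * (x ^ 2 - c * y ^ 2)) := by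
    intro v
    by_cases hl : v.lsq f
    · obtain ⟨u, hu, hnl, hh⟩ := exists_nonlsq_h v.gd hc0
      obtain ⟨x, y, hxy, hl'⟩ := Place.exists_norm_loc v.gd hc0 hu hh
      refine ⟨x, y, hxy, fun h => hnl ?_⟩
      have := Place.lsq_cancel hl h
      rw [mul_comm] at hl'
      exact Place.lsq_cancel this hl'
    · exact ⟨1, 0, by simp, by simpa using hl⟩
  choose X Y hXY hl using loc
  obtain ⟨w, hw⟩ := exists_notMem (K := K) ∅
  obtain ⟨x, y, hxy⟩ := norm_approx c (insert w (finite_h A B).toFinset) X Y (fun v => v.ord (X v ^ 2 - c * Y v ^ 2) + 1)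
  set u := x ^ 2 - c * y ^ 2 with hu
  have hu0 : u ≠ 0 := (Place.ord_eq_of_sub (hXY w) (hxy w (by simp))).1
  have key : ∀ v : Place K, v.h A B = 1 → ¬ v.lsq (f * u) := by
    intro v hv hlu
    have h5 := Place.lsq_of_close (hXY v) (hxy v (by simp [hv]))
    apply hl v
    have h6 := Place.lsq_mul hlu h5
    have e : f * u * ((X v ^ 2 - c * Y v ^ 2) * u) = f * (X v ^ 2 - c * Y v ^ 2) * u ^ 2 := by ring
    rwa [e, Place.lsq_mul_sq hu0] at h6
  obtain ⟨v, hv1, hv2⟩ := hasse4 hA0 hB0 (mul_ne_zero hf0 hu0) (by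
    intro x0 x1 x2 x3 hx
    have e : a0 * x0 ^ 2 + a1 * x1 ^ 2 + a2 * x2 ^ 2 + a3 * (x3 * x) ^ 2 + a4 * (x3 * y) ^ 2 = 0 := by
      have e1 : a1 = -(a0 * A) := by rw [hA]; field_simp
      have e2 : a2 = -(a0 * B) := by rw [hB]; field_simp
      have e3 : a4 = -(a3 * c) := by rw [hc]; field_simp
      have e4 : a3 = a0 * A * B * f := by rw [hf]; field_simp
      rw [e1, e2, e3]
      linear_combination a0 * hx + e4 * (x3 ^ 2 * u) + a3 * x3 ^ 2 * (- hu)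
    obtain ⟨k0, k1, k2, k3, k4⟩ := hcon _ _ _ _ _ e
    refine ⟨k0, k1, k2, ?_⟩
    by_contra h3'
    have kx : x = 0 := by simpa [h3'] using k3
    have ky : y = 0 := by simpa [h3'] using k4
    exact hu0 (by rw [hu, kx, ky]; ring))
  exact key v hv2 hv1

/-- `e` is a nonzero square of a pure quaternion in `(a,b)` -/
def NN (a b e : K) : Prop := e ≠ 0 ∧ ∃ x y z : K, e = a * x ^ 2 + b * y ^ 2 - a * b * z ^ 2

theorem NN.sound [Glob K] {a b e : K} (ha : a ≠ 0) (hb : b ≠ 0) (h : NN a b e) {v : Place K} (hv : v.h a b = 1) : ¬ v.lsq e := by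
  intro hl
  obtain ⟨h0, x, y, z, h⟩ := h
  have hl' := Place.lsq_inv hl
  have := Place.aniso_of_h v.gd ha hb hv hl' hl' hl' (z0 := 1) (z1 := x) (z2 := y) (z3 := z) (by
    field_simp; linear_combination h)
  exact one_ne_zero this.1

theorem NN.complete [Glob K] {a b e : K} (ha : a ≠ 0) (hb : b ≠ 0) (he : e ≠ 0) (h : ∀ v : Place K, v.h a b = 1 → ¬ v.lsq e) :
    NN a b e := ⟨he, slot ha hb he h⟩

def Small (a b x : K) : Prop := ∃ r1 r2 : K, NN a b r1 ∧ NN a b r2 ∧ NN a b (r1 * r2) ∧ NN a b (r1 * (1 + r1)) ∧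
  NN a b (r2 * (1 + r2)) ∧ NN a b (x ^ 2 + r1 * r2)

theorem ord_nonneg_of_nonlsq {v : Place K} {r : K} (h0 : r ≠ 0) (h : ¬ v.lsq (r * (1 + r))) : 0 ≤ v.ord r := by
  by_contra hc
  push Not at hc
  apply h
  have e : r * (1 + r) = (1 + r⁻¹) * r ^ 2 := by field_simp; ring
  rw [e, Place.lsq_mul_sq h0]
  refine Place.lsq_of_sub_one le_rfl ?_
  rw [add_sub_cancel_left]
  exact Place.ge_of_ord (by rw [v.ord_inv]; omega)

theorem Small.sound [Glob K] {a b x : K} (ha : a ≠ 0) (hb : b ≠ 0) (h : Small a b x) {v : Place K} (hv : v.h a b = 1) : v.ge x 1 := by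
  obtain ⟨r1, r2, h1, h2, h3, h4, h5, h6⟩ := h
  have n1 := h1.1
  have n2 := h2.1
  have k1 := h1.sound ha hb hv
  have k2 := h2.sound ha hb hv
  have k3 := h3.sound ha hb hv
  have o1 := ord_nonneg_of_nonlsq n1 (h4.sound ha hb hv)
  have o2 := ord_nonneg_of_nonlsq n2 (h5.sound ha hb hv)
  have k6 := h6.sound ha hb hv
  by_contra hc
  rw [Place.not_ge] at hc
  have hpos : 1 ≤ v.ord (r1 * r2) := by
    rw [v.ord_mul _ _ n1 n2]
    by_contra hlt
    have z1 : v.ord r1 = 0 := by omega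
    have z2 : v.ord r2 = 0 := by omega
    rw [Place.lsq_iff n1, Place.o_unit z1] at k1
    rw [Place.lsq_iff n2, Place.o_unit z2] at k2
    rw [Place.lsq_iff (mul_ne_zero n1 n2), Place.o_mul n1 n2, Place.r_mul v.gd n1 n2, Place.o_unit z1, Place.o_unit z2] at k3
    generalize v.r r1 = t1 at *
    generalize v.r r2 = t2 at *
    revert k1 k2 k3
    revert t1 t2
    decide
  apply k6
  have e : x ^ 2 + r1 * r2 = (1 + (r1 * r2) / x ^ 2) * x ^ 2 := by field_simp [hc.1]
  rw [e, Place.lsq_mul_sq hc.1]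
  refine Place.lsq_of_sub_one le_rfl ?_
  rw [add_sub_cancel_left, Place.ge_div_iff (pow_ne_zero _ hc.1), v.ord_pow]
  exact Place.ge_of_ord (by push_cast; omega)

theorem Small.complete [Glob K] {a b x : K} (ha : a ≠ 0) (hb : b ≠ 0) (h : ∀ v : Place K, v.h a b = 1 → v.ge x 2) : Small a b x := by
  classical
  choose p hp hp1 using fun v : Place K => v.exists_unif
  choose ε hε ho hr using fun v : Place K => Place.exists_loc v.gd 0 1
  -- make ε a unit
  have hε' : ∀ v : Place K, ∃ e : K, e ≠ 0 ∧ v.ord e = 0 ∧ v.r e = 1 := by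
    intro v
    have h2 : (2 : ℤ) ∣ v.ord (ε v) := by
      have := ho v
      unfold Place.o at this
      exact_mod_cast (ZMod.intCast_zmod_eq_zero_iff_dvd _ 2).1 this
    obtain ⟨j, hj⟩ := h2
    obtain ⟨y, hy, hyo⟩ := v.exists_ord (-j)
    refine ⟨ε v * y ^ 2, mul_ne_zero (hε v) (pow_ne_zero _ hy), ?_, ?_⟩
    · rw [v.ord_mul _ _ (hε v) (pow_ne_zero _ hy), v.ord_pow, hj, hyo]; push_cast; ring
    · rw [Place.r_mul v.gd (hε v) (pow_ne_zero _ hy), hr, Place.r_lsq (Place.lsq_of_eq_sq hy), add_zero]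
  choose e he heo her using hε'
  set Z := (finite_h a b).toFinset
  obtain ⟨w, hw⟩ := exists_notMem (K := K) ∅
  obtain ⟨r1, hr1⟩ := Place.approx (insert w Z) p (fun v => v.ord (p v) + 1)
  obtain ⟨r2, hr2⟩ := Place.approx (insert w Z) (fun v => e v * p v) (fun v => v.ord (e v * p v) + 1)
  have hep : ∀ v : Place K, e v * p v ≠ 0 := fun v => mul_ne_zero (he v) (hp v)
  have n1 : r1 ≠ 0 := (Place.ord_eq_of_sub (hp w) (hr1 w (by simp))).1
  have n2 : r2 ≠ 0 := (Place.ord_eq_of_sub (hep w) (hr2 w (by simp))).1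
  have odd_nl : ∀ (v : Place K) (y : K), v.ord y = 1 → ¬ v.lsq y := by
    intro v y hy hl
    obtain ⟨z, hz, hz'⟩ := Place.lsq_ord hl
    omega
  have key : ∀ v ∈ insert w Z, v.ord r1 = 1 ∧ v.ord r2 = 1 ∧ ¬ v.lsq (r1 * r2) := by
    intro v hv
    have hep1 : v.ord (e v * p v) = 1 := by rw [v.ord_mul _ _ (he v) (hp v), heo, hp1]; rfl
    refine ⟨?_, ?_, ?_⟩
    · rw [(Place.ord_eq_of_sub (hp v) (hr1 v hv)).2, hp1]
    · rw [(Place.ord_eq_of_sub (hep v) (hr2 v hv)).2, hep1]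
    · rw [Place.lsq_iff (mul_ne_zero n1 n2), Place.r_mul v.gd n1 n2, (Place.close_o_r v.gd (hp v) (hr1 v hv)).2,
        (Place.close_o_r v.gd (hep v) (hr2 v hv)).2, Place.r_mul v.gd (he v) (hp v), her]
      generalize v.r (p v) = t
      rintro ⟨-, h⟩
      revert h; revert t; decide
  have plus : ∀ v : Place K, ∀ r : K, r ≠ 0 → v.ord r = 1 → 1 + r ≠ 0 ∧ v.ord (r * (1 + r)) = 1 := by
    intro v r hr0 hr
    have := Place.ord_add_eq (v := v) (x := (1 : K)) (y := r) one_ne_zero (Place.ge_of_ord (by rw [v.ord_one, hr]; rfl))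
    refine ⟨this.1, ?_⟩
    rw [v.ord_mul _ _ hr0 this.1, this.2, v.ord_one, hr]; rfl
  have hZ : ∀ v : Place K, v.h a b = 1 → v ∈ insert w Z := fun v hv => by simp [Z, hv]
  have kw := key w (by simp)
  -- x^2 + r1 r2
  by_cases hx6 : x ^ 2 + r1 * r2 = 0
  · -- then no ramified places
    have hnone : ∀ v : Place K, v.h a b ≠ 1 := by
      intro v hv
      obtain ⟨k1, k2, k3⟩ := key v (hZ v hv)
      have hx0 : x ≠ 0 := by
        rintro rfl
        exact mul_ne_zero n1 n2 (by simpa using hx6)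
      have := (h v hv).le hx0
      have e1 : x ^ 2 = -(r1 * r2) := by linear_combination hx6
      have e2 := congrArg v.ord e1
      rw [v.ord_pow, v.ord_neg, v.ord_mul _ _ n1 n2, k1, k2] at e2
      push_cast at e2
      omega
    have any : ∀ y : K, y ≠ 0 → NN a b y := fun y hy => NN.complete ha hb hy fun v hv => absurd hv (hnone v)
    obtain ⟨q, hq, hq1⟩ := w.exists_ord (w.ord x + 1)
    have hp1' := plus w r1 n1 kw.1
    by_cases hx0 : x = 0
    · subst hx0
      exact absurd hx6 (by simpa using mul_ne_zero n1 n2)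
    · -- use r1 and r2 multiplied by a unit different from one
      have hp2' := plus w r2 n2 kw.2.1
      have hr3 : r2 * (1 + r1) ≠ 0 := mul_ne_zero n2 hp1'.1
      have ho3 : w.ord (r2 * (1 + r1)) = 1 := by
        have := hp1'.2
        rw [w.ord_mul _ _ n1 hp1'.1, kw.1] at this
        rw [w.ord_mul _ _ n2 hp1'.1, kw.2.1]; exact this
      have hp3' := plus w _ hr3 ho3
      refine ⟨r1, r2 * (1 + r1), any _ n1, any _ hr3, any _ (mul_ne_zero n1 hr3), any _ (mul_ne_zero n1 hp1'.1),
        any _ (mul_ne_zero hr3 hp3'.1), any _ ?_⟩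
      have : x ^ 2 + r1 * (r2 * (1 + r1)) = r1 * r1 * r2 := by linear_combination hx6
      rw [this]
      exact mul_ne_zero (mul_ne_zero n1 n1) n2
  · refine ⟨r1, r2, NN.complete ha hb n1 ?_, NN.complete ha hb n2 ?_, NN.complete ha hb (mul_ne_zero n1 n2) ?_,
      NN.complete ha hb (mul_ne_zero n1 (plus w r1 n1 kw.1).1) ?_, NN.complete ha hb (mul_ne_zero n2 (plus w r2 n2 kw.2.1).1) ?_,
      NN.complete ha hb hx6 ?_⟩
    · exact fun v hv => odd_nl v _ (key v (hZ v hv)).1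
    · exact fun v hv => odd_nl v _ (key v (hZ v hv)).2.1
    · exact fun v hv => (key v (hZ v hv)).2.2
    · exact fun v hv => odd_nl v _ (plus v r1 n1 (key v (hZ v hv)).1).2
    · exact fun v hv => odd_nl v _ (plus v r2 n2 (key v (hZ v hv)).2.1).2
    · intro v hv hl
      obtain ⟨k1, k2, k3⟩ := key v (hZ v hv)
      have hc : v.ge ((x ^ 2 + r1 * r2) - r1 * r2) (v.ord (r1 * r2) + 1) := by
        rw [v.ord_mul _ _ n1 n2, k1, k2, add_sub_cancel_right]
        rw [pow_two]; exact ((h v hv).mul (h v hv)).mono (by norm_num)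
      have := Place.lsq_of_close (mul_ne_zero n1 n2) hc
      rw [mul_comm] at this
      exact k3 (Place.lsq_cancel hl this)
end GFq

namespace GFq
universe u
variable {K : Type u} [Field K]

structure Par (K : Type u) [Field K] where
  v0 : Place K
  w1 : Place K
  α : K
  β : K
  y0 : K
  p0 : K
  hne : v0 ≠ w1
  hα : α ≠ 0
  hβ : β ≠ 0
  hd : ∀ w : Place K, w.h α β = 1 ↔ w = v0 ∨ w = w1
  hy : y0 ≠ 0
  hy0 : v0.ord y0 = 0
  hy1 : 2 ≤ w1.ord y0
  hp : p0 ≠ 0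
  hp0 : 0 < v0.ord p0
  hp1 : ∀ w : Place K, w ≠ v0 → w.ord p0 ≤ 0

theorem exists_par [hG : Glob K] (Z : Finset (Place K)) : ∃ P : Par K, P.v0 ∉ Z ∧ P.w1 ∉ Z := by
  classical
  obtain ⟨k, hk⟩ := hG.out
  have := hk.fin
  obtain ⟨t, ht⟩ := hk.exists_transc
  obtain ⟨v0, hv0⟩ := exists_notMem (Z ∪ (fsupp t).toFinset)
  obtain ⟨w1, hw1⟩ := exists_notMem (insert v0 Z)
  simp only [Finset.mem_union, not_or, Set.Finite.mem_toFinset, Set.mem_ofPred_eq, not_not] at hv0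
  simp only [Finset.mem_insert, not_or] at hw1
  have hne : v0 ≠ w1 := fun h => hw1.1 h.symm
  choose e he heo her using fun v : Place K => Place.exists_loc v.gd 0 1
  obtain ⟨α, hα⟩ := Place.approx {v0, w1} e (fun v => v.ord (e v) + 1)
  have nl : ∀ v ∈ ({v0, w1} : Finset (Place K)), ¬ v.lsq α := by
    intro v hv
    rw [Place.lsq_iff (Place.ord_eq_of_sub (he v) (hα v hv)).1, (Place.close_o_r v.gd (he v) (hα v hv)).2, her]
    simp
  have hα0 : α ≠ 0 := (Place.ord_eq_of_sub (he v0) (hα v0 (by simp))).1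
  obtain ⟨β, hβ0, hβ⟩ := exists_pair_h hα0 hne (nl v0 (by simp)) (nl w1 (by simp))
  obtain ⟨q, hq, hq2⟩ := w1.exists_ord 2
  obtain ⟨y0, hy0⟩ := Place.approx {v0, w1} (fun v => if v = v0 then 1 else q) (fun v => v.ord (if v = v0 then 1 else q) + 1)
  have h1 := hy0 v0 (by simp)
  have h2 := hy0 w1 (by simp)
  simp only [if_true, if_neg hne.symm] at h1 h2
  have h1' := Place.ord_eq_of_sub one_ne_zero h1
  have h2' := Place.ord_eq_of_sub hq h2
  obtain ⟨u, hu0, j, n, hj, hn, hu⟩ := exists_unit ht v0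
  refine ⟨⟨v0, w1, α, β, y0, u, hne, hα0, hβ0, hβ, h1'.1, by rw [h1'.2, v0.ord_one], by rw [h2'.2, hq2], hu0, ?_, ?_⟩, hv0.1, hw1.2⟩
  · rw [hu, if_pos rfl]
    have : poles k t v0 = 0 := by
      change (-v0.ord t).toNat = 0
      rw [hv0.2]; rfl
    rw [this]; push_cast; omega
  · intro w hw
    rw [hu, if_neg hw]
    have : (0 : ℤ) ≤ (n : ℤ) * (poles k t w : ℕ) := by positivity
    omega

def Cert (P : Par K) (X Y x1 x2 x3 : K) : Prop :=
  X ≠ 0 ∧ Y ≠ 0 ∧ Small P.α P.β (P.y0 * (X - 1)) ∧ Small P.α P.β (P.y0 * (Y - 1)) ∧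
  Small (P.α * X) (P.β * Y) (P.p0 ^ 2 * (x1 - 1)) ∧ Small (P.α * X) (P.β * Y) (P.p0 ^ 2 * (x2 - 1)) ∧
  Small (P.α * X) (P.β * Y) (P.p0 ^ 2 * (x3 - 1))

theorem Cert.sound [Glob K] {P : Par K} {X Y x1 x2 x3 : K} (h : Cert P X Y x1 x2 x3) {z0 z1 z2 z3 : K}
    (e : z0 ^ 2 - P.α * X * x1 * z1 ^ 2 - P.β * Y * x2 * z2 ^ 2 + P.α * X * (P.β * Y) * x3 * z3 ^ 2 = 0) :
    z0 = 0 ∧ z1 = 0 ∧ z2 = 0 ∧ z3 = 0 := by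
  obtain ⟨hX, hY, sX, sY, s1, s2, s3⟩ := h
  have hab : P.v0.h P.α P.β = 1 := (P.hd _).2 (Or.inl rfl)
  have loc : ∀ x : K, P.v0.ge (P.y0 * (x - 1)) 1 → P.v0.lsq x := by
    intro x hx
    rw [Place.ge_mul_iff P.hy, P.hy0] at hx
    exact Place.lsq_of_sub_one le_rfl (by simpa using hx)
  have lX := loc X (sX.sound P.hα P.hβ hab)
  have lY := loc Y (sY.sound P.hα P.hβ hab)
  have ha : P.α * X ≠ 0 := mul_ne_zero P.hα hX
  have hb : P.β * Y ≠ 0 := mul_ne_zero P.hβ hY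
  have h0 : P.v0.h (P.α * X) (P.β * Y) = 1 := by
    rw [Place.h_mul_left P.v0.gd P.hα hX, Place.h_lsq_left lX, add_zero, Place.h_mul_right P.v0.gd P.hβ hY, Place.h_lsq_right lY, add_zero, hab]
  obtain ⟨v, hv, hv1⟩ : ∃ v : Place K, v ≠ P.v0 ∧ v.h (P.α * X) (P.β * Y) = 1 := by
    by_contra hc
    push Not at hc
    refine no_bad P.v0 ⟨_, _, ha, hb, fun w => ⟨fun hw => ?_, fun hw => by rw [hw]; exact h0⟩⟩
    by_contra hne
    exact hc w hne hw
  have loc1 : ∀ x : K, v.ge (P.p0 ^ 2 * (x - 1)) 1 → v.lsq x := by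
    intro x hx
    rw [Place.ge_mul_iff (pow_ne_zero _ P.hp), v.ord_pow] at hx
    have := P.hp1 v hv
    exact Place.lsq_of_sub_one le_rfl (hx.mono (by push_cast; omega))
  exact Place.aniso_of_h v.gd ha hb hv1 (loc1 _ (s1.sound ha hb hv1)) (loc1 _ (s2.sound ha hb hv1)) (loc1 _ (s3.sound ha hb hv1)) e

theorem Place.h_close {v : Place K} (hv : v.Good) {a a' : K} (ha : a ≠ 0) (h : v.ge (a' - a) (v.ord a + 1)) (b : K) :
    v.h a' b = v.h a b := by
  unfold Place.h
  rw [(close_o_r hv ha h).1, (close_o_r hv ha h).2]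

theorem adjust {v0 v1 : Place K} (hne : v0 ≠ v1) (hv : v1.Good) {e : K} (he : e ≠ 0) (h : v1.lsq e) (M : ℤ) (hM : 1 ≤ M) :
    ∃ z : K, z ≠ 0 ∧ v1.ge (e * z ^ 2 - 1) M ∧ v0.ge (e * z ^ 2) 0 := by
  classical
  obtain ⟨y, hy, hye⟩ := Place.lsq_hensel hv h M
  obtain ⟨N1, h1⟩ := v1.sq_cont y (M - v1.ord e)
  obtain ⟨N0, h0⟩ := v0.sq_cont 0 (0 - v0.ord e)
  obtain ⟨z, hz⟩ := Place.approx {v0, v1} (fun v => if v = v0 then 0 else y) (fun v => if v = v0 then N0 else N1)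
  have k0 := hz v0 (by simp)
  have k1 := hz v1 (by simp)
  simp only [if_true, if_neg hne.symm] at k0 k1
  have m0 := h0 z k0
  have m1 := h1 z k1
  have j1 : v1.ge (e * z ^ 2 - 1) M := by
    have e1 : e * z ^ 2 - 1 = e * (z ^ 2 - y ^ 2) + (e * y ^ 2 - 1) := by ring
    rw [e1]
    exact ((Place.ge_mul_iff he).2 m1).add hye
  refine ⟨z, ?_, j1, ?_⟩
  · rintro rfl
    have := (Place.unit_of_sub_one hM j1).1
    simp at this
  · rw [Place.ge_mul_iff he]
    simpa using m0

theorem Cert.complete [Glob K] (P : Par K) {a b d : K} (ha : a ≠ 0) (hb : b ≠ 0) (hd : d ≠ 0) {v1 : Place K} (h0 : v1 ≠ P.v0)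
    (h1 : v1 ≠ P.w1) (hl : v1.lsq d) (hab : v1.h a b = 1) :
    ∃ X Y x1 x2 x3 : K, Cert P X Y x1 x2 x3 ∧ ∃ s t z1 z2 z3 : K, s ^ 2 - a * d * t ^ 2 ≠ 0 ∧ z1 ≠ 0 ∧ z2 ≠ 0 ∧ z3 ≠ 0 ∧
      P.α * X * x1 = a * z1 ^ 2 ∧ P.β * Y * x2 = b * (s ^ 2 - a * d * t ^ 2) * z2 ^ 2 ∧
      P.α * X * (P.β * Y) * x3 = a * b * d * (s ^ 2 - a * d * t ^ 2) * z3 ^ 2 := by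
  classical
  obtain ⟨v0, w1, α, β, y0, p0, hne, hα, hβ, hdel, hy, hy0, hy1, hp, hp0, hp1⟩ := P
  simp only at h0 h1
  have hαβ : v0.h α β = 1 := (hdel _).2 (Or.inl rfl)
  -- choose a'
  obtain ⟨a', ha'⟩ := Place.approx {v0, w1, v1} (fun v => if v = v1 then a else α) (fun v => if v = v1 then v.ord a + 1 else v.ord α + 2)
  have a0 := ha' v0 (by simp)
  have a1 := ha' v1 (by simp)
  have aw := ha' w1 (by simp)
  simp only [if_true, if_neg h0.symm, if_neg h1.symm] at a0 a1 aw
  have a0' := a0.mono (show v0.ord α + 1 ≤ v0.ord α + 2 by omega)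
  have hA0 : a' ≠ 0 := (Place.ord_eq_of_sub ha a1).1
  have nl0 : ¬ v0.lsq a' := by
    intro h
    have : v0.h a' β = 0 := Place.h_lsq_left h
    rw [Place.h_close v0.gd hα a0', hαβ] at this
    exact one_ne_zero this
  have nl1 : ¬ v1.lsq a' := by
    intro h
    have : v1.h a' b = 0 := Place.h_lsq_left h
    rw [Place.h_close v1.gd ha a1, hab] at this
    exact one_ne_zero this
  obtain ⟨b1, hb1, hdel1⟩ := exists_pair_h hA0 h0.symm nl0 nl1
  set c := b1 / β with hc
  have hc0 : c ≠ 0 := div_ne_zero hb1 hβ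
  have hcn : v0.h a' c = 0 := by
    have e : c = b1 * β * (1 / β) ^ 2 := by rw [hc]; field_simp
    have hb' : 1 / β ≠ 0 := div_ne_zero one_ne_zero hβ
    rw [e, Place.h_mul_right v0.gd (mul_ne_zero hb1 hβ) (pow_ne_zero _ hb'), Place.h_lsq_right (Place.lsq_of_eq_sq hb'),
      Place.h_mul_right v0.gd hb1 hβ, (hdel1 v0).2 (Or.inl rfl), Place.h_close v0.gd hα a0', hαβ]
    decide
  obtain ⟨X0, Y0, hXY0⟩ := Place.exists_norm_approx v0.gd hA0 hc0 hcn 2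
  obtain ⟨x, y, hxy⟩ := norm_approx a' {v0, w1} (fun v => if v = v0 then X0 else 0) (fun v => if v = v0 then Y0 else 0)
    (fun v => 2 - v.ord c)
  have n0 := hxy v0 (by simp)
  have nw := hxy w1 (by simp)
  simp only [if_true, if_neg hne.symm] at n0 nw
  set n' := x ^ 2 - a' * y ^ 2 with hn'
  set Y := c * n' with hY
  have Y0' : v0.ge (Y - 1) 2 := by
    have e : Y - 1 = c * (n' - (X0 ^ 2 - a' * Y0 ^ 2)) + (c * (X0 ^ 2 - a' * Y0 ^ 2) - 1) := by rw [hY]; ring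
    rw [e]
    exact ((Place.ge_mul_iff hc0).2 n0).add hXY0
  have Yw : w1.ge (Y - 1) 0 := by
    refine Place.ge.sub ?_ Place.ge_one
    rw [hY, Place.ge_mul_iff hc0]
    have : n' - (0 ^ 2 - a' * 0 ^ 2) = n' := by ring
    rw [this] at nw
    exact nw.mono (by omega)
  have hYne : Y ≠ 0 := (Place.unit_of_sub_one (by norm_num) Y0').1
  have hn0 : n' ≠ 0 := fun h => hYne (by rw [hY, h, mul_zero])
  set X := a' / α with hX
  have hXne : X ≠ 0 := div_ne_zero hA0 hα
  have eX : α * X = a' := by rw [hX]; field_simp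
  have eXm : X - 1 = (a' - α) / α := by rw [hX]; field_simp
  have eY : β * Y = b1 * n' := by rw [hY, hc]; field_simp
  have hB0 : b1 * n' ≠ 0 := mul_ne_zero hb1 hn0
  have hdel2 : ∀ w : Place K, w.h a' (b1 * n') = w.h a' b1 := fun w => by
    rw [Place.h_mul_right w.gd hb1 hn0, Place.h_norm w.gd hA0 hn0, add_zero]
  set b' := b1 * n' with hb'
  have had : a * d ≠ 0 := mul_ne_zero ha hd
  obtain ⟨s, t, hst, hlst⟩ := Place.exists_norm_loc v1.gd had (mul_ne_zero hb hB0) (by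
    rw [Place.h_mul_left v1.gd ha hd, Place.h_lsq_left hl, add_zero, Place.h_mul_right v1.gd hb hB0, hab,
      ← Place.h_close v1.gd ha a1 b', hdel2, (hdel1 v1).2 (Or.inr rfl)]
    decide)
  set m := s ^ 2 - a * d * t ^ 2 with hm
  set M := 2 - 2 * v1.ord p0 with hM
  have hM1 : 1 ≤ M := by have := hp1 v1 h0; omega
  have l1 : v1.lsq (a / a') := by
    have e : a / a' = a * a' * (1 / a') ^ 2 := by field_simp
    rw [e, Place.lsq_mul_sq (div_ne_zero one_ne_zero hA0)]
    exact Place.lsq_of_close ha a1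
  have l2 : v1.lsq (b * m / b') := by
    have e : b * m / b' = b * b' * m * (1 / b') ^ 2 := by field_simp
    rw [e, Place.lsq_mul_sq (div_ne_zero one_ne_zero hB0)]
    exact hlst
  have l3 : v1.lsq ((a / a') * (b * m / b') * d) := Place.lsq_mul (Place.lsq_mul l1 l2) hl
  obtain ⟨z1, hz1, p1, q1⟩ := adjust h0.symm v1.gd (Place.lsq_ne_zero l1) l1 M hM1
  obtain ⟨z2, hz2, p2, q2⟩ := adjust h0.symm v1.gd (Place.lsq_ne_zero l2) l2 M hM1
  obtain ⟨z3, hz3, p3, q3⟩ := adjust h0.symm v1.gd (Place.lsq_ne_zero l3) l3 M hM1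
  have fin : ∀ ξ : K, v1.ge (ξ - 1) M → v0.ge ξ 0 → Small a' b' (p0 ^ 2 * (ξ - 1)) := by
    intro ξ hξ1 hξ0
    refine Small.complete hA0 hB0 fun v hv => ?_
    rw [hdel2, hdel1] at hv
    rw [Place.ge_mul_iff (pow_ne_zero _ hp), v.ord_pow]
    rcases hv with rfl | rfl
    · exact (hξ0.sub Place.ge_one).mono (by push_cast; omega)
    · exact hξ1.mono (by push_cast; omega)
  refine ⟨X, Y, a / a' * z1 ^ 2, b * m / b' * z2 ^ 2, (a / a') * (b * m / b') * d * z3 ^ 2, ⟨hXne, hYne, ?_, ?_, ?_, ?_, ?_⟩,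
    s, t, z1, z2, z3, hst, hz1, hz2, hz3, ?_, ?_, ?_⟩
  · refine Small.complete hα hβ fun v hv => ?_
    rw [hdel] at hv
    simp only
    rw [Place.ge_mul_iff hy, eXm, Place.ge_div_iff hα]
    rcases hv with rfl | rfl
    · exact a0.mono (by omega)
    · exact aw.mono (by omega)
  · refine Small.complete hα hβ fun v hv => ?_
    rw [hdel] at hv
    simp only
    rw [Place.ge_mul_iff hy]
    rcases hv with rfl | rfl
    · exact Y0'.mono (by omega)
    · exact Yw.mono (by omega)
  · simp only [eX, eY]; exact fin _ p1 q1
  · simp only [eX, eY]; exact fin _ p2 q2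
  · simp only [eX, eY]; exact fin _ p3 q3
  · simp only [eX]; field_simp
  · simp only [eY]; field_simp; exact hm
  · simp only [eX, eY]; field_simp; exact hm
end GFq

namespace GFq
universe u
variable {K : Type u} [Field K]

/-- anisotropy of a diagonal form -/
def AN {m : ℕ} (w : Fin m → K) : Prop := ∀ x : Fin m → K, ∑ i, w i * x i ^ 2 = 0 → x = 0

theorem AN.ne {m : ℕ} {w : Fin m → K} (h : AN w) (i : Fin m) : w i ≠ 0 := by
  intro hi
  have := h (Pi.single i 1) (by
    rw [Finset.sum_eq_single i]
    · simp [hi]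
    · intro j _ hj; simp [hj]
    · simp)
  have := congrFun this i
  simp at this

/-- values of the general form -/
def Qf {m : ℕ} (a : Fin m × Fin m → K) (x : Fin m → K) : K := ∑ p : Fin m × Fin m, a p * x p.1 * x p.2

theorem diag (h2 : (2 : K) ≠ 0) {m : ℕ} (a : Fin m × Fin m → K) :
    ∃ (w : Fin m → K) (e : (Fin m → K) ≃ₗ[K] (Fin m → K)), ∀ x, Qf a x = ∑ i, w i * (e x i) ^ 2 := by
  let _ : Invertible (2 : K) := invertibleOfNonzero h2
  let M : Matrix (Fin m) (Fin m) K := Matrix.of fun i j => a (i, j)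
  obtain ⟨w, ⟨e⟩⟩ := QuadraticForm.equivalent_weightedSumSquares (M.toQuadraticForm')
  have hf : Module.finrank K (Fin m → K) = m := by simp
  let σ : Fin m ≃ Fin (Module.finrank K (Fin m → K)) := finCongr hf.symm
  refine ⟨fun i => w (σ i), e.toLinearEquiv.trans (LinearEquiv.funCongrLeft K K σ), fun x => ?_⟩
  have h := e.map_app x
  rw [QuadraticMap.weightedSumSquares_apply] at h
  have h' : M.toQuadraticForm' x = Qf a x := by
    unfold Matrix.toQuadraticForm' Qf
    rw [LinearMap.BilinMap.toQuadraticMap_apply, Matrix.toLinearMap₂'_apply, Fintype.sum_prod_type]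
    refine Finset.sum_congr rfl fun i _ => Finset.sum_congr rfl fun j _ => ?_
    simp [M]; ring
  rw [← h', ← h, ← Equiv.sum_comp σ]
  refine Finset.sum_congr rfl fun i _ => ?_
  rw [pow_two]
  rfl

theorem AN.ext1 [Glob K] {w : Fin 1 → K} (h : AN w) : ∃ e : K, AN (Fin.cons e w : Fin 2 → K) := by
  obtain ⟨v, -⟩ := exists_notMem (∅ : Finset (Place K))
  obtain ⟨u, hu, ho, hr⟩ := Place.exists_loc v.gd 0 1
  have hl : ¬ v.lsq u := by rw [Place.lsq_iff hu, hr]; simp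
  obtain ⟨b, hb, hub⟩ := Place.exists_h_one v.gd hu hl
  have h0 := h.ne 0
  refine ⟨- (u * w 0), fun x hx => ?_⟩
  simp [Fin.sum_univ_succ] at hx
  have l1 : v.lsq (1 : K) := by
    have := Place.lsq_of_eq_sq (v := v) (y := (1 : K)) one_ne_zero
    simpa using this
  have k := Place.aniso_of_h v.gd hu hb hub l1 l1 l1 (z0 := x 1) (z1 := x 0) (z2 := 0) (z3 := 0) (by
    apply mul_left_cancel₀ h0; linear_combination hx)
  ext i; fin_cases i
  · exact k.2.1
  · exact k.1

theorem AN.ext2 [Glob K] {w : Fin 2 → K} (h : AN w) : ∃ e : K, AN (Fin.cons e w : Fin 3 → K) := by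
  have h0 := h.ne 0
  have h1 := h.ne 1
  obtain ⟨a, ha⟩ : ∃ a, a = - w 1 / w 0 := ⟨_, rfl⟩
  have ha0 : a ≠ 0 := by rw [ha]; exact div_ne_zero (neg_ne_zero.2 h1) h0
  have ea : w 1 = - (w 0 * a) := by rw [ha]; field_simp
  have hns : ¬ IsSquare a := by
    rintro ⟨s, hs⟩
    have := h ![s, 1] (by simp [Fin.sum_univ_succ, ea, hs]; ring)
    have := congrFun this 1
    simp at this
  obtain ⟨v, -, hv⟩ := exists_nonlsq hns ∅
  obtain ⟨b, hb, hab⟩ := Place.exists_h_one v.gd ha0 hv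
  have l1 : v.lsq (1 : K) := by
    have := Place.lsq_of_eq_sq (v := v) (y := (1 : K)) one_ne_zero
    simpa using this
  refine ⟨- (b * w 0), fun x hx => ?_⟩
  simp [Fin.sum_univ_succ, ea] at hx
  have k := Place.aniso_of_h v.gd ha0 hb hab l1 l1 l1 (z0 := x 1) (z1 := x 2) (z2 := x 0) (z3 := 0) (by
    apply mul_left_cancel₀ h0; linear_combination hx)
  ext i; fin_cases i
  · exact k.2.2.1
  · exact k.1
  · exact k.2.1

theorem AN.ext3 [Glob K] {w : Fin 3 → K} (h : AN w) : ∃ e : K, AN (Fin.cons e w : Fin 4 → K) := by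
  have h0 := h.ne 0
  have h1 := h.ne 1
  have h2 := h.ne 2
  obtain ⟨a, ha⟩ : ∃ a, a = - w 1 / w 0 := ⟨_, rfl⟩
  have ha0 : a ≠ 0 := by rw [ha]; exact div_ne_zero (neg_ne_zero.2 h1) h0
  have ea : w 1 = - (w 0 * a) := by rw [ha]; field_simp
  obtain ⟨b, hb⟩ : ∃ b, b = - w 2 / w 0 := ⟨_, rfl⟩
  have hb0 : b ≠ 0 := by rw [hb]; exact div_ne_zero (neg_ne_zero.2 h2) h0
  have eb : w 2 = - (w 0 * b) := by rw [hb]; field_simp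
  have : ∃ v : Place K, v.h a b = 1 := by
    by_contra hc
    push Not at hc
    obtain ⟨p, q, hpq⟩ := norm_of_h ha0 hb0 fun v => (zmod2_cases _).resolve_right (hc v)
    have := h ![p, q, 1] (by simp [Fin.sum_univ_succ, ea, eb]; linear_combination - w 0 * hpq)
    have := congrFun this 2
    simp at this
  obtain ⟨v, hab⟩ := this
  have l1 : v.lsq (1 : K) := by
    have := Place.lsq_of_eq_sq (v := v) (y := (1 : K)) one_ne_zero
    simpa using this
  refine ⟨a * b * w 0, fun x hx => ?_⟩
  simp [Fin.sum_univ_succ, ea, eb] at hx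
  have k := Place.aniso_of_h v.gd ha0 hb0 hab l1 l1 l1 (z0 := x 1) (z1 := x 2) (z2 := x 3) (z3 := x 0) (by
    apply mul_left_cancel₀ h0; linear_combination hx)
  ext i; fin_cases i
  · exact k.2.2.2
  · exact k.1
  · exact k.2.1
  · exact k.2.2.1

/-- `w` is represented by `w'` -/
def Rp {m n : ℕ} (q : (Fin m → K) → K) (w : Fin n → K) : Prop :=
  ∃ L : (Fin m → K) →ₗ[K] (Fin n → K), ∀ x, q x = ∑ i, w i * (L x i) ^ 2

theorem Rp.cons {m n : ℕ} {q : (Fin m → K) → K} {w : Fin n → K} (h : Rp q w) (e : K) :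
    Rp q (Fin.cons e w : Fin (n + 1) → K) := by
  obtain ⟨L, hL⟩ := h
  let C : (Fin n → K) →ₗ[K] (Fin (n + 1) → K) :=
    { toFun := fun x => Fin.cons 0 x
      map_add' := fun x y => by ext i; refine Fin.cases ?_ (fun j => ?_) i <;> simp
      map_smul' := fun c x => by ext i; refine Fin.cases ?_ (fun j => ?_) i <;> simp }
  refine ⟨C.comp L, fun x => ?_⟩
  rw [hL, Fin.sum_univ_succ]
  simp [C]

theorem exists4 [Glob K] {m : ℕ} (hm : 1 ≤ m) (hm4 : m ≤ 4) {w : Fin m → K} (h : AN w) :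
    ∃ w' : Fin 4 → K, AN w' ∧ Rp (fun x : Fin m → K => ∑ i, w i * x i ^ 2) w' := by
  have r : Rp (fun x : Fin m → K => ∑ i, w i * x i ^ 2) w := ⟨LinearMap.id, fun x => rfl⟩
  generalize (fun x : Fin m → K => ∑ i, w i * x i ^ 2) = q at r
  interval_cases hm' : m
  · obtain ⟨e1, k1⟩ := h.ext1
    obtain ⟨e2, k2⟩ := k1.ext2
    obtain ⟨e3, k3⟩ := k2.ext3
    exact ⟨_, k3, ((r.cons e1).cons e2).cons e3⟩
  · obtain ⟨e2, k2⟩ := h.ext2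
    obtain ⟨e3, k3⟩ := k2.ext3
    exact ⟨_, k3, (r.cons e2).cons e3⟩
  · obtain ⟨e3, k3⟩ := h.ext3
    exact ⟨_, k3, r.cons e3⟩
  · exact ⟨_, h, r⟩

theorem Rp.trans {m n l : ℕ} {q : (Fin m → K) → K} {w : Fin n → K} {w' : Fin l → K} (h : Rp q w)
    (h' : Rp (fun x : Fin n → K => ∑ i, w i * x i ^ 2) w') : Rp q w' := by
  obtain ⟨L, hL⟩ := h
  obtain ⟨L', hL'⟩ := h'
  exact ⟨L'.comp L, fun x => by rw [hL]; exact hL' (L x)⟩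

/-- the certified form -/
def phi (P : Par K) (c X Y x1 x2 x3 : K) : Fin 4 → K :=
  ![c, - (c * (P.α * X * x1)), - (c * (P.β * Y * x2)), c * (P.α * X * (P.β * Y) * x3)]

theorem certify [Glob K] {P1 P2 : Par K} (hd : ∀ v : Place K, (v ≠ P1.v0 ∧ v ≠ P1.w1) ∨ (v ≠ P2.v0 ∧ v ≠ P2.w1))
    {w : Fin 4 → K} (h : AN w) : ∃ P : Par K, (P = P1 ∨ P = P2) ∧ ∃ c X Y x1 x2 x3 : K, c ≠ 0 ∧ Cert P X Y x1 x2 x3 ∧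
      Rp (fun x : Fin 4 → K => ∑ i, w i * x i ^ 2) (phi P c X Y x1 x2 x3) := by
  have h0 := h.ne 0
  have h1 := h.ne 1
  have h2 := h.ne 2
  have h3 := h.ne 3
  obtain ⟨a, ha⟩ : ∃ a, a = - w 1 / w 0 := ⟨_, rfl⟩
  have ha0 : a ≠ 0 := by rw [ha]; exact div_ne_zero (neg_ne_zero.2 h1) h0
  have ea : w 1 = - (w 0 * a) := by rw [ha]; field_simp
  obtain ⟨b, hb⟩ : ∃ b, b = - w 2 / w 0 := ⟨_, rfl⟩
  have hb0 : b ≠ 0 := by rw [hb]; exact div_ne_zero (neg_ne_zero.2 h2) h0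
  have eb : w 2 = - (w 0 * b) := by rw [hb]; field_simp
  obtain ⟨d, hd'⟩ : ∃ d, d = w 3 / (w 0 * a * b) := ⟨_, rfl⟩
  have hd0 : d ≠ 0 := by rw [hd']; exact div_ne_zero h3 (mul_ne_zero (mul_ne_zero h0 ha0) hb0)
  have ed : w 3 = w 0 * (a * b * d) := by rw [hd']; field_simp
  obtain ⟨v1, hl, hab⟩ := hasse4 ha0 hb0 hd0 fun x0 x1 x2 x3 e => by
    have := h ![x0, x1, x2, x3] (by simp [Fin.sum_univ_succ, ea, eb, ed]; linear_combination w 0 * e)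
    exact ⟨congrFun this 0, congrFun this 1, congrFun this 2, congrFun this 3⟩
  obtain ⟨P, hP, hv, hv'⟩ : ∃ P : Par K, (P = P1 ∨ P = P2) ∧ v1 ≠ P.v0 ∧ v1 ≠ P.w1 := by
    rcases hd v1 with h | h
    · exact ⟨P1, Or.inl rfl, h⟩
    · exact ⟨P2, Or.inr rfl, h⟩
  obtain ⟨X, Y, x1, x2, x3, hC, s, t, z1, z2, z3, hn, hz1, hz2, hz3, e1, e2, e3⟩ := Cert.complete P ha0 hb0 hd0 hv hv' hl hab
  refine ⟨P, hP, w 0, X, Y, x1, x2, x3, h0, hC, ?_⟩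
  obtain ⟨n, hn'⟩ : ∃ n, n = s ^ 2 - a * d * t ^ 2 := ⟨_, rfl⟩
  rw [← hn'] at hn e2 e3
  refine ⟨Matrix.toLin' !![1, 0, 0, 0; 0, 1 / z1, 0, 0; 0, 0, s / (n * z2), - (a * d * t) / (n * z2);
    0, 0, - t / (n * z3), s / (n * z3)], fun x => ?_⟩
  simp only [phi, e1, e2, e3]
  simp [Fin.sum_univ_succ, Matrix.mulVec, dotProduct, ea, eb, ed]
  field_simp
  rw [hn']
  ring

def Formula (P : Par K) {m : ℕ} (a : Fin m × Fin m → K) : Prop :=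
  ∃ c X Y x1 x2 x3 : K, ∃ T : Fin 4 × Fin m → K, ∃ T' : Fin m × Fin 4 → K, c ≠ 0 ∧ Cert P X Y x1 x2 x3 ∧
    (∀ j l : Fin m, ∑ i, T' (j, i) * T (i, l) = (1 : Matrix (Fin m) (Fin m) K) j l) ∧
    ∀ j l : Fin m, a (j, l) + a (l, j) = 2 * ∑ i, phi P c X Y x1 x2 x3 i * T (i, j) * T (i, l)

theorem Formula.sound [hG : Glob K] {P : Par K} {m : ℕ} {a : Fin m × Fin m → K} (h : Formula P a) (x : Fin m → K)
    (hx : Qf a x = 0) : x = 0 := by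
  obtain ⟨c, X, Y, x1, x2, x3, T, T', hc, hC, hT, ha⟩ := h
  let z : Fin 4 → K := fun i => ∑ j, T (i, j) * x j
  have key : 2 * Qf a x = 2 * ∑ i, phi P c X Y x1 x2 x3 i * z i ^ 2 := by
    have e1 : Qf a x = ∑ j, ∑ l, a (j, l) * x j * x l := by unfold Qf; rw [Fintype.sum_prod_type]
    have e2 : Qf a x = ∑ j, ∑ l, a (l, j) * x j * x l := by
      rw [e1, Finset.sum_comm]
      exact Finset.sum_congr rfl fun i _ => Finset.sum_congr rfl fun j _ => by ring
    rw [two_mul]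
    nth_rewrite 1 [e1]
    rw [e2, ← Finset.sum_add_distrib]
    simp only [← Finset.sum_add_distrib, ← add_mul, ha, z, pow_two, Finset.mul_sum, Finset.sum_mul]
    rw [Finset.sum_comm' (t' := Finset.univ) (s' := fun _ => Finset.univ) (by simp)]
    have : ∀ l : Fin m, ∑ j : Fin m, ∑ i : Fin 4, 2 * (phi P c X Y x1 x2 x3 i * T (i, j) * T (i, l)) * x j * x l =
      ∑ i : Fin 4, ∑ j : Fin m, 2 * (phi P c X Y x1 x2 x3 i * T (i, j) * T (i, l)) * x j * x l := fun l => Finset.sum_comm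
    simp only [this]
    rw [Finset.sum_comm]
    refine Finset.sum_congr rfl fun i _ => Finset.sum_congr rfl fun j _ => Finset.sum_congr rfl fun l _ => ?_
    ring
  have hz : ∑ i, phi P c X Y x1 x2 x3 i * z i ^ 2 = 0 := by
    rw [hx, mul_zero] at key
    exact (mul_eq_zero.1 key.symm).resolve_left hG.two
  have hz' := hC.sound (z0 := z 0) (z1 := z 1) (z2 := z 2) (z3 := z 3) (by
    apply mul_left_cancel₀ hc
    simp [phi, Fin.sum_univ_succ] at hz
    linear_combination hz)
  have hz0 : ∀ i, z i = 0 := by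
    intro i; fin_cases i
    · exact hz'.1
    · exact hz'.2.1
    · exact hz'.2.2.1
    · exact hz'.2.2.2
  ext j
  have e : ∑ i, T' (j, i) * z i = x j := by
    simp only [z, Finset.mul_sum]
    rw [Finset.sum_comm]
    have : ∀ l : Fin m, ∑ i, T' (j, i) * (T (i, l) * x l) = (1 : Matrix (Fin m) (Fin m) K) j l * x l := fun l => by
      rw [← hT, Finset.sum_mul]
      exact Finset.sum_congr rfl fun i _ => by ring
    simp only [this]
    simp [Matrix.one_apply]
  rw [← e]
  simp [hz0]

theorem Formula.complete [hG : Glob K] {P1 P2 : Par K} (hd : ∀ v : Place K, (v ≠ P1.v0 ∧ v ≠ P1.w1) ∨ (v ≠ P2.v0 ∧ v ≠ P2.w1))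
    {m : ℕ} (hm : 1 ≤ m) (hm4 : m ≤ 4) {a : Fin m × Fin m → K} (h : ∀ x, Qf a x = 0 → x = 0) : Formula P1 a ∨ Formula P2 a := by
  obtain ⟨w, e, he⟩ := diag hG.two a
  have hw : AN w := fun x hx => by
    have := h (e.symm x) (by rw [he]; simpa using hx)
    simpa using this
  obtain ⟨w', hw', r⟩ := exists4 hm hm4 hw
  obtain ⟨P, hP, c, X, Y, x1, x2, x3, hc, hC, r'⟩ := certify hd hw'
  have r0 : Rp (Qf a) w := ⟨e.toLinearMap, he⟩
  obtain ⟨L, hL⟩ := (r0.trans r).trans r'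
  have : Formula P a := by
    have hinj : LinearMap.ker L = ⊥ := by
      rw [LinearMap.ker_eq_bot']
      intro x hx
      exact h x (by rw [hL, hx]; simp)
    obtain ⟨g, hg⟩ := L.exists_leftInverse_of_injective hinj
    refine ⟨c, X, Y, x1, x2, x3, fun p => LinearMap.toMatrix' L p.1 p.2, fun p => LinearMap.toMatrix' g p.1 p.2, hc, hC, ?_, ?_⟩
    · intro j l
      have := congrArg LinearMap.toMatrix' hg
      rw [LinearMap.toMatrix'_comp, LinearMap.toMatrix'_id] at this
      rw [← this, Matrix.mul_apply]
    · intro j l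
      let B : (Fin m → K) → (Fin m → K) → K := fun x y => ∑ p : Fin m × Fin m, a p * x p.1 * y p.2
      have hB : ∀ x y, Qf a (x + y) - Qf a x - Qf a y = B x y + B y x := by
        intro x y
        simp only [Qf, B, ← Finset.sum_sub_distrib, ← Finset.sum_add_distrib, Pi.add_apply]
        exact Finset.sum_congr rfl fun i _ => by ring
      have hBs : ∀ j l, B (Pi.single j 1) (Pi.single l 1) = a (j, l) := by
        intro j l
        simp only [B]
        rw [Finset.sum_eq_single (j, l)]
        · simp
        · rintro ⟨p, q⟩ _ hpq
          by_cases h1 : p = j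
          · have : q ≠ l := fun h2 => hpq (by rw [h1, h2])
            simp [this]
          · simp [h1]
        · simp
      have := hB (Pi.single j 1) (Pi.single l 1)
      rw [hBs, hBs] at this
      rw [← this, hL, hL, hL, ← Finset.sum_sub_distrib, ← Finset.sum_sub_distrib, Finset.mul_sum]
      refine Finset.sum_congr rfl fun i _ => ?_
      simp only [map_add, Pi.add_apply, LinearMap.toMatrix'_apply]
      ring
  rcases hP with rfl | rfl
  · exact Or.inl this
  · exact Or.inr this

theorem iso5 [hG : Glob K] {n : ℕ} (a : Fin (n + 5) × Fin (n + 5) → K) : ∃ x, Qf a x = 0 ∧ x ≠ 0 := by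
  obtain ⟨w, e, he⟩ := diag hG.two a
  obtain ⟨x0, x1, x2, x3, x4, h, hne⟩ := five (w 0) (w 1) (w 2) (w 3) (w 4)
  let y : Fin (n + 5) → K := Fin.cons x0 (Fin.cons x1 (Fin.cons x2 (Fin.cons x3 (Fin.cons x4 (0 : Fin n → K)))))
  refine ⟨e.symm y, ?_, ?_⟩
  · rw [he, LinearEquiv.apply_symm_apply, Fin.sum_univ_succ, Fin.sum_univ_succ, Fin.sum_univ_succ, Fin.sum_univ_succ, Fin.sum_univ_succ]
    simp only [y, Fin.cons_zero, Fin.cons_succ]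
    simp only [Pi.zero_apply]
    simp only [zero_pow two_ne_zero, mul_zero, Finset.sum_const_zero, add_zero, ← add_assoc]
    exact h
  · intro hc
    have hy : y = 0 := by simpa using hc
    exact hne ⟨congrFun hy 0, congrFun hy (Fin.succ 0), congrFun hy (Fin.succ (Fin.succ 0)),
      congrFun hy (Fin.succ (Fin.succ (Fin.succ 0))), congrFun hy (Fin.succ (Fin.succ (Fin.succ (Fin.succ 0))))⟩

theorem exists_two_par [Glob K] : ∃ P1 P2 : Par K, ∀ v : Place K, (v ≠ P1.v0 ∧ v ≠ P1.w1) ∨ (v ≠ P2.v0 ∧ v ≠ P2.w1) := by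
  classical
  obtain ⟨P1, -, -⟩ := exists_par (∅ : Finset (Place K))
  obtain ⟨P2, h1, h2⟩ := exists_par ({P1.v0, P1.w1} : Finset (Place K))
  refine ⟨P1, P2, fun v => ?_⟩
  by_contra hc
  push Not at hc
  simp only [Finset.mem_insert, Finset.mem_singleton, not_or] at h1 h2
  obtain ⟨c1, c2⟩ := hc
  by_cases a1 : v = P1.v0
  · by_cases a2 : v = P2.v0
    · exact h1.1 (a2 ▸ a1)
    · exact h2.1 (c2 a2 ▸ a1)
  · by_cases a2 : v = P2.v0
    · exact h1.2 (a2 ▸ c1 a1)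
    · exact h2.2 (c2 a2 ▸ c1 a1)
end GFq

namespace GFq
universe u
variable {K : Type u} [Field K]

def IsPoly {ι : Type} (g : (ι → K) → K) : Prop := ∃ p : MvPolynomial ι K, ∀ a, g a = MvPolynomial.eval a p

section
variable {ι σ : Type} {f g : (ι → K) → K}

theorem IsPoly.const (c : K) : IsPoly (fun _ : ι → K => c) := ⟨MvPolynomial.C c, fun a => by simp⟩
theorem IsPoly.coord (i : ι) : IsPoly (fun q : ι → K => q i) := ⟨MvPolynomial.X i, fun a => by simp⟩
theorem IsPoly.add (hf : IsPoly f) (hg : IsPoly g) : IsPoly (fun q => f q + g q) := by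
  obtain ⟨p, hp⟩ := hf
  obtain ⟨r, hr⟩ := hg
  exact ⟨p + r, fun a => by simp [hp, hr]⟩
theorem IsPoly.mul (hf : IsPoly f) (hg : IsPoly g) : IsPoly (fun q => f q * g q) := by
  obtain ⟨p, hp⟩ := hf
  obtain ⟨r, hr⟩ := hg
  exact ⟨p * r, fun a => by simp [hp, hr]⟩
theorem IsPoly.sub (hf : IsPoly f) (hg : IsPoly g) : IsPoly (fun q => f q - g q) := by
  obtain ⟨p, hp⟩ := hf
  obtain ⟨r, hr⟩ := hg
  exact ⟨p - r, fun a => by simp [hp, hr]⟩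
theorem IsPoly.neg (hf : IsPoly f) : IsPoly (fun q => - f q) := by
  obtain ⟨p, hp⟩ := hf
  exact ⟨- p, fun a => by simp [hp]⟩
theorem IsPoly.pow (hf : IsPoly f) (n : ℕ) : IsPoly (fun q => f q ^ n) := by
  obtain ⟨p, hp⟩ := hf
  exact ⟨p ^ n, fun a => by simp [hp]⟩
theorem IsPoly.sum {J : Type} (s : Finset J) {F : J → (ι → K) → K} (h : ∀ j, IsPoly (F j)) :
    IsPoly (fun q => ∑ j ∈ s, F j q) := by
  choose p hp using h
  exact ⟨∑ j ∈ s, p j, fun a => by rw [map_sum]; exact Finset.sum_congr rfl fun j _ => hp j a⟩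
theorem IsPoly.inl (hf : IsPoly f) : IsPoly (fun q : ι ⊕ σ → K => f (fun i => q (Sum.inl i))) := by
  obtain ⟨p, hp⟩ := hf
  exact ⟨MvPolynomial.rename Sum.inl p, fun a => by rw [MvPolynomial.eval_rename]; exact hp _⟩
end

/-- diophantine predicates -/
def D {ι : Type} (P : (ι → K) → Prop) : Prop :=
  ∃ (σ : Type) (_ : Fintype σ) (f : MvPolynomial (ι ⊕ σ) K), ∀ a, P a ↔ ∃ x : σ → K, MvPolynomial.eval (Sum.elim a x) f = 0

section
variable {ι : Type} {P Q : (ι → K) → Prop}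

theorem D.isDiophantine [Fintype ι] (h : D P) : IsDiophantine {a | P a} := by
  obtain ⟨σ, _, f, hf⟩ := h
  let e := Fintype.equivFin σ
  refine ⟨Fintype.card σ, MvPolynomial.rename (Sum.map id e) f, fun a => ?_⟩
  rw [Set.mem_ofPred_eq, hf]
  constructor
  · rintro ⟨x, hx⟩
    refine ⟨x ∘ e.symm, ?_⟩
    rw [MvPolynomial.eval_rename, Sum.elim_comp_map, Function.comp_assoc]
    simpa using hx
  · rintro ⟨x, hx⟩
    rw [MvPolynomial.eval_rename, Sum.elim_comp_map] at hx
    exact ⟨_, hx⟩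

theorem D.congr (h : D P) (e : ∀ a, Q a ↔ P a) : D Q := by
  obtain ⟨σ, i, f, hf⟩ := h
  exact ⟨σ, i, f, fun a => (e a).trans (hf a)⟩

theorem D.eq {f g : (ι → K) → K} (hf : IsPoly f) (hg : IsPoly g) : D (fun a => f a = g a) := by
  obtain ⟨p, hp⟩ := hf.sub hg
  refine ⟨Empty, inferInstance, MvPolynomial.rename Sum.inl p, fun a => ?_⟩
  simp only [MvPolynomial.eval_rename, Sum.elim_comp_inl, ← hp, sub_eq_zero]
  exact ⟨fun h => ⟨Empty.elim, h⟩, fun ⟨_, h⟩ => h⟩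

theorem D.or (h : D P) (h' : D Q) : D (fun a => P a ∨ Q a) := by
  obtain ⟨σ, i, f, hf⟩ := h
  obtain ⟨τ, j, g, hg⟩ := h'
  refine ⟨σ ⊕ τ, inferInstance, MvPolynomial.rename (Sum.map id Sum.inl) f * MvPolynomial.rename (Sum.map id Sum.inr) g, fun a => ?_⟩
  simp only [map_mul, MvPolynomial.eval_rename, Sum.elim_comp_map, mul_eq_zero, hf, hg, Function.comp_id]
  constructor
  · rintro (⟨x, hx⟩ | ⟨x, hx⟩)
    · exact ⟨Sum.elim x 0, Or.inl (by simpa using hx)⟩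
    · exact ⟨Sum.elim 0 x, Or.inr (by simpa using hx)⟩
  · rintro ⟨x, hx | hx⟩
    · exact Or.inl ⟨_, hx⟩
    · exact Or.inr ⟨_, hx⟩

theorem exists_nonsq [Glob K] : ∃ u : K, ∀ f g : K, f ^ 2 - u * g ^ 2 = 0 ↔ f = 0 ∧ g = 0 := by
  obtain ⟨v, -⟩ := exists_notMem (∅ : Finset (Place K))
  obtain ⟨u, hu, ho, hr⟩ := Place.exists_loc v.gd 0 1
  have hl : ¬ v.lsq u := by rw [Place.lsq_iff hu, hr]; simp
  refine ⟨u, fun f g => ⟨fun h => ?_, fun h => by simp [h.1, h.2]⟩⟩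
  have hg : g = 0 := by
    by_contra hg
    have e : u = (f / g) ^ 2 := by field_simp; linear_combination - h
    have hfg : f / g ≠ 0 := by rintro hc; rw [hc] at e; exact hu (by rw [e]; simp)
    exact hl (e ▸ Place.lsq_of_eq_sq hfg)
  refine ⟨?_, hg⟩
  rw [hg] at h
  simpa using h

theorem D.and [Glob K] (h : D P) (h' : D Q) : D (fun a => P a ∧ Q a) := by
  obtain ⟨σ, i, f, hf⟩ := h
  obtain ⟨τ, j, g, hg⟩ := h'
  obtain ⟨u, hu⟩ := exists_nonsq (K := K)
  refine ⟨σ ⊕ τ, inferInstance, MvPolynomial.rename (Sum.map id Sum.inl) f ^ 2 -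
    MvPolynomial.C u * MvPolynomial.rename (Sum.map id Sum.inr) g ^ 2, fun a => ?_⟩
  simp only [map_sub, map_mul, map_pow, MvPolynomial.eval_C, hu, MvPolynomial.eval_rename, Sum.elim_comp_map, hf, hg, Function.comp_id]
  constructor
  · rintro ⟨⟨x, hx⟩, ⟨y, hy⟩⟩
    exact ⟨Sum.elim x y, by simpa using hx, by simpa using hy⟩
  · rintro ⟨x, hx, hy⟩
    exact ⟨⟨_, hx⟩, ⟨_, hy⟩⟩

theorem D.ex {τ : Type} [Fintype τ] {P : (ι → K) → (τ → K) → Prop}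
    (h : D (fun q : ι ⊕ τ → K => P (fun i => q (Sum.inl i)) (fun i => q (Sum.inr i)))) : D (fun a => ∃ x, P a x) := by
  obtain ⟨σ, i, f, hf⟩ := h
  refine ⟨τ ⊕ σ, inferInstance, MvPolynomial.rename (Equiv.sumAssoc ι τ σ) f, fun a => ?_⟩
  have e : ∀ (x : τ → K) (y : σ → K), Sum.elim a (Sum.elim x y) ∘ (Equiv.sumAssoc ι τ σ) = Sum.elim (Sum.elim a x) y := by
    intro x y
    ext ((i | i) | i) <;> rfl
  constructor
  · rintro ⟨x, hx⟩
    obtain ⟨y, hy⟩ := (hf (Sum.elim a x)).1 hx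
    refine ⟨Sum.elim x y, ?_⟩
    rw [MvPolynomial.eval_rename, e, hy]
  · rintro ⟨z, hz⟩
    refine ⟨fun i => z (Sum.inl i), (hf (Sum.elim a _)).2 ⟨fun i => z (Sum.inr i), ?_⟩⟩
    have e2 : z = Sum.elim (fun i => z (Sum.inl i)) (fun i => z (Sum.inr i)) := by
      ext (i | i) <;> rfl
    rw [MvPolynomial.eval_rename, e2, e] at hz
    exact hz

theorem D.all [Glob K] {J : Type} [Fintype J] {P : J → (ι → K) → Prop} (h : ∀ j, D (P j)) : D (fun a => ∀ j, P j a) := by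
  classical
  have : ∀ s : Finset J, D (fun a => ∀ j ∈ s, P j a) := by
    intro s
    induction s using Finset.induction_on with
    | empty => exact (D.eq (IsPoly.const 0) (IsPoly.const 0)).congr fun a => by simp
    | insert j s hj ih => exact ((h j).and ih).congr fun a => by simp
  exact (this Finset.univ).congr fun a => by simp

theorem D.ne [Glob K] {f : (ι → K) → K} (hf : IsPoly f) : D (fun a => f a ≠ 0) := by
  have : D (fun a => ∃ x : Unit → K, f a * x () = 1) :=
    D.ex (D.eq (hf.inl.mul (IsPoly.coord _)) (IsPoly.const 1))
  refine this.congr fun a => ⟨fun h => ⟨fun _ => (f a)⁻¹, mul_inv_cancel₀ h⟩, ?_⟩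
  rintro ⟨x, hx⟩ h0
  rw [h0] at hx
  simp at hx

theorem D.NN [Glob K] {a b e : (ι → K) → K} (ha : IsPoly a) (hb : IsPoly b) (he : IsPoly e) :
    D (fun q => NN (a q) (b q) (e q)) := by
  have : D (fun q => ∃ x : Fin 3 → K, e q = a q * x 0 ^ 2 + b q * x 1 ^ 2 - a q * b q * x 2 ^ 2) :=
    D.ex (D.eq he.inl (((ha.inl.mul ((IsPoly.coord _).pow 2)).add (hb.inl.mul ((IsPoly.coord _).pow 2))).sub
      ((ha.inl.mul hb.inl).mul ((IsPoly.coord _).pow 2))))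
  refine ((D.ne he).and this).congr fun q => and_congr Iff.rfl ⟨?_, ?_⟩
  · rintro ⟨x, y, z, h⟩
    exact ⟨![x, y, z], h⟩
  · rintro ⟨x, h⟩
    exact ⟨_, _, _, h⟩

theorem D.Small [Glob K] {a b x : (ι → K) → K} (ha : IsPoly a) (hb : IsPoly b) (hx : IsPoly x) :
    D (fun q => Small (a q) (b q) (x q)) := by
  have : D (fun q => ∃ r : Fin 2 → K, GFq.NN (a q) (b q) (r 0) ∧ GFq.NN (a q) (b q) (r 1) ∧ GFq.NN (a q) (b q) (r 0 * r 1) ∧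
      GFq.NN (a q) (b q) (r 0 * (1 + r 0)) ∧ GFq.NN (a q) (b q) (r 1 * (1 + r 1)) ∧ GFq.NN (a q) (b q) ((x q) ^ 2 + r 0 * r 1)) := by
    have c0 : IsPoly (fun q : ι ⊕ Fin 2 → K => q (Sum.inr 0)) := IsPoly.coord _
    have c1 : IsPoly (fun q : ι ⊕ Fin 2 → K => q (Sum.inr 1)) := IsPoly.coord _
    have o : IsPoly (fun q : ι ⊕ Fin 2 → K => (1 : K)) := IsPoly.const _
    exact D.ex ((D.NN ha.inl hb.inl c0).and <| (D.NN ha.inl hb.inl c1).and <| (D.NN ha.inl hb.inl (c0.mul c1)).and <|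
      (D.NN ha.inl hb.inl (c0.mul (o.add c0))).and <| (D.NN ha.inl hb.inl (c1.mul (o.add c1))).and <|
      D.NN ha.inl hb.inl ((hx.inl.pow 2).add (c0.mul c1)))
  refine this.congr fun q => ⟨?_, ?_⟩
  · rintro ⟨r1, r2, h⟩
    exact ⟨![r1, r2], h⟩
  · rintro ⟨r, h⟩
    exact ⟨_, _, h⟩

theorem D.Cert [Glob K] (P : Par K) {X Y x1 x2 x3 : (ι → K) → K} (hX : IsPoly X) (hY : IsPoly Y) (h1 : IsPoly x1) (h2 : IsPoly x2)
    (h3 : IsPoly x3) : D (fun q => Cert P (X q) (Y q) (x1 q) (x2 q) (x3 q)) := by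
  have c : ∀ k : K, IsPoly (fun _ : ι → K => k) := IsPoly.const
  have a := (c P.α).mul hX
  have b := (c P.β).mul hY
  exact (D.ne hX).and <| (D.ne hY).and <| (D.Small (c _) (c _) ((c _).mul (hX.sub (c 1)))).and <|
    (D.Small (c _) (c _) ((c _).mul (hY.sub (c 1)))).and <| (D.Small a b ((c _).mul (h1.sub (c 1)))).and <|
    (D.Small a b ((c _).mul (h2.sub (c 1)))).and (D.Small a b ((c _).mul (h3.sub (c 1))))

end

theorem IsPoly.phi {ι : Type} (P : Par K) {c X Y x1 x2 x3 : (ι → K) → K} (hc : IsPoly c) (hX : IsPoly X) (hY : IsPoly Y)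
    (h1 : IsPoly x1) (h2 : IsPoly x2) (h3 : IsPoly x3) (i : Fin 4) :
    IsPoly (fun q => phi P (c q) (X q) (Y q) (x1 q) (x2 q) (x3 q) i) := by
  have k : ∀ k : K, IsPoly (fun _ : ι → K => k) := IsPoly.const
  have a := (k P.α).mul hX
  have b := (k P.β).mul hY
  fin_cases i
  · exact hc
  · exact (hc.mul (a.mul h1)).neg
  · exact (hc.mul (b.mul h2)).neg
  · exact hc.mul ((a.mul b).mul h3)

theorem D.Formula [Glob K] (P : Par K) (m : ℕ) : D (fun a : Fin m × Fin m → K => Formula P a) := by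
  have : D (fun a : Fin m × Fin m → K => ∃ x : (Fin 6 ⊕ (Fin 4 × Fin m) ⊕ (Fin m × Fin 4)) → K,
      x (Sum.inl 0) ≠ 0 ∧ GFq.Cert P (x (Sum.inl 1)) (x (Sum.inl 2)) (x (Sum.inl 3)) (x (Sum.inl 4)) (x (Sum.inl 5)) ∧
      (∀ j l : Fin m, ∑ i, x (Sum.inr (Sum.inr (j, i))) * x (Sum.inr (Sum.inl (i, l))) = (1 : Matrix (Fin m) (Fin m) K) j l) ∧
      ∀ j l : Fin m, a (j, l) + a (l, j) = 2 * ∑ i, phi P (x (Sum.inl 0)) (x (Sum.inl 1)) (x (Sum.inl 2)) (x (Sum.inl 3))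
        (x (Sum.inl 4)) (x (Sum.inl 5)) i * x (Sum.inr (Sum.inl (i, j))) * x (Sum.inr (Sum.inl (i, l)))) := by
    refine D.ex ((D.ne (IsPoly.coord _)).and <| (D.Cert P (IsPoly.coord _) (IsPoly.coord _) (IsPoly.coord _) (IsPoly.coord _)
      (IsPoly.coord _)).and <| (D.all fun j => D.all fun l => ?_).and (D.all fun j => D.all fun l => ?_))
    · exact D.eq (IsPoly.sum _ fun i => (IsPoly.coord _).mul (IsPoly.coord _)) (IsPoly.const _)
    · exact D.eq ((IsPoly.coord _).add (IsPoly.coord _)) ((IsPoly.const 2).mul (IsPoly.sum _ fun i =>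
        ((IsPoly.phi P (IsPoly.coord _) (IsPoly.coord _) (IsPoly.coord _) (IsPoly.coord _) (IsPoly.coord _) (IsPoly.coord _) i).mul
          (IsPoly.coord _)).mul (IsPoly.coord _)))
  refine this.congr fun a => ⟨?_, ?_⟩
  · rintro ⟨c, X, Y, x1, x2, x3, T, T', h⟩
    exact ⟨Sum.elim ![c, X, Y, x1, x2, x3] (Sum.elim T T'), h⟩
  · rintro ⟨x, h⟩
    exact ⟨_, _, _, _, _, _, fun p => x (Sum.inr (Sum.inl p)), fun p => x (Sum.inr (Sum.inr p)), h⟩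

theorem main [Glob K] (m : ℕ) (hm : 1 ≤ m) : IsDiophantine {a : Fin m × Fin m → K |
      ∀ x : Fin m → K, (∑ p : Fin m × Fin m, a p * x p.1 * x p.2) = 0 → x = 0} := by
  by_cases h4 : m ≤ 4
  · obtain ⟨P1, P2, hP⟩ := exists_two_par (K := K)
    refine D.isDiophantine (((D.Formula P1 m).or (D.Formula P2 m)).congr fun a => ⟨?_, ?_⟩)
    · exact Formula.complete hP hm h4
    · rintro (h | h)
      · exact h.sound
      · exact h.sound
  · obtain ⟨n, rfl⟩ : ∃ n, m = n + 5 := ⟨m - 5, by omega⟩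
    refine D.isDiophantine ((D.eq (IsPoly.const 1) (IsPoly.const 0)).congr fun a => ⟨fun h => ?_, fun h => ?_⟩)
    · obtain ⟨x, hx, hx0⟩ := iso5 a
      exact absurd (h x hx) hx0
    · exact absurd h one_ne_zero

theorem glob_of (Fq : Type*) (K : Type u) [Field Fq] [Fintype Fq] [Field K] [Algebra (RatFunc Fq) K]
    [FiniteDimensional (RatFunc Fq) K] (hq : Odd (Fintype.card Fq)) : Glob K := by
  have : GF Fq (RatFunc Fq) := by
    refine ⟨inferInstance, ?_, ?_⟩
    · have : Algebra.EssFiniteType (Polynomial Fq) (RatFunc Fq) :=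
        Algebra.EssFiniteType.of_isLocalization _ (nonZeroDivisors (Polynomial Fq))
      exact Algebra.EssFiniteType.comp Fq (Polynomial Fq) (RatFunc Fq)
    · have : Algebra.IsAlgebraic (Polynomial Fq) (RatFunc Fq) := 
        (IsFractionRing.comap_isAlgebraic_iff (K := RatFunc Fq)).2 inferInstance
      have e := _root_.lift_trdeg_add_eq Fq (Polynomial Fq) (RatFunc Fq)
      rw [Polynomial.trdeg_of_isDomain, trdeg_eq_zero (R := Polynomial Fq) (A := RatFunc Fq)] at e
      simpa using e.symm
  have h2 : (2 : Fq) ≠ 0 := by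
    intro h
    have : ringChar Fq = 2 := CharP.ringChar_of_prime_eq_zero Nat.prime_two h
    have := FiniteField.even_card_of_char_two this
    rw [← Nat.even_iff] at this
    exact (Nat.not_even_iff_odd.2 hq) this
  have : Glob (RatFunc Fq) := ⟨⟨_, GF.of_range (Fq := Fq)⟩, by
    have := (map_ne_zero (algebraMap Fq (RatFunc Fq))).2 h2
    rwa [map_ofNat] at this⟩
  exact Glob.of_finite (K := RatFunc Fq)

end GFq

/-- Over a global function field `K` of odd characteristic, the set of coefficient matrices
`(a_ij) ∈ K^(m²)` whose associated quadratic form `∑ a_ij x_i x_j` has no nontrivial zero is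
diophantine over `K`. -/
theorem anisotropic_general_diophantine_functionField
    (Fq K : Type*) [Field Fq] [Fintype Fq] [Field K] [Algebra (RatFunc Fq) K]
    [FunctionField Fq K] (hq : Odd (Fintype.card Fq)) (m : ℕ) (hm : 1 ≤ m) :
    IsDiophantine {a : Fin m × Fin m → K |
      ∀ x : Fin m → K, (∑ p : Fin m × Fin m, a p * x p.1 * x p.2) = 0 → x = 0} := by
  have : GFq.Glob K := GFq.glob_of Fq K hq
  exact GFq.main m hm
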